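/- arXiv:math/0606511 — 2 statements merged into one kernel-verified Lean document; each statement's English description precedes it below -/
import Mathlib

section
/- Let k be a field of positive characteristic p, q = p^e, and R → S a surjection of graded k-algebras with S artinian. Assume either that R is a complete intersection (a quotient of a positively graded polynomial ring over k by a homogeneous regular sequence) or that R is Gorenstein and F-pure. If d is the top socle degree of S, then the top socle degree of F_R^e(S) is at least q·d − (q−1)·a(R). -/
open Finset CategoryTheory

section Prelim
variable {k : Type} [Field k] {R : Type} [CommRing R] [Algebra k R]

/-- The irrelevant maximal ideal `m = ⊕_{i>0} R_i` of a graded algebra with pieces `𝒜`. -/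
def irrel (𝒜 : ℕ → Submodule k R) : Ideal R :=
  Ideal.span {x : R | ∃ i, 0 < i ∧ x ∈ 𝒜 i}

/-- The degree-zero piece is exactly `k`. -/
def ZeroPieceIsBase (𝒜 : ℕ → Submodule k R) : Prop :=
  ∀ x ∈ 𝒜 0, ∃ c : k, c • (1 : R) = x

/-- The Frobenius power `I^{[q]}`, generated by the `q`-th powers of the elements of `I`. -/
def frobPow {R : Type} [CommRing R] (I : Ideal R) (q : ℕ) : Ideal R :=
  Ideal.span ((fun x => x ^ q) '' (I : Set R))

/-- The `k`-dimension of the degree-`n` graded piece of the socle `(J : m)/J` of `R/J`. -/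
noncomputable def socCount (𝒜 : ℕ → Submodule k R) (J : Ideal R) (n : ℕ) : ℕ :=
  Module.finrank k ((Submodule.restrictScalars k (J.colon (irrel 𝒜)) ⊓ 𝒜 n) : Submodule k R) -
    Module.finrank k ((Submodule.restrictScalars k J ⊓ 𝒜 n) : Submodule k R)

/-- The socle degrees of `R/J` are `d 0 ≤ … ≤ d (ℓ-1)`, as a multiset. -/
def HasSocleDegrees (𝒜 : ℕ → Submodule k R) (J : Ideal R) {ℓ : ℕ} (d : Fin ℓ → ℕ) : Prop :=
  Monotone d ∧ ∀ n : ℕ, socCount 𝒜 J n = (univ.filter fun i => d i = n).card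

/-- The Hilbert series of `R/J`. -/
noncomputable def hilbQ (𝒜 : ℕ → Submodule k R) (J : Ideal R) : PowerSeries ℤ :=
  PowerSeries.mk fun n =>
    (Module.finrank k ((𝒜 n : Submodule k R)) : ℤ) -
      (Module.finrank k ((Submodule.restrictScalars k J ⊓ 𝒜 n) : Submodule k R) : ℤ)

/-- `a` is the `a`-invariant of `R/J`: for a Cohen-Macaulay graded quotient this is
the degree of the Hilbert series of `R/J` as a rational function, which agrees with the
Goto-Watanabe `a`-invariant defined via graded local cohomology. -/
def IsAInv (𝒜 : ℕ → Submodule k R) (J : Ideal R) (a : ℤ) : Prop :=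
  ∃ num den : Polynomial ℤ, den ≠ 0 ∧
    (den : PowerSeries ℤ) * hilbQ 𝒜 J = (num : PowerSeries ℤ) ∧
    a = (num.natDegree : ℤ) - den.natDegree

/-- `R` is F-pure: if `x ∉ J` then `x^q ∉ J^{[q]}` for all `q = p^e`. -/
def IsFPureRing (R : Type) [CommRing R] (p : ℕ) : Prop :=
  ∀ (J : Ideal R) (x : R), x ∉ J → ∀ e : ℕ, x ^ p ^ e ∉ frobPow J (p ^ e)

/-- A graded `k`-algebra is Cohen-Macaulay iff some homogeneous system of parameters is a
regular sequence. -/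
def IsCMGraded (𝒜 : ℕ → Submodule k R) : Prop :=
  ∃ xs : List R, RingTheory.Sequence.IsRegular R xs ∧
    (∀ x ∈ xs, ∃ i, 0 < i ∧ x ∈ 𝒜 i) ∧
    (Ideal.span {x | x ∈ xs}).radical = irrel 𝒜

/-- A graded `k`-algebra is Gorenstein iff some homogeneous system of parameters is a
regular sequence and the (artinian) quotient by it has one-dimensional socle. -/
def IsGorensteinGraded (𝒜 : ℕ → Submodule k R) : Prop :=
  ∃ xs : List R, RingTheory.Sequence.IsRegular R xs ∧
    (∀ x ∈ xs, ∃ i, 0 < i ∧ x ∈ 𝒜 i) ∧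
    (Ideal.span {x | x ∈ xs}).radical = irrel 𝒜 ∧
    ∃ δ : ℕ, socCount 𝒜 (Ideal.span {x | x ∈ xs}) δ = 1 ∧
      ∀ n : ℕ, n ≠ δ → socCount 𝒜 (Ideal.span {x | x ∈ xs}) n = 0

/-- `x 0, …, x (ℓ-1)` is a minimal generating set for the submodule `N`. -/
def IsMinGenSet {R M : Type} [CommRing R] [AddCommGroup M] [Module R M] {ℓ : ℕ}
    (x : Fin ℓ → M) (N : Submodule R M) : Prop :=
  Submodule.span R (Set.range x) = N ∧ ∀ i, x i ∉ Submodule.span R (x '' {j | j ≠ i})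

/-- `Tor_n^R(M, N)`. -/
noncomputable def TorM (R : Type) [CommRing R] (n : ℕ) (M N : ModuleCat R) : ModuleCat R :=
  ((Tor (ModuleCat R) n).obj M).obj N

/-- `R` viewed as a module over itself via the `e`-th iterate of the Frobenius
endomorphism, i.e. `^{φ_R^e}R`. -/
noncomputable def frobMod (R : Type) [CommRing R] (p : ℕ) [ExpChar R p] (e : ℕ) : ModuleCat R :=
  (ModuleCat.restrictScalars (iterateFrobenius R p e)).obj (ModuleCat.of R R)

/-- `M` has finite projective dimension over the graded algebra `R`: over a Noetherian
graded algebra with `R₀ = k` this is equivalent to the eventual vanishing of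
`Tor_n^R(M, R/m)`, `m` the irrelevant maximal ideal. -/
def HasFinProjDim (𝒜 : ℕ → Submodule k R) (M : ModuleCat R) : Prop :=
  ∃ n : ℕ, ∀ m : ℕ, n ≤ m → Subsingleton (TorM R m M (ModuleCat.of R (R ⧸ irrel 𝒜)))

/-- The degree-`n` graded piece of the twisted graded free module `⊕_j R(-b j)`. -/
def freePiece (𝒬 : ℕ → Submodule k R) {m : ℕ} (b : Fin m → ℕ) (n : ℤ) :
    Submodule k (Fin m → R) :=
  Submodule.pi Set.univ fun j =>
    if 0 ≤ n - (b j : ℤ) then 𝒬 (n - (b j : ℤ)).toNat else ⊥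

/-- The data `(r, b, A)` is a minimal homogeneous free resolution of `R/J` of length `c`:
the `i`-th free module is `⊕_{j < r i} R(-b i j)`, and the differentials are given by the
homogeneous matrices `A i`, with entries in the irrelevant maximal ideal (minimality). -/
def IsMinGradedFreeResolution (𝒜 : ℕ → Submodule k R) (J : Ideal R) (c : ℕ)
    (r : ℕ → ℕ) (b : (i : ℕ) → Fin (r i) → ℕ)
    (A : (i : ℕ) → Matrix (Fin (r i)) (Fin (r (i + 1))) R) : Prop :=
  r 0 = 1 ∧ (∀ j, b 0 j = 0) ∧ (∀ i, c < i → r i = 0) ∧ 0 < r c ∧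
    (∀ i j l, A i j l ∈ 𝒜 (b (i + 1) l - b i j) ∧ (b (i + 1) l < b i j → A i j l = 0)) ∧
    (∀ i j l, A i j l ∈ irrel 𝒜) ∧
    (∀ i, Function.Exact (Matrix.mulVecLin (A (i + 1))) (Matrix.mulVecLin (A i))) ∧
    Function.Exact (Matrix.mulVecLin (A 0))
      ((J.mkQ).comp (∑ j : Fin (r 0), LinearMap.proj j))

end Prelim

/-- A graded `k`-algebra is a complete intersection if it is a quotient of a positively
graded polynomial ring by an ideal generated by a homogeneous regular sequence. -/
def IsGradedCI {k R : Type} [Field k] [CommRing R] [Algebra k R]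
    (𝒜 : ℕ → Submodule k R) : Prop :=
  ∃ (n : ℕ) (w : Fin n → ℕ), (∀ i, 0 < w i) ∧
    ∃ φ : MvPolynomial (Fin n) k →ₐ[k] R,
      Function.Surjective φ ∧
      (∀ (d : ℕ) x, x ∈ MvPolynomial.weightedHomogeneousSubmodule k w d → φ x ∈ 𝒜 d) ∧
      ∃ (c : ℕ) (f : Fin c → MvPolynomial (Fin n) k),
        RingTheory.Sequence.IsRegular (MvPolynomial (Fin n) k) (List.ofFn f) ∧
        (∀ i, ∃ di : ℕ, f i ∈ MvPolynomial.weightedHomogeneousSubmodule k w di) ∧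
        RingHom.ker φ = Ideal.span (Set.range f)


section Work
set_option linter.unusedSectionVars false
variable {k : Type} [Field k] {B : Type} [CommRing B] [Algebra k B]

def NZM (I : Ideal B) (x : B) : Prop := ∀ y, x * y ∈ I → y ∈ I

def RegOn : Ideal B → List B → Prop
  | _, [] => True
  | I, x :: xs => NZM I x ∧ RegOn (I ⊔ Ideal.span {x}) xs

theorem mem_sup_sing {I : Ideal B} {x y : B} :
    y ∈ I ⊔ Ideal.span {x} ↔ ∃ r, y - x * r ∈ I := by
  rw [sup_comm, Ideal.mem_span_singleton_sup]
  constructor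
  · rintro ⟨a, b, hb, rfl⟩
    exact ⟨a, by convert hb using 1; ring⟩
  · rintro ⟨r, hr⟩
    exact ⟨r, _, hr, by ring⟩

theorem NZM.pow {I : Ideal B} {x : B} (h : NZM I x) (N : ℕ) : NZM I (x ^ N) := by
  induction N with
  | zero => intro y hy; simpa using hy
  | succ n ih =>
    intro y hy
    apply ih; apply h
    convert hy using 1; ring

theorem regOn_append (I : Ideal B) (xs ys : List B) :
    RegOn I (xs ++ ys) ↔ RegOn I xs ∧ RegOn (I ⊔ Ideal.ofList xs) ys := by
  induction xs generalizing I with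
  | nil => simp [RegOn]
  | cons x t ih => simp [RegOn, ih, and_assoc, sup_assoc]

variable (𝒜 : ℕ → Submodule k B) [GradedAlgebra 𝒜]

theorem homog_sing {x : B} {d : ℕ} (hx : x ∈ 𝒜 d) : (Ideal.span {x}).IsHomogeneous 𝒜 :=
  Ideal.homogeneous_span _ _ (by rintro _ rfl; exact ⟨d, hx⟩)

theorem homog_ofList {L : List B} (hL : ∀ x ∈ L, ∃ d, 0 < d ∧ x ∈ 𝒜 d) :
    (Ideal.ofList L).IsHomogeneous 𝒜 :=
  Ideal.homogeneous_span _ _ (by intro x hx; obtain ⟨d, -, h⟩ := hL x hx; exact ⟨d, h⟩)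

theorem homog_mem {I : Ideal B} (hI : I.IsHomogeneous 𝒜) {y : B}
    (h : ∀ n, (DirectSum.decompose 𝒜 y n : B) ∈ I) : y ∈ I :=
  (Ideal.IsHomogeneous.mem_iff 𝒜 hI).2 h

theorem decomp_of {n : ℕ} {h : B} (hh : h ∈ 𝒜 n) : (DirectSum.decompose 𝒜 h n : B) = h :=
  DirectSum.decompose_of_mem_same 𝒜 hh

theorem comp_lemma {I : Ideal B} (hI : I.IsHomogeneous 𝒜) {n e : ℕ} {h x r : B}
    (hh : h ∈ 𝒜 n) (hx : x ∈ 𝒜 e) (H : h - x * r ∈ I) :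
    (e ≤ n ∧ ∃ r' ∈ 𝒜 (n - e), h - x * r' ∈ I) ∨ h ∈ I := by
  have H2 := hI n H
  rw [DirectSum.decompose_sub, DirectSum.sub_apply, AddSubgroupClass.coe_sub,
    decomp_of 𝒜 hh] at H2
  by_cases hle : e ≤ n
  · left
    rw [DirectSum.coe_decompose_mul_of_left_mem_of_le 𝒜 hx hle] at H2
    exact ⟨hle, _, SetLike.coe_mem _, H2⟩
  · right
    rw [DirectSum.coe_decompose_mul_of_left_mem_of_not_le 𝒜 hx hle] at H2
    simpa using H2

theorem nzm_of_homog {I : Ideal B} (hI : I.IsHomogeneous 𝒜) {x : B} {e : ℕ} (hx : x ∈ 𝒜 e)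
    (H : ∀ n, ∀ y ∈ 𝒜 n, x * y ∈ I → y ∈ I) : NZM I x := by
  intro y hy
  apply homog_mem 𝒜 hI
  intro n
  apply H n _ (SetLike.coe_mem _)
  rw [← DirectSum.coe_decompose_mul_add_of_left_mem 𝒜 hx]
  exact hI _ hy

theorem swap_lemma {I : Ideal B} (hI : I.IsHomogeneous 𝒜) {a b : B} {d e : ℕ} (hd : 0 < d)
    (ha : a ∈ 𝒜 d) (hb : b ∈ 𝒜 e) (h1 : NZM I a) (h2 : NZM (I ⊔ Ideal.span {a}) b) :
    NZM I b ∧ NZM (I ⊔ Ideal.span {b}) a := by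
  constructor
  · apply nzm_of_homog 𝒜 hI hb
    intro n
    induction n using Nat.strong_induction_on with
    | _ n ih =>
      intro y hy hby
      obtain ⟨r, hr⟩ := mem_sup_sing.1 (h2 y (Ideal.mem_sup_left hby))
      rcases comp_lemma 𝒜 hI hy ha hr with ⟨hle, r', hr', hr2⟩ | h
      · have : r' ∈ I := by
          apply ih (n - d) (by omega) r' hr'
          apply h1
          have : a * (b * r') = b * y - b * (y - a * r') := by ring
          rw [this]
          exact I.sub_mem hby (I.mul_mem_left _ hr2)
        have h3 : y = (y - a * r') + a * r' := by ring
        rw [h3]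
        exact I.add_mem hr2 (I.mul_mem_left _ this)
      · exact h
  · intro y hy
    obtain ⟨z, hz⟩ := mem_sup_sing.1 hy
    have : z ∈ I ⊔ Ideal.span {a} := by
      apply h2
      refine mem_sup_sing.2 ⟨y, ?_⟩
      rw [← neg_mem_iff]; convert hz using 1; ring
    obtain ⟨r, hr⟩ := mem_sup_sing.1 this
    refine mem_sup_sing.2 ⟨r, h1 _ ?_⟩
    have : a * (y - b * r) = (a * y - b * z) + b * (z - a * r) := by ring
    rw [this]
    exact I.add_mem hz (I.mul_mem_left _ hr)

theorem rot_lemma {x : B} (hx : ∃ d, 0 < d ∧ x ∈ 𝒜 d) (t : List B) :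
    ∀ (I : Ideal B), I.IsHomogeneous 𝒜 → (∀ y ∈ t, ∃ d, 0 < d ∧ y ∈ 𝒜 d) →
    RegOn I (x :: t) → RegOn I (t ++ [x]) := by
  induction t with
  | nil => intro I _ _ h; exact h
  | cons y t ih =>
    intro I hI ht h
    obtain ⟨d, hd, hxd⟩ := hx
    obtain ⟨e, he, hye⟩ := ht y (by simp)
    obtain ⟨h1, h2, h3⟩ := h
    obtain ⟨g1, g2⟩ := swap_lemma 𝒜 hI hd hxd hye h1 h2
    refine ⟨g1, ih _ (hI.sup (homog_sing 𝒜 hye)) (fun z hz => ht z (by simp [hz])) ⟨g2, ?_⟩⟩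
    rwa [sup_right_comm]

def GorSoc (I : Ideal B) (δ : ℕ) : Prop :=
  ∃ g ∈ 𝒜 δ, g ∉ I ∧ (∀ x ∈ irrel 𝒜, x * g ∈ I) ∧
    ∀ n, ∀ h ∈ 𝒜 n, (∀ x ∈ irrel 𝒜, x * h ∈ I) → h ∈ I ∨ (n = δ ∧ ∃ c : k, h - c • g ∈ I)

theorem smul_mem_ideal (I : Ideal B) (c : k) {x : B} (hx : x ∈ I) : c • x ∈ I := by
  rw [Algebra.smul_def]; exact I.mul_mem_left _ hx

theorem soc_step {A : Ideal B} (hA : A.IsHomogeneous 𝒜) {x : B} {d : ℕ} (hd : 0 < d)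
    (hx : x ∈ 𝒜 d) (hnz : NZM A x) {δ : ℕ} (hG : GorSoc 𝒜 (A ⊔ Ideal.span {x}) δ) (N : ℕ) :
    GorSoc 𝒜 (A ⊔ Ideal.span {x ^ (N + 1)}) (δ + N * d) := by
  obtain ⟨g, hg, hgI, hgm, hgu⟩ := hG
  have hxN : x ^ N ∈ 𝒜 (N * d) := by simpa using SetLike.pow_mem_graded N hx
  have key : ∀ y, x ^ N * y ∈ A ⊔ Ideal.span {x ^ (N + 1)} ↔ y ∈ A ⊔ Ideal.span {x} := by
    intro y
    rw [mem_sup_sing, mem_sup_sing]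
    constructor
    · rintro ⟨r, hr⟩
      exact ⟨r, hnz.pow N _ (by convert hr using 1; ring)⟩
    · rintro ⟨r, hr⟩
      exact ⟨r, by convert A.mul_mem_left (x ^ N) hr using 1; ring⟩
  refine ⟨x ^ N * g, ?_, ?_, ?_, ?_⟩
  · rw [add_comm]; exact SetLike.mul_mem_graded hxN hg
  · rwa [key]
  · intro y hy
    rw [mul_left_comm, key]; exact hgm y hy
  · intro n h hn hh
    have hxm : x ∈ irrel 𝒜 := Ideal.subset_span ⟨d, hd, hx⟩
    obtain ⟨r, hr⟩ := mem_sup_sing.1 (hh x hxm)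
    have hr2 : h - x ^ N * r ∈ A := hnz _ (by convert hr using 1; ring)
    rcases comp_lemma 𝒜 hA hn hxN hr2 with ⟨hle, r', hr', hr3⟩ | h3
    · have h4 : ∀ y ∈ irrel 𝒜, y * r' ∈ A ⊔ Ideal.span {x} := by
        intro y hy
        rw [← key]
        have : x ^ N * (y * r') = y * h - y * (h - x ^ N * r') := by ring
        rw [this]
        exact Ideal.sub_mem _ (hh y hy) (Ideal.mem_sup_left (A.mul_mem_left _ hr3))
      have h5 : h = (h - x ^ N * r') + x ^ N * r' := by ring
      rcases hgu _ r' hr' h4 with h6 | ⟨h6, c, hc⟩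
      · left
        rw [h5]
        exact Ideal.add_mem _ (Ideal.mem_sup_left hr3) ((key _).2 h6)
      · right
        refine ⟨by omega, c, ?_⟩
        have : h - c • (x ^ N * g) = (h - x ^ N * r') + x ^ N * (r' - c • g) := by
          rw [mul_sub, mul_smul_comm]; ring
        rw [this]
        exact Ideal.add_mem _ (Ideal.mem_sup_left hr3) ((key _).2 hc)
    · exact Or.inl (Ideal.mem_sup_left h3)

/-- bundle: homogeneous regular sequence with one-dimensional socle and full radical. -/
def GoodSeq (L : List B) (ds : List ℕ) : Prop :=
  List.Forall₂ (fun x d => 0 < d ∧ x ∈ 𝒜 d) L ds ∧ RegOn ⊥ L ∧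
    irrel 𝒜 ≤ (Ideal.ofList L).radical ∧ ∃ δ, GorSoc 𝒜 (Ideal.ofList L) δ

theorem forall2_hom {L : List B} {ds : List ℕ}
    (h : List.Forall₂ (fun x d => 0 < d ∧ x ∈ 𝒜 d) L ds) :
    ∀ x ∈ L, ∃ d, 0 < d ∧ x ∈ 𝒜 d := by
  induction h with
  | nil => simp
  | cons h _ ih =>
    intro x hx
    rcases List.mem_cons.1 hx with rfl | hx
    · exact ⟨_, h⟩
    · exact ih x hx

theorem good_step {x : B} {t : List B} {d : ℕ} {ds : List ℕ}
    (h : GoodSeq 𝒜 (x :: t) (d :: ds)) (N : ℕ) :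
    GoodSeq 𝒜 (t ++ [x ^ (N + 1)]) (ds ++ [(N + 1) * d]) := by
  obtain ⟨h1, h2, h3, δ, h4⟩ := h
  obtain ⟨⟨hd, hx⟩, ht⟩ := List.forall₂_cons.1 h1
  have htm := forall2_hom 𝒜 ht
  have hr := rot_lemma 𝒜 ⟨d, hd, hx⟩ t ⊥ (Ideal.IsHomogeneous.bot 𝒜) htm h2
  rw [regOn_append] at hr
  obtain ⟨r1, r2, -⟩ := hr
  rw [bot_sup_eq] at r2
  refine ⟨?_, ?_, ?_, ?_⟩
  · refine List.rel_append ht (List.Forall₂.cons ⟨by positivity, ?_⟩ .nil)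
    simpa using SetLike.pow_mem_graded (N + 1) hx
  · rw [regOn_append]
    refine ⟨r1, ?_, trivial⟩
    rw [bot_sup_eq]; exact r2.pow _
  · refine h3.trans ?_
    rw [Ideal.radical_le_radical_iff, Ideal.ofList_cons, Ideal.ofList_append,
      Ideal.ofList_singleton]
    refine sup_le ?_ ?_
    · rw [Ideal.span_singleton_le_iff_mem]
      exact ⟨N + 1, Ideal.mem_sup_right (Ideal.mem_span_singleton_self _)⟩
    · exact le_sup_left.trans Ideal.le_radical
  · refine ⟨δ + N * d, ?_⟩
    rw [Ideal.ofList_append, Ideal.ofList_singleton]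
    apply soc_step 𝒜 (homog_ofList 𝒜 htm) hd hx r2
    rwa [sup_comm, ← Ideal.ofList_cons]

theorem good_pow_aux (N : ℕ) (xs : List B) : ∀ (ds : List ℕ) (ys : List B) (es : List ℕ),
    List.Forall₂ (fun x d => 0 < d ∧ x ∈ 𝒜 d) xs ds →
    GoodSeq 𝒜 (xs ++ ys) (ds ++ es) →
    GoodSeq 𝒜 (ys ++ xs.map (· ^ (N + 1))) (es ++ ds.map ((N + 1) * ·)) := by
  induction xs with
  | nil =>
    intro ds ys es h h2
    cases h
    simpa using h2
  | cons x t ih =>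
    intro ds ys es h h2
    cases h with
    | cons h h' =>
      rw [List.cons_append, List.cons_append] at h2
      have := good_step 𝒜 h2 N
      rw [List.append_assoc, List.append_assoc] at this
      simpa using ih _ _ _ h' this

theorem good_pow {L : List B} {ds : List ℕ} (h : GoodSeq 𝒜 L ds) {N : ℕ} (hN : 0 < N) :
    GoodSeq 𝒜 (L.map (· ^ N)) (ds.map (N * ·)) := by
  obtain ⟨N, rfl⟩ := Nat.exists_eq_succ_of_ne_zero hN.ne'
  have := good_pow_aux 𝒜 N L ds [] [] h.1 (by simpa using h)
  simpa using this


theorem const_add_irrel (h0 : ZeroPieceIsBase 𝒜) (b : B) : ∃ c : k, b - c • (1 : B) ∈ irrel 𝒜 := by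
  induction b using DirectSum.Decomposition.inductionOn 𝒜 with
  | zero => exact ⟨0, by simp⟩
  | @homogeneous i m =>
    rcases Nat.eq_zero_or_pos i with rfl | hi
    · obtain ⟨c, hc⟩ := h0 m m.2
      exact ⟨c, by rw [hc]; simp⟩
    · have : (m : B) ∈ irrel 𝒜 := Ideal.subset_span ⟨i, hi, m.2⟩
      exact ⟨0, by simpa using this⟩
  | add x y hx hy =>
    obtain ⟨c, hc⟩ := hx
    obtain ⟨d, hd⟩ := hy
    refine ⟨c + d, ?_⟩
    convert Ideal.add_mem _ hc hd using 1
    rw [add_smul]; ring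

theorem quot_finite (h0 : ZeroPieceIsBase 𝒜) (hFT : Algebra.FiniteType k B) {I : Ideal B}
    (hI : irrel 𝒜 ≤ I.radical) : Module.Finite k (B ⧸ I) := by
  have : Algebra.IsIntegral k (B ⧸ I) := by
    constructor
    intro x
    obtain ⟨b, rfl⟩ := Ideal.Quotient.mk_surjective x
    obtain ⟨c, hc⟩ := const_add_irrel 𝒜 h0 b
    obtain ⟨n, hn⟩ := hI hc
    have h1 : IsIntegral k (Ideal.Quotient.mk I (b - c • 1)) := by
      refine IsIntegral.of_pow (n := n + 1) (Nat.succ_pos n) ?_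
      rw [← map_pow, pow_succ, Ideal.Quotient.eq_zero_iff_mem.2 (I.mul_mem_right _ hn)]
      exact isIntegral_zero
    have h2 : Ideal.Quotient.mk I b = Ideal.Quotient.mk I (b - c • 1)
        + algebraMap k (B ⧸ I) c := by
      rw [map_sub, ← Algebra.algebraMap_eq_smul_one]
      exact (sub_add_cancel _ _).symm
    rw [h2]
    exact h1.add isIntegral_algebraMap
  have : Algebra.FiniteType k (B ⧸ I) :=
    hFT.of_surjective (Ideal.Quotient.mkₐ k I) (Ideal.Quotient.mkₐ_surjective k I)
  exact Algebra.IsIntegral.finite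

def Fil (n : ℕ) : Ideal B := Ideal.span {x | ∃ m, n ≤ m ∧ x ∈ 𝒜 m}

theorem fil_comp {n j : ℕ} (hj : j < n) {x : B} (hx : x ∈ Fil 𝒜 n) :
    (DirectSum.decompose 𝒜 x j : B) = 0 := by
  suffices H : ∀ j < n, (DirectSum.decompose 𝒜 x j : B) = 0 from H j hj
  clear hj j
  refine Submodule.span_induction ?_ ?_ ?_ ?_ hx
  · rintro x ⟨m, hm, hx⟩ j hj
    exact DirectSum.decompose_of_mem_ne 𝒜 hx (by omega)
  · intro j _; simp
  · intro x y _ _ hx hy j hj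
    rw [DirectSum.decompose_add, DirectSum.add_apply, Submodule.coe_add, hx j hj, hy j hj, add_zero]
  · intro a x _ hx
    rw [smul_eq_mul]
    induction a using DirectSum.Decomposition.inductionOn 𝒜 with
    | zero => intro j _; simp
    | @homogeneous i m =>
      intro j hj
      rw [DirectSum.coe_decompose_mul_of_left_mem 𝒜 j m.2]
      split_ifs
      · rw [hx _ (by omega), mul_zero]
      · rfl
    | add a b ha hb =>
      intro j hj
      rw [add_mul, DirectSum.decompose_add, DirectSum.add_apply, Submodule.coe_add, ha j hj,
        hb j hj, add_zero]

theorem piece_finite (h0 : ZeroPieceIsBase 𝒜) (hFT : Algebra.FiniteType k B) (n : ℕ) :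
    Module.Finite k (𝒜 n) := by
  have : Module.Finite k (B ⧸ Fil 𝒜 (n + 1)) := by
    apply quot_finite 𝒜 h0 hFT
    refine Ideal.span_le.2 ?_
    rintro x ⟨i, hi, hx⟩
    refine ⟨n + 1, Ideal.subset_span ⟨(n + 1) * i, Nat.le_mul_of_pos_right _ hi, ?_⟩⟩
    simpa using SetLike.pow_mem_graded (n + 1) hx
  refine Module.Finite.of_injective
    ((Ideal.Quotient.mkₐ k (Fil 𝒜 (n + 1))).toLinearMap ∘ₗ (𝒜 n).subtype) ?_
  rw [← LinearMap.ker_eq_bot, LinearMap.ker_eq_bot']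
  intro m hm
  have hm' : (m : B) ∈ Fil 𝒜 (n + 1) := Ideal.Quotient.eq_zero_iff_mem.1 hm
  have := fil_comp 𝒜 (Nat.lt_succ_self n) hm'
  rw [decomp_of 𝒜 m.2] at this
  exact Subtype.ext this

theorem top_exists (h0 : ZeroPieceIsBase 𝒜) (hFT : Algebra.FiniteType k B) {I : Ideal B}
    (hh : I.IsHomogeneous 𝒜) (hI : irrel 𝒜 ≤ I.radical) :
    ∃ n0, ∀ n, n0 ≤ n → ∀ x ∈ 𝒜 n, x ∈ I := by
  have := quot_finite 𝒜 h0 hFT hI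
  have : IsArtinianRing (B ⧸ I) := IsArtinianRing.of_finite k (B ⧸ I)
  let f : ℕ →o (Ideal (B ⧸ I))ᵒᵈ :=
    ⟨fun n => OrderDual.toDual ((Fil 𝒜 n).map (Ideal.Quotient.mk I)), by
      intro a b hab
      apply Ideal.map_mono
      apply Ideal.span_mono
      rintro x ⟨m, hm, hx⟩
      exact ⟨m, hab.trans hm, hx⟩⟩
  obtain ⟨n0, hn0⟩ := IsArtinian.monotone_stabilizes f
  refine ⟨n0, fun n hn x hx => ?_⟩
  have e : (Fil 𝒜 n).map (Ideal.Quotient.mk I) = (Fil 𝒜 (n + 1)).map (Ideal.Quotient.mk I) :=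
    ((hn0 n hn).symm.trans (hn0 (n + 1) (by omega)))
  have h1 : Ideal.Quotient.mk I x ∈ (Fil 𝒜 n).map (Ideal.Quotient.mk I) :=
    Ideal.mem_map_of_mem _ (Ideal.subset_span ⟨n, le_rfl, hx⟩)
  rw [e, Ideal.mem_map_iff_of_surjective _ Ideal.Quotient.mk_surjective] at h1
  obtain ⟨y, hy, hyx⟩ := h1
  have h2 := hh n ((Ideal.Quotient.mk_eq_mk_iff_sub_mem _ _).1 hyx)
  rw [DirectSum.decompose_sub, DirectSum.sub_apply, AddSubgroupClass.coe_sub,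
    decomp_of 𝒜 hx, fil_comp 𝒜 (Nat.lt_succ_self n) hy, zero_sub, neg_mem_iff] at h2
  exact h2

theorem irrel_mul {I : Ideal B} {z : B} (H : ∀ i, 0 < i → ∀ x ∈ 𝒜 i, x * z ∈ I) :
    ∀ x ∈ irrel 𝒜, x * z ∈ I := by
  intro x hx
  refine Submodule.span_induction ?_ ?_ ?_ ?_ hx
  · rintro x ⟨i, hi, hx⟩; exact H i hi x hx
  · simp
  · intro x y _ _ hx hy; rw [add_mul]; exact I.add_mem hx hy
  · intro a x _ hx; rw [smul_eq_mul, mul_assoc]; exact I.mul_mem_left _ hx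

theorem dual1 {I : Ideal B} {n0 δ : ℕ} (hn0 : ∀ n, n0 ≤ n → ∀ x ∈ 𝒜 n, x ∈ I)
    (hG : GorSoc 𝒜 I δ) {z : B} {m : ℕ} (hz : z ∈ 𝒜 m) (hzI : z ∉ I) :
    ∃ j, m + j = δ ∧ ∃ w ∈ 𝒜 j, z * w ∉ I := by
  classical
  let P : ℕ → Prop := fun j => ∃ w ∈ 𝒜 j, z * w ∉ I
  have hb : ∀ j, P j → j ≤ n0 := by
    rintro j ⟨w, hw, hzw⟩
    by_contra hj
    exact hzw (hn0 (m + j) (by omega) _ (SetLike.mul_mem_graded hz hw))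
  have hP0 : P 0 := ⟨1, SetLike.one_mem_graded 𝒜, by simpa using hzI⟩
  obtain ⟨w, hw, hzw⟩ : P (Nat.findGreatest P n0) := Nat.findGreatest_spec (Nat.zero_le _) hP0
  refine ⟨_, ?_, w, hw, hzw⟩
  obtain ⟨g, hg, hgI, hgm, hgu⟩ := hG
  have hirr : ∀ i, 0 < i → ∀ x ∈ 𝒜 i, x * (z * w) ∈ I := by
    intro i hi x hx
    by_contra hcon
    have hP : P (Nat.findGreatest P n0 + i) :=
      ⟨w * x, SetLike.mul_mem_graded hw hx, by convert hcon using 1; ring_nf⟩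
    have := Nat.le_findGreatest (hb _ hP) hP
    omega
  rcases hgu _ (z * w) (SetLike.mul_mem_graded hz hw) (irrel_mul 𝒜 hirr) with h | h
  · exact absurd h hzw
  · exact h.1

theorem dual2 {I J : Ideal B} {n0 δ : ℕ} (hn0 : ∀ n, n0 ≤ n → ∀ x ∈ 𝒜 n, x ∈ I)
    (hG : GorSoc 𝒜 I δ) (hIJ : I ≤ J) (hI : I.IsHomogeneous 𝒜) (hJ : J.IsHomogeneous 𝒜)
    {d : ℕ} (hfin : Module.Finite k (𝒜 d)) {u : B} (hu : u ∈ 𝒜 d) (huJ : u ∉ J) :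
    ∃ e, d + e = δ ∧ ∃ v ∈ 𝒜 e, v ∉ I ∧ ∀ j ∈ J, v * j ∈ I := by
  obtain ⟨e, he, -⟩ := dual1 𝒜 hn0 hG hu (fun h => huJ (hIJ h))
  refine ⟨e, he, ?_⟩
  have hG' := hG
  obtain ⟨g, hg, hgI, hgm, hgu⟩ := hG'
  obtain ⟨lam0, hlam0, hlamI⟩ := Submodule.exists_le_ker_of_notMem
    (p := I.restrictScalars k) (v := g) hgI
  have hlam : ∀ h ∈ 𝒜 δ, h ∉ I → lam0 h ≠ 0 := by
    intro h hh hhI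
    have hirr : ∀ i, 0 < i → ∀ x ∈ 𝒜 i, x * h ∈ I := by
      intro i hi x hx
      by_contra hcon
      obtain ⟨j, hj, -⟩ := dual1 𝒜 hn0 hG (SetLike.mul_mem_graded hx hh) hcon
      omega
    rcases hgu δ h hh (irrel_mul 𝒜 hirr) with h1 | ⟨-, c, hc⟩
    · exact absurd h1 hhI
    · have h2 : lam0 (h - c • g) = 0 := hlamI hc
      rw [map_sub, map_smul, sub_eq_zero] at h2
      rw [h2, smul_eq_mul]
      refine mul_ne_zero ?_ hlam0
      rintro rfl
      apply hhI; simpa using hc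
  have hlamz : ∀ h ∈ I, lam0 h = 0 := fun h hh => hlamI hh
  obtain ⟨ell, hell, hellJ⟩ := Submodule.exists_le_ker_of_notMem
    (p := J.restrictScalars k) (v := u) huJ
  have hellz : ∀ h ∈ J, ell h = 0 := fun h hh => hellJ hh
  let beta : 𝒜 e →ₗ[k] Module.Dual k (𝒜 d) :=
    LinearMap.mk₂ k (fun v y => lam0 ((v : B) * (y : B)))
      (by intros; simp [add_mul]) (by intros; simp) (by intros; simp [mul_add])
      (by intros; simp)
  have hb : ∀ v y, beta v y = lam0 ((v : B) * (y : B)) := fun v y => rfl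
  have hmem : ell ∘ₗ (𝒜 d).subtype ∈ LinearMap.range beta := by
    rw [← Subspace.dualCoannihilator_dualAnnihilator_eq (W := LinearMap.range beta),
      Submodule.mem_dualAnnihilator]
    intro y hy
    rw [Submodule.mem_dualCoannihilator] at hy
    apply hellz
    apply hIJ
    by_contra hcon
    obtain ⟨j, hj, w, hw, hzw⟩ := dual1 𝒜 hn0 hG y.2 hcon
    obtain rfl : j = e := by omega
    have h3 := hy (beta ⟨w, hw⟩) ⟨_, rfl⟩
    rw [hb, mul_comm] at h3
    exact hlam _ (he ▸ SetLike.mul_mem_graded y.2 hw) hzw h3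
  obtain ⟨v, hv⟩ := hmem
  have hv' : ∀ y ∈ 𝒜 d, lam0 ((v : B) * y) = ell y := by
    intro y hy
    rw [← hb v ⟨y, hy⟩, hv]; rfl
  refine ⟨v, v.2, ?_, ?_⟩
  · intro hvI
    apply hell
    rw [← hv' u hu]
    exact hlamz _ (I.mul_mem_right _ hvI)
  · have key : ∀ n, ∀ j ∈ 𝒜 n, j ∈ J → (v : B) * j ∈ I := by
      intro n j hj hjJ
      by_contra hcon
      obtain ⟨i, hi, w, hw, hzw⟩ := dual1 𝒜 hn0 hG (SetLike.mul_mem_graded v.2 hj) hcon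
      have hjw : j * w ∈ 𝒜 d := by
        have := SetLike.mul_mem_graded hj hw
        rwa [show n + i = d by omega] at this
      refine hlam _ ?_ hzw ?_
      · rw [← hi]; exact SetLike.mul_mem_graded (SetLike.mul_mem_graded v.2 hj) hw
      · rw [mul_assoc, hv' _ hjw]
        exact hellz _ (J.mul_mem_right _ hjJ)
    intro j hj
    apply homog_mem 𝒜 hI
    intro n
    rw [DirectSum.coe_decompose_mul_of_left_mem 𝒜 n v.2]
    split_ifs
    · exact key _ _ (SetLike.coe_mem _) (hJ _ hj)
    · exact I.zero_mem

theorem f_step {I : Ideal B} {q : ℕ} {z0 : B} {m0 : ℕ} (hz0 : z0 ∈ 𝒜 m0) (hz0I : z0 ∉ I)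
    (F : List B) : ∀ (ds : List ℕ), List.Forall₂ (fun f d => f ∈ 𝒜 d) F ds →
    (∀ f ∈ F, z0 * f ^ q ∈ I) →
    ∃ m, m + ds.sum ≤ m0 + q * ds.sum ∧ ∃ z ∈ 𝒜 m, z ∉ I ∧ z0 ∣ z ∧ ∀ f ∈ F, z * f ∈ I := by
  classical
  induction F with
  | nil =>
    intro ds h _
    cases h
    exact ⟨m0, by simp, z0, hz0, hz0I, dvd_rfl, by simp⟩
  | cons f F ih =>
    intro ds h hF
    cases h with
    | @cons _ d _ ds hf h =>
      obtain ⟨m, hm, z, hz, hzI, hdvd, hzF⟩ := ih ds h (fun f hf => hF f (by simp [hf]))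
      have hex : ∃ j, z * f ^ j ∈ I := by
        obtain ⟨c, rfl⟩ := hdvd
        refine ⟨q, ?_⟩
        have := I.mul_mem_left c (hF f (by simp))
        convert this using 1; ring
      have hq : Nat.find hex ≤ q := by
        apply Nat.find_min'
        obtain ⟨c, rfl⟩ := hdvd
        have := I.mul_mem_left c (hF f (by simp))
        convert this using 1; ring
      have hpos : Nat.find hex ≠ 0 := by
        intro h0
        have := Nat.find_spec hex
        rw [h0] at this
        apply hzI; simpa using this
      obtain ⟨j, hj⟩ := Nat.exists_eq_succ_of_ne_zero hpos
      have hfj : f ^ j ∈ 𝒜 (j * d) := by simpa using SetLike.pow_mem_graded j hf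
      refine ⟨m + j * d, ?_, z * f ^ j, SetLike.mul_mem_graded hz hfj, ?_,
        hdvd.mul_right _, ?_⟩
      · have : j + 1 ≤ q := by omega
        have := Nat.mul_le_mul_right d this
        simp only [List.sum_cons]
        nlinarith
      · exact Nat.find_min hex (by omega)
      · intro f' hf'
        rcases List.mem_cons.1 hf' with rfl | hf'
        · have := Nat.find_spec hex
          rw [hj] at this
          convert this using 1; rw [pow_succ]; ring
        · have := I.mul_mem_right (f ^ j) (hzF f' hf')
          convert this using 1; ring


theorem rank_null {C : Type} [AddCommGroup C] [Module k C] (f : B →ₗ[k] C) (V : Submodule k B)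
    [Module.Finite k V] :
    Module.finrank k (V.map f) + Module.finrank k (LinearMap.ker f ⊓ V : Submodule k B)
      = Module.finrank k V := by
  have h := LinearMap.finrank_range_add_finrank_ker (f.domRestrict V)
  rw [LinearMap.range_domRestrict] at h
  rw [← h]
  congr 1
  rw [LinearMap.ker_domRestrict, inf_comm, ← Submodule.map_comap_subtype,
    Submodule.finrank_map_subtype_eq]

theorem hilb_coeff (I : Ideal B) (n : ℕ) : PowerSeries.coeff n (hilbQ 𝒜 I) =
    (Module.finrank k ((𝒜 n : Submodule k B)) : ℤ) -
      (Module.finrank k ((Submodule.restrictScalars k I ⊓ 𝒜 n) : Submodule k B) : ℤ) := by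
  rw [hilbQ, PowerSeries.coeff_mk]

theorem hilb_step (hfin : ∀ n, Module.Finite k (𝒜 n)) {I : Ideal B} (hI : I.IsHomogeneous 𝒜)
    {x : B} {d : ℕ} (hx : x ∈ 𝒜 d) (hnz : NZM I x) :
    hilbQ 𝒜 (I ⊔ Ideal.span {x}) = (1 - PowerSeries.X ^ d) * hilbQ 𝒜 I := by
  ext n
  rw [sub_mul, one_mul, map_sub, PowerSeries.coeff_X_pow_mul']
  split_ifs with hle
  · rw [hilb_coeff, hilb_coeff, hilb_coeff]
    set V : Submodule k B := Submodule.restrictScalars k (I ⊔ Ideal.span {x}) ⊓ 𝒜 n with hV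
    let pi : B →ₗ[k] (B ⧸ I) := (Ideal.Quotient.mkₐ k I).toLinearMap
    have hpi : ∀ b, pi b = 0 ↔ b ∈ I := fun b => Ideal.Quotient.eq_zero_iff_mem
    have hfV : Module.Finite k V := Submodule.finiteDimensional_of_le (S₂ := 𝒜 n) inf_le_right
    have h1 := rank_null pi V
    have h2 := rank_null (pi ∘ₗ LinearMap.mulLeft k x) (𝒜 (n - d))
    have e1 : LinearMap.ker pi ⊓ V = Submodule.restrictScalars k I ⊓ 𝒜 n := by
      ext b
      simp only [hV, Submodule.mem_inf, LinearMap.mem_ker, hpi, Submodule.restrictScalars_mem]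
      constructor
      · rintro ⟨h1, h2, h3⟩; exact ⟨h1, h3⟩
      · rintro ⟨h1, h3⟩; exact ⟨h1, Ideal.mem_sup_left h1, h3⟩
    have e2 : LinearMap.ker (pi ∘ₗ LinearMap.mulLeft k x) ⊓ 𝒜 (n - d) =
        Submodule.restrictScalars k I ⊓ 𝒜 (n - d) := by
      ext b
      simp only [Submodule.mem_inf, LinearMap.mem_ker, LinearMap.comp_apply,
        LinearMap.mulLeft_apply, hpi, Submodule.restrictScalars_mem]
      constructor
      · rintro ⟨h1, h3⟩; exact ⟨hnz _ h1, h3⟩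
      · rintro ⟨h1, h3⟩; exact ⟨I.mul_mem_left _ h1, h3⟩
    have e3 : V.map pi = (𝒜 (n - d)).map (pi ∘ₗ LinearMap.mulLeft k x) := by
      ext c
      simp only [Submodule.mem_map, LinearMap.comp_apply, LinearMap.mulLeft_apply]
      constructor
      · rintro ⟨b, ⟨hb1, hb2⟩, rfl⟩
        obtain ⟨r, hr⟩ := mem_sup_sing.1 hb1
        rcases comp_lemma 𝒜 hI hb2 hx hr with ⟨-, r', hr', h⟩ | h
        · refine ⟨r', hr', ?_⟩
          rw [eq_comm, ← sub_eq_zero, ← map_sub, hpi]; exact h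
        · exact ⟨0, Submodule.zero_mem _, by rw [mul_zero, map_zero, (hpi b).2 h]⟩
      · rintro ⟨b, hb, rfl⟩
        refine ⟨x * b, ⟨?_, ?_⟩, rfl⟩
        · exact Ideal.mem_sup_right (Ideal.mul_mem_right _ _ (Ideal.mem_span_singleton_self x))
        · have := SetLike.mul_mem_graded hx hb
          rwa [show d + (n - d) = n by omega] at this
    rw [e1] at h1
    rw [e2, ← e3] at h2
    omega
  · rw [sub_zero, hilb_coeff, hilb_coeff]
    suffices H : Submodule.restrictScalars k (I ⊔ Ideal.span {x}) ⊓ 𝒜 n =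
        Submodule.restrictScalars k I ⊓ 𝒜 n by rw [H]
    refine le_antisymm ?_ ?_
    · rintro b ⟨hb1, hb2⟩
      obtain ⟨r, hr⟩ := mem_sup_sing.1 hb1
      rcases comp_lemma 𝒜 hI hb2 hx hr with ⟨h, -⟩ | h
      · exact absurd h hle
      · exact ⟨h, hb2⟩
    · rintro b ⟨hb1, hb2⟩
      exact ⟨Ideal.mem_sup_left hb1, hb2⟩

open Polynomial in
noncomputable def DP (ds : List ℕ) : ℤ[X] := (ds.map fun d => 1 - X ^ d).prod

theorem hilb_list (hfin : ∀ n, Module.Finite k (𝒜 n)) (L : List B) :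
    ∀ (ds : List ℕ) (I : Ideal B), I.IsHomogeneous 𝒜 →
    List.Forall₂ (fun x d => x ∈ 𝒜 d) L ds → RegOn I L →
    hilbQ 𝒜 (I ⊔ Ideal.ofList L) = (DP ds : PowerSeries ℤ) * hilbQ 𝒜 I := by
  induction L with
  | nil => intro ds I hI h _; cases h; simp [DP]
  | cons x L ih =>
    intro ds I hI h hr
    cases h with
    | @cons _ d _ ds hx h =>
      rw [Ideal.ofList_cons, ← sup_assoc, ih ds _ (hI.sup (homog_sing 𝒜 hx)) h hr.2,
        hilb_step 𝒜 hfin hI hx hr.1]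
      simp only [DP, List.map_cons, List.prod_cons, Polynomial.coe_mul, Polynomial.coe_sub,
        Polynomial.coe_one, Polynomial.coe_pow, Polynomial.coe_X]
      ring

open Polynomial in
theorem natDegree_one_sub_X_pow (d : ℕ) : (1 - X ^ d : ℤ[X]).natDegree = d := by
  rw [← natDegree_neg, neg_sub]
  have := natDegree_X_pow_sub_C (n := d) (r := (1 : ℤ))
  simpa using this

theorem DP_natDegree (ds : List ℕ) (h : DP ds ≠ 0) : (DP ds).natDegree = ds.sum := by
  induction ds with
  | nil => simp [DP]
  | cons d ds ih =>
    have e : DP (d :: ds) = (1 - Polynomial.X ^ d) * DP ds := by simp [DP]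
    rw [e] at h ⊢
    rw [Polynomial.natDegree_mul (left_ne_zero_of_mul h) (right_ne_zero_of_mul h),
      natDegree_one_sub_X_pow, ih (right_ne_zero_of_mul h), List.sum_cons]

theorem DP_ne_zero (ds : List ℕ) (h : ∀ d ∈ ds, 0 < d) : DP ds ≠ 0 := by
  refine List.prod_ne_zero ?_
  intro hm
  obtain ⟨d, hd, h0⟩ := List.mem_map.1 hm
  have := natDegree_one_sub_X_pow d
  rw [h0] at this
  have := h d hd
  simp at *
  omega

theorem hilb_bot_ne [Nontrivial B] (hfin : ∀ n, Module.Finite k (𝒜 n)) : hilbQ 𝒜 ⊥ ≠ 0 := by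
  intro h
  have h1 := hilb_coeff 𝒜 ⊥ 0
  rw [h, map_zero] at h1
  have h2 : (Submodule.restrictScalars k (⊥ : Ideal B) ⊓ 𝒜 0) = ⊥ := by simp
  rw [h2, finrank_bot] at h1
  have h3 : Module.finrank k (𝒜 0) = 0 := by omega
  rw [Submodule.finrank_eq_zero] at h3
  have h4 : (1 : B) ∈ 𝒜 0 := SetLike.one_mem_graded 𝒜
  rw [h3] at h4
  exact one_ne_zero h4

theorem ainv_unique {h : PowerSeries ℤ} (hh : h ≠ 0) {n1 d1 n2 d2 : Polynomial ℤ} (h1 : d1 ≠ 0)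
    (h2 : d2 ≠ 0) (e1 : (d1 : PowerSeries ℤ) * h = n1) (e2 : (d2 : PowerSeries ℤ) * h = n2) :
    (n1.natDegree : ℤ) - d1.natDegree = (n2.natDegree : ℤ) - d2.natDegree := by
  have hn : ∀ {n d : Polynomial ℤ}, d ≠ 0 → (d : PowerSeries ℤ) * h = n → n ≠ 0 := by
    rintro n d hd e rfl
    rw [Polynomial.coe_zero, mul_eq_zero] at e
    rcases e with e | e
    · exact hd (by exact_mod_cast e)
    · exact hh e
  have e : n1 * d2 = n2 * d1 := by
    have : ((n1 * d2 : Polynomial ℤ) : PowerSeries ℤ) = (n2 * d1 : Polynomial ℤ) := by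
      rw [Polynomial.coe_mul, Polynomial.coe_mul, ← e1, ← e2]; ring
    exact_mod_cast this
  have := congrArg Polynomial.natDegree e
  rw [Polynomial.natDegree_mul (hn h1 e1) h2, Polynomial.natDegree_mul (hn h2 e2) h1] at this
  omega

theorem gor_isAInv [Nontrivial B] (h0 : ZeroPieceIsBase 𝒜) (hFT : Algebra.FiniteType k B)
    {L : List B} {ds : List ℕ} (hL : GoodSeq 𝒜 L ds)
    {δ : ℕ} (hG : GorSoc 𝒜 (Ideal.ofList L) δ) : IsAInv 𝒜 ⊥ ((δ : ℤ) - ds.sum) := by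
  have hfin := piece_finite 𝒜 h0 hFT
  obtain ⟨h1, h2, h3, -⟩ := hL
  have hhom := homog_ofList 𝒜 (forall2_hom 𝒜 h1)
  obtain ⟨n0, hn0⟩ := top_exists 𝒜 h0 hFT hhom h3
  have e2 := hilb_list 𝒜 hfin L ds ⊥ (Ideal.IsHomogeneous.bot 𝒜) (h1.imp fun _ _ h => h.2) h2
  rw [bot_sup_eq] at e2
  have hpos : ∀ d ∈ ds, 0 < d := by
    clear e2 hhom hn0 h2 h3 hG
    induction h1 with
    | nil => simp
    | cons h _ ih =>
      intro d hd
      rcases List.mem_cons.1 hd with rfl | hd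
      · exact h.1
      · exact ih d hd
  have hDP := DP_ne_zero ds hpos
  have hc0 : ∀ n, δ < n → PowerSeries.coeff n (hilbQ 𝒜 (Ideal.ofList L)) = 0 := by
    intro n hn
    rw [hilb_coeff]
    have : Submodule.restrictScalars k (Ideal.ofList L) ⊓ 𝒜 n = 𝒜 n := by
      rw [inf_eq_right]
      intro z hz
      by_contra hcon
      obtain ⟨j, hj, -⟩ := dual1 𝒜 hn0 hG hz hcon
      omega
    rw [this, sub_self]
  have hcδ : PowerSeries.coeff δ (hilbQ 𝒜 (Ideal.ofList L)) ≠ 0 := by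
    rw [hilb_coeff]
    obtain ⟨g, hg, hgI, -⟩ := hG
    have : Submodule.restrictScalars k (Ideal.ofList L) ⊓ 𝒜 δ < 𝒜 δ := by
      refine lt_of_le_of_ne inf_le_right ?_
      intro h
      rw [inf_eq_right] at h
      exact hgI (h hg)
    have := Submodule.finrank_lt_finrank_of_lt this
    omega
  have e3 : ((PowerSeries.trunc (δ + 1) (hilbQ 𝒜 (Ideal.ofList L)) : Polynomial ℤ) : PowerSeries ℤ)
      = hilbQ 𝒜 (Ideal.ofList L) := by
    ext n
    rw [Polynomial.coeff_coe, PowerSeries.coeff_trunc]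
    split_ifs with h
    · rfl
    · exact (hc0 n (by omega)).symm
  have hnd : (PowerSeries.trunc (δ + 1) (hilbQ 𝒜 (Ideal.ofList L)) : Polynomial ℤ).natDegree = δ := by
    refine le_antisymm ?_ ?_
    · have := PowerSeries.natDegree_trunc_lt (hilbQ 𝒜 (Ideal.ofList L)) δ
      omega
    · apply Polynomial.le_natDegree_of_ne_zero
      rw [PowerSeries.coeff_trunc, if_pos (Nat.lt_succ_self δ)]
      exact hcδ
  exact ⟨_, _, hDP, e2.symm.trans e3.symm, by rw [hnd, DP_natDegree ds hDP]⟩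

theorem isAInv_unique [Nontrivial B] (h0 : ZeroPieceIsBase 𝒜) (hFT : Algebra.FiniteType k B)
    {a b : ℤ} (ha : IsAInv 𝒜 ⊥ a) (hb : IsAInv 𝒜 ⊥ b) : a = b := by
  obtain ⟨num, den, hden, e, rfl⟩ := ha
  obtain ⟨num', den', hden', e', rfl⟩ := hb
  exact ainv_unique (hilb_bot_ne 𝒜 (piece_finite 𝒜 h0 hFT)) hden hden' e e'

theorem gor_ainv [Nontrivial B] (h0 : ZeroPieceIsBase 𝒜) (hFT : Algebra.FiniteType k B)
    {L : List B} {ds : List ℕ} (hL : GoodSeq 𝒜 L ds) {a : ℤ} (ha : IsAInv 𝒜 ⊥ a)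
    {δ : ℕ} (hG : GorSoc 𝒜 (Ideal.ofList L) δ) : (δ : ℤ) = a + ds.sum := by
  have := isAInv_unique 𝒜 h0 hFT ha (gor_isAInv 𝒜 h0 hFT hL hG)
  omega


theorem exists_pow_all {J : Ideal B} (L : List B) (h : ∀ x ∈ L, x ∈ J.radical) :
    ∃ N, 0 < N ∧ ∀ x ∈ L, x ^ N ∈ J := by
  induction L with
  | nil => exact ⟨1, one_pos, by simp⟩
  | cons y L ih =>
    obtain ⟨N, hN, hL⟩ := ih (fun x hx => h x (by simp [hx]))
    obtain ⟨M, hM⟩ := h y (by simp)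
    refine ⟨N + M, by omega, ?_⟩
    intro x hx
    rw [pow_add]
    rcases List.mem_cons.1 hx with rfl | hx
    · exact J.mul_mem_left _ hM
    · exact J.mul_mem_right _ (hL x hx)

theorem list_sum_mul (N : ℕ) (ds : List ℕ) : (ds.map (N * ·)).sum = N * ds.sum := by
  induction ds with
  | nil => simp
  | cons d ds ih => simp [ih, mul_add]

theorem core [Nontrivial B] (p : ℕ) [Fact p.Prime] [CharP B p] (h0 : ZeroPieceIsBase 𝒜)
    (hFT : Algebra.FiniteType k B) {L : List B} {ds : List ℕ} (hL : GoodSeq 𝒜 L ds)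
    {a : ℤ} (ha : IsAInv 𝒜 ⊥ a) (e q : ℕ) (hq : q = p ^ e)
    (hF : ∀ N, 0 < N → ∀ v, v ∉ Ideal.ofList (L.map (· ^ N)) →
      v ^ q ∉ Ideal.ofList ((L.map (· ^ N)).map (· ^ q)))
    {J : Ideal B} (hJ : J.IsHomogeneous 𝒜) (hrad : irrel 𝒜 ≤ J.radical)
    {d : ℕ} {u : B} (hu : u ∈ 𝒜 d) (huJ : u ∉ J)
    (F : List B) (fs : List ℕ) (hFf : List.Forall₂ (fun f d => f ∈ 𝒜 d) F fs)
    (hFJ : ∀ f ∈ F, f ∈ J) :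
    ∃ n : ℕ, (q : ℤ) * d - ((q : ℤ) - 1) * (a + fs.sum) ≤ (n : ℤ) ∧
      ∃ w ∈ 𝒜 n, w ∉ frobPow J q ⊔ Ideal.ofList F := by
  have hq0 : 0 < q := by rw [hq]; exact pow_pos (Fact.out : p.Prime).pos e
  obtain ⟨N, hN, hNJ⟩ := exists_pow_all L (J := J) (by
    intro x hx
    obtain ⟨i, hi, hxi⟩ := forall2_hom 𝒜 hL.1 x hx
    exact hrad (Ideal.subset_span ⟨i, hi, hxi⟩))
  have g1 := good_pow 𝒜 hL hN
  have g2 := good_pow 𝒜 g1 hq0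
  have hFN := hF N hN
  set L1 := L.map (· ^ N) with hL1
  set L2 := L1.map (· ^ q) with hL2
  set I1 := Ideal.ofList L1 with hI1
  set I2 := Ideal.ofList L2 with hI2
  have hfrob : ∀ y ∈ I1, y ^ q ∈ I2 := by
    intro y hy
    have h1 := Ideal.mem_map_of_mem (iterateFrobenius B p e) hy
    rw [hI1, Ideal.map_ofList] at h1
    have h2 : L1.map (iterateFrobenius B p e) = L2 := by
      rw [hL2]
      apply List.map_congr_left
      intro x _
      rw [iterateFrobenius_def, hq]
    rw [h2, iterateFrobenius_def, ← hq] at h1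
    exact h1
  have hI1J : I1 ≤ J := by
    refine Ideal.span_le.2 ?_
    intro y hy
    obtain ⟨x, hx, rfl⟩ := List.mem_map.1 hy
    exact hNJ x hx
  obtain ⟨δ1, hG1⟩ := g1.2.2.2
  obtain ⟨δ2, hG2⟩ := g2.2.2.2
  have hom1 : I1.IsHomogeneous 𝒜 := homog_ofList 𝒜 (forall2_hom 𝒜 g1.1)
  have hom2 : I2.IsHomogeneous 𝒜 := homog_ofList 𝒜 (forall2_hom 𝒜 g2.1)
  obtain ⟨n1, hn1⟩ := top_exists 𝒜 h0 hFT hom1 g1.2.2.1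
  obtain ⟨n2, hn2⟩ := top_exists 𝒜 h0 hFT hom2 g2.2.2.1
  have a1 := gor_ainv 𝒜 h0 hFT g1 ha hG1
  have a2 := gor_ainv 𝒜 h0 hFT g2 ha hG2
  obtain ⟨c, hc, v, hv, hvI, hvJ⟩ := dual2 𝒜 hn1 hG1 hI1J hom1 hJ
    (piece_finite 𝒜 h0 hFT d) hu huJ
  have hvq : v ^ q ∈ 𝒜 (q * c) := by simpa using SetLike.pow_mem_graded q hv
  have hvqJ : ∀ j ∈ J, v ^ q * j ^ q ∈ I2 := by
    intro j hj
    rw [← mul_pow]; exact hfrob _ (hvJ j hj)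
  obtain ⟨m, hm, z, hz, hzI, hdvd, hzF⟩ := f_step 𝒜 (q := q) hvq (hFN v hvI) F fs hFf
    (fun f hf => hvqJ f (hFJ f hf))
  obtain ⟨n, hn, w, hw, hzw⟩ := dual1 𝒜 hn2 hG2 hz hzI
  refine ⟨n, ?_, w, hw, ?_⟩
  · rw [list_sum_mul q] at a2
    generalize (ds.map (N * ·)).sum = S at a1 a2
    generalize fs.sum = T at hm ⊢
    push_cast at a2
    zify at hm hn hc
    have h1 : (q : ℤ) * δ1 = q * d + q * c := by rw [← hc]; ring
    have h2 : (q : ℤ) * δ1 = q * a + q * (S : ℤ) := by rw [a1]; ring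
    nlinarith
  · intro hwI
    apply hzw
    have hle : frobPow J q ⊔ Ideal.ofList F ≤ I2.colon {z} := by
      refine sup_le (Ideal.span_le.2 ?_) (Ideal.span_le.2 ?_)
      · rintro _ ⟨j, hj, rfl⟩
        obtain ⟨c, rfl⟩ := hdvd
        simp only [SetLike.mem_coe, Submodule.mem_colon_singleton, smul_eq_mul]
        have := I2.mul_mem_left c (hvqJ j hj)
        convert this using 1; ring
      · intro f hf
        simp only [SetLike.mem_coe, Submodule.mem_colon_singleton, smul_eq_mul]
        rw [mul_comm]; exact hzF f hf
    have := hle hwI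
    rw [Submodule.mem_colon_singleton, smul_eq_mul, mul_comm] at this
    exact this

theorem regOn_of_weak (suf : List B) : ∀ pre : List B,
    RingTheory.Sequence.IsWeaklyRegular B (pre ++ suf) → RegOn (Ideal.ofList pre) suf := by
  induction suf with
  | nil => intro _ _; trivial
  | cons x t ih =>
    intro pre h
    refine ⟨?_, ?_⟩
    · rw [RingTheory.Sequence.isWeaklyRegular_append_iff,
        RingTheory.Sequence.isWeaklyRegular_cons_iff] at h
      intro y hy
      have h1 : x • (Submodule.Quotient.mk y : B ⧸ (Ideal.ofList pre • ⊤ : Submodule B B)) =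
          x • 0 := by
        rw [smul_zero, ← Submodule.Quotient.mk_smul, Submodule.Quotient.mk_eq_zero]
        simpa using hy
      have h2 := h.2.1 h1
      rw [Submodule.Quotient.mk_eq_zero] at h2
      simpa using h2
    · have := ih (pre ++ [x]) (by simpa using h)
      rwa [Ideal.ofList_append, Ideal.ofList_singleton] at this

theorem regOn_of_reg {L : List B} (h : RingTheory.Sequence.IsRegular B L) : RegOn ⊥ L := by
  have := regOn_of_weak L [] (by simpa using h.toIsWeaklyRegular)
  rwa [Ideal.ofList_nil] at this

theorem exists_degs {P : B → ℕ → Prop} (L : List B) (h : ∀ x ∈ L, ∃ d, P x d) :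
    ∃ ds, List.Forall₂ P L ds := by
  induction L with
  | nil => exact ⟨[], .nil⟩
  | cons x L ih =>
    obtain ⟨ds, hds⟩ := ih (fun y hy => h y (by simp [hy]))
    obtain ⟨d, hd⟩ := h x (by simp)
    exact ⟨d :: ds, .cons hd hds⟩

theorem gorSoc_of_count (hfin : ∀ n, Module.Finite k (𝒜 n)) {I : Ideal B} {δ : ℕ}
    (h1 : socCount 𝒜 I δ = 1) (h2 : ∀ n, n ≠ δ → socCount 𝒜 I n = 0) : GorSoc 𝒜 I δ := by
  have hle : ∀ n, (Submodule.restrictScalars k I ⊓ 𝒜 n : Submodule k B) ≤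
      Submodule.restrictScalars k (I.colon (irrel 𝒜)) ⊓ 𝒜 n := by
    intro n x hx
    refine ⟨?_, hx.2⟩
    rw [SetLike.mem_coe, Submodule.restrictScalars_mem, Submodule.mem_colon]
    intro s _
    exact I.mul_mem_right _ hx.1
  have hmem : ∀ n (h : B), h ∈ 𝒜 n → (∀ x ∈ irrel 𝒜, x * h ∈ I) →
      h ∈ (Submodule.restrictScalars k (I.colon (irrel 𝒜)) ⊓ 𝒜 n : Submodule k B) := by
    intro n h hn hh
    refine ⟨?_, hn⟩
    rw [SetLike.mem_coe, Submodule.restrictScalars_mem, Submodule.mem_colon]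
    intro s hs
    rw [smul_eq_mul, mul_comm]; exact hh s hs
  have hfd : ∀ n, Module.Finite k
      (Submodule.restrictScalars k (I.colon (irrel 𝒜)) ⊓ 𝒜 n : Submodule k B) := fun n =>
    Submodule.finiteDimensional_of_le (S₂ := 𝒜 n) inf_le_right
  have hne : ¬ (Submodule.restrictScalars k (I.colon (irrel 𝒜)) ⊓ 𝒜 δ : Submodule k B) ≤
      Submodule.restrictScalars k I ⊓ 𝒜 δ := by
    intro h
    have := le_antisymm h (hle δ)
    rw [socCount, this] at h1
    omega
  obtain ⟨g, hg, hgI⟩ := SetLike.not_le_iff_exists.1 hne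
  have hgI' : g ∉ I := fun h => hgI ⟨h, hg.2⟩
  refine ⟨g, hg.2, hgI', ?_, ?_⟩
  · intro x hx
    have := hg.1
    rw [SetLike.mem_coe, Submodule.restrictScalars_mem, Submodule.mem_colon] at this
    have := this x hx
    rwa [smul_eq_mul, mul_comm] at this
  · intro n h hn hh
    by_cases hnδ : n = δ
    · subst hnδ
      right
      refine ⟨rfl, ?_⟩
      have hm := hmem n h hn hh
      have hsup : (Submodule.restrictScalars k I ⊓ 𝒜 n : Submodule k B) ⊔ Submodule.span k {g} =
          Submodule.restrictScalars k (I.colon (irrel 𝒜)) ⊓ 𝒜 n := by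
        apply Submodule.eq_of_le_of_finrank_le
        · refine sup_le (hle n) ?_
          rw [Submodule.span_singleton_le_iff_mem]; exact hg
        · have hlt : (Submodule.restrictScalars k I ⊓ 𝒜 n : Submodule k B) <
              (Submodule.restrictScalars k I ⊓ 𝒜 n : Submodule k B) ⊔ Submodule.span k {g} := by
            refine lt_of_le_of_ne le_sup_left ?_
            intro hh
            apply hgI
            rw [hh]
            exact Submodule.mem_sup_right (Submodule.mem_span_singleton_self g)
          have : Module.Finite k ((Submodule.restrictScalars k I ⊓ 𝒜 n : Submodule k B) ⊔
              Submodule.span k {g} : Submodule k B) :=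
            Submodule.finiteDimensional_of_le (S₂ := 𝒜 n) (sup_le inf_le_right (by
              rw [Submodule.span_singleton_le_iff_mem]; exact hg.2))
          have := Submodule.finrank_lt_finrank_of_lt hlt
          rw [socCount] at h1
          omega
      rw [← hsup] at hm
      obtain ⟨i, hi, y, hy, rfl⟩ := Submodule.mem_sup.1 hm
      obtain ⟨c, rfl⟩ := Submodule.mem_span_singleton.1 hy
      exact ⟨c, by simpa using hi.1⟩
    · left
      have h3 := h2 n hnδ
      rw [socCount] at h3
      have := Submodule.eq_of_le_of_finrank_le (hle n) (by omega)
      have hm := hmem n h hn hh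
      rw [← this] at hm
      exact hm.1

theorem fpure_case [Nontrivial B] (p : ℕ) [Fact p.Prime] [CharP B p] (h0 : ZeroPieceIsBase 𝒜)
    (hFT : Algebra.FiniteType k B) (hG : IsGorensteinGraded 𝒜) (hP : IsFPureRing B p)
    {a : ℤ} (ha : IsAInv 𝒜 ⊥ a) (e q : ℕ) (hq : q = p ^ e)
    {J : Ideal B} (hJ : J.IsHomogeneous 𝒜) (hrad : irrel 𝒜 ≤ J.radical)
    {d : ℕ} {u : B} (hu : u ∈ 𝒜 d) (huJ : u ∉ J) :
    ∃ n : ℕ, (q : ℤ) * d - ((q : ℤ) - 1) * a ≤ (n : ℤ) ∧ ∃ w ∈ 𝒜 n, w ∉ frobPow J q := by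
  obtain ⟨xs, h1, h2, h3, δ, h4, h5⟩ := hG
  obtain ⟨ds, hds⟩ := exists_degs xs h2
  have hL : GoodSeq 𝒜 xs ds := ⟨hds, regOn_of_reg h1, h3.ge,
    δ, gorSoc_of_count 𝒜 (piece_finite 𝒜 h0 hFT) h4 h5⟩
  obtain ⟨n, hn, w, hw, hwJ⟩ := core 𝒜 p h0 hFT hL ha e q hq (by
    intro N hN v hv hcon
    subst hq
    refine hP _ v hv e ?_
    refine Ideal.span_mono ?_ hcon
    intro y hy
    obtain ⟨x, hx, rfl⟩ := List.mem_map.1 hy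
    exact ⟨x, Ideal.subset_span hx, rfl⟩) hJ hrad hu huJ [] [] .nil (by simp)
  refine ⟨n, by simpa using hn, w, hw, fun h => hwJ (Ideal.mem_sup_left h)⟩


open MvPolynomial in
theorem mv_nzm {n : ℕ} (s : Set (Fin n)) (i : Fin n) (hi : i ∉ s) :
    NZM (Ideal.span ((X : Fin n → MvPolynomial (Fin n) k) '' s)) (X i) := by
  intro y hy
  rw [mem_ideal_span_X_image] at hy ⊢
  intro m hm
  have h1 : Finsupp.single i 1 + m ∈ (X i * y).support := by
    rw [mem_support_iff, coeff_X_mul]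
    exact mem_support_iff.1 hm
  obtain ⟨j, hj, h2⟩ := hy _ h1
  refine ⟨j, hj, ?_⟩
  have hne : i ≠ j := by rintro rfl; exact hi hj
  simpa [Finsupp.single_apply, hne] using h2

open MvPolynomial in
theorem mv_reg {n : ℕ} (l : List (Fin n)) : ∀ (s : Set (Fin n)), l.Nodup → (∀ i ∈ l, i ∉ s) →
    RegOn (Ideal.span ((X : Fin n → MvPolynomial (Fin n) k) '' s)) (l.map X) := by
  induction l with
  | nil => intro s _ _; trivial
  | cons i l ih =>
    intro s hn hs
    refine ⟨mv_nzm s i (hs i (by simp)), ?_⟩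
    have h := ih (insert i s) (List.nodup_cons.1 hn).2 (by
      intro j hj
      simp only [Set.mem_insert_iff, not_or]
      refine ⟨?_, hs j (by simp [hj])⟩
      rintro rfl
      exact (List.nodup_cons.1 hn).1 hj)
    rwa [Set.image_insert_eq, Ideal.span_insert, sup_comm] at h

open MvPolynomial in
theorem mv_ofList {n : ℕ} : Ideal.ofList ((List.finRange n).map
    (X : Fin n → MvPolynomial (Fin n) k)) = Ideal.span (X '' Set.univ) := by
  unfold Ideal.ofList
  congr 1
  ext x; simp

open MvPolynomial in
theorem mv_sub_C {n : ℕ} (h : MvPolynomial (Fin n) k) :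
    h - C (coeff 0 h) ∈ Ideal.span ((X : Fin n → MvPolynomial (Fin n) k) '' Set.univ) := by
  rw [mem_ideal_span_X_image]
  intro m hm
  by_contra hcon
  push Not at hcon
  have : m = 0 := by ext i; simpa using hcon i (Set.mem_univ i)
  subst this
  rw [mem_support_iff] at hm
  simp at hm

open MvPolynomial in
theorem mv_coeff_zero {n : ℕ} (w : Fin n → ℕ) {d : ℕ} (hd : d ≠ 0)
    {h : MvPolynomial (Fin n) k} (hh : h ∈ weightedHomogeneousSubmodule k w d) :
    coeff 0 h = 0 := by
  by_contra hc
  have := (mem_weightedHomogeneousSubmodule k w d h).1 hh hc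
  simp at this
  exact hd this.symm

open MvPolynomial in
theorem mv_zero {n : ℕ} (w : Fin n → ℕ) (hw : ∀ i, 0 < w i) :
    ZeroPieceIsBase (weightedHomogeneousSubmodule k w) := by
  intro x hx
  refine ⟨coeff 0 x, ?_⟩
  rw [← Algebra.algebraMap_eq_smul_one, algebraMap_eq]
  ext m
  rw [coeff_C]
  split_ifs with h
  · rw [h]
  · by_contra hc
    have h1 := (mem_weightedHomogeneousSubmodule k w 0 x).1 hx (Ne.symm hc)
    apply h
    rw [Finsupp.weight_apply, Finsupp.sum, Finset.sum_eq_zero_iff] at h1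
    ext i
    by_contra hi
    have h2 := h1 i (Finsupp.mem_support_iff.2 (Ne.symm hi))
    simp only [smul_eq_mul, mul_eq_zero] at h2
    rcases h2 with h2 | h2
    · exact hi h2.symm
    · exact (hw i).ne' h2

open MvPolynomial in
theorem mv_gor {n : ℕ} (w : Fin n → ℕ) :
    GorSoc (weightedHomogeneousSubmodule k w)
      (Ideal.span ((X : Fin n → MvPolynomial (Fin n) k) '' Set.univ)) 0 := by
  have hmem : ∀ d, d ≠ 0 → ∀ x ∈ weightedHomogeneousSubmodule k w d,
      x ∈ Ideal.span ((X : Fin n → MvPolynomial (Fin n) k) '' Set.univ) := by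
    intro d hd x hx
    have := mv_sub_C x
    rwa [mv_coeff_zero w hd hx, C_0, sub_zero] at this
  refine ⟨1, isWeightedHomogeneous_one k w, ?_, ?_, ?_⟩
  · rw [mem_ideal_span_X_image]
    intro h
    obtain ⟨i, -, hi⟩ := h 0 (by rw [mem_support_iff]; simp)
    simp at hi
  · intro x hx
    rw [mul_one]
    refine Ideal.span_le.2 ?_ hx
    rintro y ⟨i, hi, hy⟩
    exact hmem i hi.ne' y hy
  · intro d h hd _
    by_cases h0 : d = 0
    · right
      refine ⟨h0, coeff 0 h, ?_⟩
      rw [← Algebra.algebraMap_eq_smul_one, algebraMap_eq]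
      exact mv_sub_C h
    · left; exact hmem d h0 h hd

open MvPolynomial in
theorem mv_good {n : ℕ} (w : Fin n → ℕ) (hw : ∀ i, 0 < w i) :
    GoodSeq (weightedHomogeneousSubmodule k w) ((List.finRange n).map X)
      ((List.finRange n).map w) := by
  refine ⟨?_, ?_, ?_, 0, ?_⟩
  · rw [List.forall₂_map_left_iff, List.forall₂_map_right_iff, List.forall₂_same]
    intro i _
    exact ⟨hw i, isWeightedHomogeneous_X k w i⟩
  · have := mv_reg (k := k) (List.finRange n) ∅ (List.nodup_finRange n) (by simp)
    simpa using this
  · refine le_trans ?_ Ideal.le_radical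
    rw [mv_ofList]
    refine Ideal.span_le.2 ?_
    rintro y ⟨i, hi, hy⟩
    have := mv_sub_C y
    rwa [mv_coeff_zero w hi.ne' hy, C_0, sub_zero] at this
  · rw [mv_ofList]; exact mv_gor w

open MvPolynomial in
theorem mv_coeff_frob {n : ℕ} (p : ℕ) [Fact p.Prime] [CharP k p] (e : ℕ)
    (v : MvPolynomial (Fin n) k) (m : Fin n →₀ ℕ) :
    coeff (p ^ e • m) (v ^ p ^ e) = coeff m v ^ p ^ e := by
  classical
  have hp : 0 < p ^ e := pow_pos (Fact.out : p.Prime).pos e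
  induction v using MvPolynomial.induction_on' with
  | monomial u a =>
    rw [monomial_pow, coeff_monomial, coeff_monomial]
    by_cases h : u = m
    · simp [h]
    · rw [if_neg h, if_neg, zero_pow hp.ne']
      intro h2
      apply h
      ext i
      have := DFunLike.congr_fun h2 i
      simp only [Finsupp.smul_apply, smul_eq_mul] at this
      exact Nat.eq_of_mul_eq_mul_left hp this
  | add a b ha hb =>
    rw [add_pow_char_pow, coeff_add, coeff_add, ha, hb, add_pow_char_pow]

open MvPolynomial in
theorem mv_powIdeal {n : ℕ} (N : ℕ) (v : MvPolynomial (Fin n) k) :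
    v ∈ Ideal.ofList (((List.finRange n).map
      (X : Fin n → MvPolynomial (Fin n) k)).map (· ^ N)) ↔
      ∀ m ∈ v.support, ∃ i, N ≤ m i := by
  have : Ideal.ofList (((List.finRange n).map
      (X : Fin n → MvPolynomial (Fin n) k)).map (· ^ N)) =
      Ideal.span ((fun s => monomial s (1 : k)) '' (Set.range fun i => Finsupp.single i N)) := by
    unfold Ideal.ofList
    congr 1
    ext x
    simp [X_pow_eq_monomial]
  rw [this, mem_ideal_span_monomial_image]
  simp

open MvPolynomial in
theorem mv_frob {n : ℕ} (p : ℕ) [Fact p.Prime] [CharP k p] (e q : ℕ) (hq : q = p ^ e) (N : ℕ)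
    (v : MvPolynomial (Fin n) k)
    (hv : v ∉ Ideal.ofList (((List.finRange n).map X).map (· ^ N))) :
    v ^ q ∉ Ideal.ofList ((((List.finRange n).map X).map (· ^ N)).map (· ^ q)) := by
  have hp : 0 < q := by rw [hq]; exact pow_pos (Fact.out : p.Prime).pos e
  have e1 : (((List.finRange n).map (X : Fin n → MvPolynomial (Fin n) k)).map (· ^ N)).map (· ^ q)
      = ((List.finRange n).map X).map (· ^ (N * q)) := by
    rw [List.map_map]
    congr 1
    ext x : 1
    simp [pow_mul]
  rw [e1, mv_powIdeal]
  rw [mv_powIdeal] at hv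
  push Not at hv
  obtain ⟨m, hm, hmN⟩ := hv
  intro H
  obtain ⟨i, hi⟩ := H (q • m) (by
    rw [mem_support_iff, hq, mv_coeff_frob]
    exact pow_ne_zero _ (mem_support_iff.1 hm))
  have := hmN i
  simp only [Finsupp.smul_apply, smul_eq_mul] at hi
  nlinarith

theorem phi_comp {P : Type} [CommRing P] [Algebra k P] (𝒢 : ℕ → Submodule k P) [GradedAlgebra 𝒢]
    (φ : P →ₐ[k] B) (hφ : ∀ d, ∀ x ∈ 𝒢 d, φ x ∈ 𝒜 d) (y : P) (n : ℕ) :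
    (DirectSum.decompose 𝒜 (φ y) n : B) = φ (DirectSum.decompose 𝒢 y n : P) := by
  induction y using DirectSum.Decomposition.inductionOn 𝒢 with
  | zero => simp
  | @homogeneous i m =>
    by_cases h : i = n
    · subst h
      rw [decomp_of 𝒜 (hφ i _ m.2), decomp_of 𝒢 m.2]
    · rw [DirectSum.decompose_of_mem_ne 𝒜 (hφ i _ m.2) h,
        DirectSum.decompose_of_mem_ne 𝒢 m.2 h, map_zero]
  | add a b ha hb =>
    rw [map_add, DirectSum.decompose_add, DirectSum.add_apply, Submodule.coe_add, ha, hb,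
      DirectSum.decompose_add, DirectSum.add_apply, Submodule.coe_add, map_add]

theorem phi_hilb {P : Type} [CommRing P] [Algebra k P] (𝒢 : ℕ → Submodule k P) [GradedAlgebra 𝒢]
    (hfin : ∀ n, Module.Finite k (𝒢 n))
    (φ : P →ₐ[k] B) (hsurj : Function.Surjective φ) (hφ : ∀ d, ∀ x ∈ 𝒢 d, φ x ∈ 𝒜 d) :
    hilbQ 𝒜 ⊥ = hilbQ 𝒢 (RingHom.ker φ) := by
  ext n
  rw [hilb_coeff, hilb_coeff]
  have h1 := rank_null φ.toLinearMap (𝒢 n)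
  have e1 : (𝒢 n).map φ.toLinearMap = 𝒜 n := by
    ext r
    constructor
    · rintro ⟨y, hy, rfl⟩; exact hφ n y hy
    · intro hr
      obtain ⟨y, rfl⟩ := hsurj r
      refine ⟨_, SetLike.coe_mem (DirectSum.decompose 𝒢 y n), ?_⟩
      rw [AlgHom.toLinearMap_apply, ← phi_comp 𝒜 𝒢 φ hφ, decomp_of 𝒜 hr]
  have e2 : LinearMap.ker φ.toLinearMap = Submodule.restrictScalars k (RingHom.ker φ) := by
    ext y; simp [RingHom.mem_ker]
  have e3 : (Submodule.restrictScalars k (⊥ : Ideal B) ⊓ 𝒜 n) = ⊥ := by simp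
  rw [e1, e2] at h1
  rw [e3, finrank_bot]
  omega

theorem ci_gen [Nontrivial B] (p : ℕ) [Fact p.Prime] [CharP B p] (h0 : ZeroPieceIsBase 𝒜)
    (hFT : Algebra.FiniteType k B)
    {a : ℤ} (ha : IsAInv 𝒜 ⊥ a) (e q : ℕ) (hq : q = p ^ e)
    {J : Ideal B} (hJ : J.IsHomogeneous 𝒜) (hrad : irrel 𝒜 ≤ J.radical)
    {d : ℕ} {u : B} (hu : u ∈ 𝒜 d) (huJ : u ∉ J)
    {P : Type} [CommRing P] [Algebra k P] [Nontrivial P] [CharP P p]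
    (𝒢 : ℕ → Submodule k P) [GradedAlgebra 𝒢]
    (φ : P →ₐ[k] B) (hsurj : Function.Surjective φ) (hφ : ∀ d, ∀ x ∈ 𝒢 d, φ x ∈ 𝒜 d)
    (hFTP : Algebra.FiniteType k P) (h0P : ZeroPieceIsBase 𝒢)
    {L : List P} {ds : List ℕ} (hgood : GoodSeq 𝒢 L ds)
    (hF : ∀ N, 0 < N → ∀ v, v ∉ Ideal.ofList (L.map (· ^ N)) →
      v ^ q ∉ Ideal.ofList ((L.map (· ^ N)).map (· ^ q)))
    {c : ℕ} (f : Fin c → P) (hreg : RingTheory.Sequence.IsRegular P (List.ofFn f))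
    (hfd : ∀ i, ∃ di : ℕ, f i ∈ 𝒢 di) (hker : RingHom.ker φ = Ideal.span (Set.range f)) :
    ∃ n : ℕ, (q : ℤ) * d - ((q : ℤ) - 1) * a ≤ (n : ℤ) ∧ ∃ w ∈ 𝒜 n, w ∉ frobPow J q := by
  have hfinP := piece_finite 𝒢 h0P hFTP
  obtain ⟨δ, hG⟩ := hgood.2.2.2
  have haP := gor_isAInv 𝒢 h0P hFTP hgood hG
  generalize (δ : ℤ) - ds.sum = aP at haP
  obtain ⟨fs, hfs⟩ := exists_degs (P := fun x d => x ∈ 𝒢 d) (List.ofFn f) (by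
    intro x hx
    obtain ⟨i, rfl⟩ := (List.mem_ofFn' f x).1 hx
    exact hfd i)
  have hofF : Ideal.ofList (List.ofFn f) = RingHom.ker φ := by
    rw [hker]; unfold Ideal.ofList; congr 1; ext x; simp [List.mem_ofFn]
  have hH1 := hilb_list 𝒢 hfinP (List.ofFn f) fs ⊥ (Ideal.IsHomogeneous.bot 𝒢) hfs
    (regOn_of_reg hreg)
  rw [bot_sup_eq, hofF, ← phi_hilb 𝒜 𝒢 hfinP φ hsurj hφ] at hH1
  have haeq : a = aP + fs.sum := by
    have hb := hilb_bot_ne 𝒜 (piece_finite 𝒜 h0 hFT)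
    have hb' := hilb_bot_ne 𝒢 hfinP
    obtain ⟨num, den, hden, hE, rfl⟩ := haP
    have hDP : DP fs ≠ 0 := by
      intro h
      rw [h, Polynomial.coe_zero, zero_mul] at hH1
      exact hb hH1
    have hnum : num ≠ 0 := by
      rintro rfl
      rw [Polynomial.coe_zero, mul_eq_zero] at hE
      rcases hE with h | h
      · exact hden (by exact_mod_cast h)
      · exact hb' h
    apply isAInv_unique 𝒜 h0 hFT ha
    refine ⟨DP fs * num, den, hden, ?_, ?_⟩
    · rw [hH1, Polynomial.coe_mul, ← hE]; ring
    · rw [Polynomial.natDegree_mul hDP hnum, DP_natDegree fs hDP]; push_cast; ring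
  have hu' : φ (DirectSum.decompose 𝒢 (hsurj u).choose d : P) = u := by
    rw [← phi_comp 𝒜 𝒢 φ hφ, (hsurj u).choose_spec, decomp_of 𝒜 hu]
  obtain ⟨m, hm, z, hz, hzJ⟩ := core 𝒢 p h0P hFTP hgood haP e q hq
    hF (J := J.comap φ)
    (by
      intro i y hy
      rw [Ideal.mem_comap, ← phi_comp 𝒜 𝒢 φ hφ]
      exact hJ i hy)
    (by
      refine Ideal.span_le.2 ?_
      rintro x ⟨i, hi, hx⟩
      obtain ⟨N, hN⟩ := hrad (Ideal.subset_span ⟨i, hi, hφ i x hx⟩)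
      exact ⟨N, by rw [Ideal.mem_comap, map_pow]; exact hN⟩)
    (SetLike.coe_mem (DirectSum.decompose 𝒢 (hsurj u).choose d))
    (by rw [Ideal.mem_comap, hu']; exact huJ)
    (List.ofFn f) fs hfs (by
      intro x hx
      have : x ∈ RingHom.ker φ := by rw [← hofF]; exact Ideal.subset_span hx
      rw [Ideal.mem_comap, (RingHom.mem_ker).1 this]
      exact J.zero_mem)
  refine ⟨m, by rw [haeq]; exact hm, φ z, hφ m z hz, ?_⟩
  intro hcon
  apply hzJ
  have hle : frobPow J q ≤ (frobPow (J.comap φ) q).map φ := by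
    refine Ideal.span_le.2 ?_
    rintro _ ⟨j, hj, rfl⟩
    obtain ⟨j', rfl⟩ := hsurj j
    have : φ (j' ^ q) ∈ (frobPow (J.comap φ) q).map φ :=
      Ideal.mem_map_of_mem φ (Ideal.subset_span ⟨j', hj, rfl⟩)
    simpa using this
  obtain ⟨z', hz', hzz⟩ := (Ideal.mem_map_iff_of_surjective φ hsurj).1 (hle hcon)
  have : z = z' + (z - z') := by ring
  rw [this]
  refine Ideal.add_mem _ (Ideal.mem_sup_left hz') (Ideal.mem_sup_right ?_)
  rw [hofF, RingHom.mem_ker, map_sub, hzz, sub_self]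

theorem ci_case [Nontrivial B] (p : ℕ) [Fact p.Prime] [CharP B p] (h0 : ZeroPieceIsBase 𝒜)
    (hFT : Algebra.FiniteType k B) (hCI : IsGradedCI 𝒜)
    {a : ℤ} (ha : IsAInv 𝒜 ⊥ a) (e q : ℕ) (hq : q = p ^ e)
    {J : Ideal B} (hJ : J.IsHomogeneous 𝒜) (hrad : irrel 𝒜 ≤ J.radical)
    {d : ℕ} {u : B} (hu : u ∈ 𝒜 d) (huJ : u ∉ J) :
    ∃ n : ℕ, (q : ℤ) * d - ((q : ℤ) - 1) * a ≤ (n : ℤ) ∧ ∃ w ∈ 𝒜 n, w ∉ frobPow J q := by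
  obtain ⟨n, w, hw, φ, hsurj, hφ, c, f, hreg, hfd, hker⟩ := hCI
  letI : GradedAlgebra (MvPolynomial.weightedHomogeneousSubmodule k w) :=
    MvPolynomial.weightedGradedAlgebra k w
  have hck : CharP k p := ((algebraMap k B).charP_iff (algebraMap k B).injective p).2 inferInstance
  have hFTP : Algebra.FiniteType k (MvPolynomial (Fin n) k) := inferInstance
  exact ci_gen 𝒜 p h0 hFT ha e q hq hJ hrad hu huJ
    (MvPolynomial.weightedHomogeneousSubmodule k w) φ hsurj hφ hFTP (mv_zero (k := k) w hw)
    (mv_good w hw) (fun N _ v hv => mv_frob p e q hq N v hv) f hreg hfd hker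

end Work

/-- **Proposition 6.1.** Let `R → S = R/J` be a surjection of graded `k`-algebras with `S`
artinian, where `R` is either a complete intersection, or Gorenstein and F-pure.  If `d` is
the top socle degree of `S`, then the top socle degree of `F_R^e(S) = R/J^{[q]}` is at
least `q·d - (q-1)·a(R)`. -/
theorem socle_degrees_stmt17
    {k R : Type} [Field k] [CommRing R] [Algebra k R]
    (p : ℕ) [Fact p.Prime] [CharP R p]
    (𝒜 : ℕ → Submodule k R) [GradedAlgebra 𝒜] (h0 : ZeroPieceIsBase 𝒜)
    (hFT : Algebra.FiniteType k R)
    (hR : IsGradedCI 𝒜 ∨ (IsGorensteinGraded 𝒜 ∧ IsFPureRing R p))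
    (J : Ideal R) (hJ : J.IsHomogeneous 𝒜) (hart : J.radical = irrel 𝒜)
    (e : ℕ) (q : ℕ) (hq : q = p ^ e)
    (a : ℤ) (ha : IsAInv 𝒜 (⊥ : Ideal R) a)
    (dtop : ℕ) (hd1 : ¬((𝒜 dtop : Set R) ⊆ (J : Set R)))
    (hd2 : ∀ n : ℕ, dtop < n → (𝒜 n : Set R) ⊆ (J : Set R)) :
    ∃ n : ℕ, (q : ℤ) * dtop - ((q : ℤ) - 1) * a ≤ (n : ℤ) ∧
      ¬((𝒜 n : Set R) ⊆ (frobPow J q : Set R)) := by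
  have hnt : Nontrivial R := CharP.nontrivial_of_char_ne_one (Fact.out : p.Prime).ne_one
  obtain ⟨u, hu, huJ⟩ := Set.not_subset.1 hd1
  rcases hR with h | ⟨hG, hP⟩
  · obtain ⟨n, hn, w, hw, hwJ⟩ := ci_case 𝒜 p h0 hFT h ha e q hq hJ hart.ge hu huJ
    exact ⟨n, hn, fun hs => hwJ (hs hw)⟩
  · obtain ⟨n, hn, w, hw, hwJ⟩ := fpure_case 𝒜 p h0 hFT hG hP ha e q hq hJ hart.ge hu huJ
    exact ⟨n, hn, fun hs => hwJ (hs hw)⟩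
end

section
/- Let k be a field of positive characteristic p, q = p^e, and R → S a surjection of graded k-algebras with R Gorenstein and F-pure and S artinian. Write R = P/C and S = R/IR with P a positively graded polynomial ring over k and I ⊂ P a homogeneous ideal containing C. Suppose d_1 ≤ … ≤ d_ℓ are the socle degrees of S, the socle of F_R^e(S) has the same k-dimension ℓ as the socle of S, and the socle degrees of F_R^e(S) are D_1 ≤ … ≤ D_ℓ with D_i = q·d_i − (q−1)·a(R) for all i. Then (C^{[q]} + I^{[q]}) : (C^{[q]} : C) = C + I^{[q]} as ideals of P. -/
open Finset CategoryTheory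

/-- An ideal of a weighted polynomial ring is homogeneous iff it contains all the weighted
homogeneous components of its elements. -/
def IsWHomogeneousIdeal {k σ : Type} [Field k] (w : σ → ℕ)
    (I : Ideal (MvPolynomial σ k)) : Prop :=
  ∀ x ∈ I, ∀ n : ℕ, MvPolynomial.weightedHomogeneousComponent w n x ∈ I


section Basics
open MvPolynomial
variable {k σ : Type} [Field k]

lemma wh_iff (w : σ → ℕ) (I : Ideal (MvPolynomial σ k)) :
    letI := weightedGradedAlgebra k w
    IsWHomogeneousIdeal w I ↔ Ideal.IsHomogeneous (weightedHomogeneousSubmodule k w) I := by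
  letI := weightedGradedAlgebra k w
  constructor
  · intro h i r hr
    have := h r hr i
    rwa [← weightedDecomposition.decompose'_apply] at this
  · intro h x hx n
    have := h n hx
    rwa [← weightedDecomposition.decompose'_apply]

lemma wh_sup {w : σ → ℕ} {I J : Ideal (MvPolynomial σ k)} (hI : IsWHomogeneousIdeal w I)
    (hJ : IsWHomogeneousIdeal w J) : IsWHomogeneousIdeal w (I ⊔ J) := by
  letI := weightedGradedAlgebra k w
  rw [wh_iff] at *
  exact hI.sup hJ

lemma wh_span {w : σ → ℕ} {S : Set (MvPolynomial σ k)}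
    (hS : ∀ x ∈ S, ∃ n, IsWeightedHomogeneous w x n) : IsWHomogeneousIdeal w (Ideal.span S) := by
  letI := weightedGradedAlgebra k w
  rw [wh_iff] at *
  exact Ideal.homogeneous_span _ _ (fun x hx => by
    obtain ⟨n, hn⟩ := hS x hx
    exact ⟨n, hn⟩)

/-- f as a finite sum of components -/
lemma sum_comp (w : σ → ℕ) (f : MvPolynomial σ k) :
    ∃ s : Finset ℕ, f = ∑ n ∈ s, weightedHomogeneousComponent w n f := by
  have h := sum_weightedHomogeneousComponent w f
  have hf : (Function.support fun m => weightedHomogeneousComponent w m f).Finite :=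
    weightedHomogeneousComponent_finsupp (w := w) f
  rw [finsum_eq_sum_of_support_subset (s := hf.toFinset) _ (by rw [Set.Finite.coe_toFinset])] at h
  exact ⟨_, h.symm⟩

lemma mem_of_comp (w : σ → ℕ) {f : MvPolynomial σ k} {I : Ideal (MvPolynomial σ k)}
    (h : ∀ n, weightedHomogeneousComponent w n f ∈ I) : f ∈ I := by
  obtain ⟨s, hs⟩ := sum_comp w f
  rw [hs]
  exact Ideal.sum_mem _ fun n _ => h n

lemma frobPow_eq (p : ℕ) [Fact p.Prime] [CharP k p] (e : ℕ) (I : Ideal (MvPolynomial σ k)) :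
    frobPow I (p ^ e) = I.map (iterateFrobenius (MvPolynomial σ k) p e) := rfl

lemma wh_frob (p : ℕ) [Fact p.Prime] [CharP k p] (e : ℕ) {w : σ → ℕ} {I : Ideal (MvPolynomial σ k)}
    (hI : IsWHomogeneousIdeal w I) : IsWHomogeneousIdeal w (frobPow I (p ^ e)) := by
  have : I = Ideal.span {x | x ∈ I ∧ ∃ n, IsWeightedHomogeneous w x n} := by
    apply le_antisymm
    · intro f hf
      exact mem_of_comp w fun n => Ideal.subset_span
        ⟨hI f hf n, n, weightedHomogeneousComponent_isWeightedHomogeneous n f⟩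
    · exact Ideal.span_le.2 fun x hx => hx.1
  rw [frobPow_eq, this, Ideal.map_span]
  apply wh_span
  rintro _ ⟨x, ⟨_, n, hn⟩, rfl⟩
  exact ⟨_, hn.pow (p ^ e)⟩

lemma comp_mul {w : σ → ℕ} {f g : MvPolynomial σ k} {n : ℕ} (hf : IsWeightedHomogeneous w f n) (m : ℕ) :
    weightedHomogeneousComponent w (n + m) (f * g) = f * weightedHomogeneousComponent w m g := by
  obtain ⟨s, hs⟩ := sum_comp w g
  have key : ∀ j, weightedHomogeneousComponent w (n + m) (f * weightedHomogeneousComponent w j g) =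
      f * weightedHomogeneousComponent w m (weightedHomogeneousComponent w j g) := by
    intro j
    have hj := weightedHomogeneousComponent_isWeightedHomogeneous (w := w) j g
    by_cases h : j = m
    · subst h
      rw [(hf.mul hj).weightedHomogeneousComponent_same, hj.weightedHomogeneousComponent_same]
    · rw [(hf.mul hj).weightedHomogeneousComponent_ne, hj.weightedHomogeneousComponent_ne]
      · simp
      · exact fun h' => h h'.symm
      · omega
  rw [hs, Finset.mul_sum, map_sum, map_sum, Finset.mul_sum]
  exact Finset.sum_congr rfl fun j _ => key j

lemma comp_mul_lt {w : σ → ℕ} {f g : MvPolynomial σ k} {n : ℕ} (hf : IsWeightedHomogeneous w f n) {m : ℕ}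
    (hm : m < n) : weightedHomogeneousComponent w m (f * g) = 0 := by
  obtain ⟨s, hs⟩ := sum_comp w g
  rw [hs, Finset.mul_sum, map_sum]
  refine Finset.sum_eq_zero fun j _ => ?_
  have hj := weightedHomogeneousComponent_isWeightedHomogeneous (w := w) j g
  rw [(hf.mul hj).weightedHomogeneousComponent_ne]
  omega

lemma X_wh (w : σ → ℕ) (i : σ) : IsWeightedHomogeneous w (X i : MvPolynomial σ k) (w i) :=
  isWeightedHomogeneous_X _ _ _

lemma irrel_eq {w : σ → ℕ} (hw : ∀ i, 0 < w i) :
    irrel (weightedHomogeneousSubmodule k w) = Ideal.span (Set.range (X : σ → MvPolynomial σ k)) := by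
  apply le_antisymm
  · refine Ideal.span_le.2 ?_
    rintro f ⟨n, hn, hf⟩
    have hX := mem_ideal_span_X_image (R := k) (s := Set.univ) (x := f)
    rw [Set.image_univ] at hX
    rw [SetLike.mem_coe, hX]
    intro m hm
    have h1 : Finsupp.weight w m = n := hf (by simpa using hm)
    by_contra hc
    push Not at hc
    have : m = 0 := by ext i; simpa using hc i (Set.mem_univ i)
    subst this
    simp at h1; omega
  · refine Ideal.span_le.2 ?_
    rintro _ ⟨i, rfl⟩
    exact Ideal.subset_span ⟨w i, hw i, X_wh w i⟩

lemma mem_colon_irrel {w : σ → ℕ} (hw : ∀ i, 0 < w i) {J : Ideal (MvPolynomial σ k)} {f : MvPolynomial σ k} :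
    f ∈ J.colon (irrel (weightedHomogeneousSubmodule k w)) ↔ ∀ i, X i * f ∈ J := by
  rw [irrel_eq hw]
  have := Submodule.colon_span (N := J) (S := Set.range (X : σ → MvPolynomial σ k))
  change f ∈ J.colon ((Submodule.span _ (Set.range (X : σ → MvPolynomial σ k)) : Submodule _ _ ) : Set _) ↔ _
  rw [this, Submodule.mem_colon]
  simp [mul_comm]

/-- the socle condition -/
def Soc (J : Ideal (MvPolynomial σ k)) (f : MvPolynomial σ k) : Prop := ∀ i, X i * f ∈ J

lemma Soc.comp {w : σ → ℕ} {J : Ideal (MvPolynomial σ k)} (hJ : IsWHomogeneousIdeal w J)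
    {f : MvPolynomial σ k} (h : Soc J f) (n : ℕ) : Soc J (weightedHomogeneousComponent w n f) := by
  intro i
  rw [← comp_mul (X_wh w i)]
  exact hJ _ (h i) _

/-- artinian -/
def Art (w : σ → ℕ) (J : Ideal (MvPolynomial σ k)) : Prop :=
  ∃ D, ∀ n, D ≤ n → ∀ f, IsWeightedHomogeneous w f n → f ∈ J

lemma art_of_radical [Fintype σ] {w : σ → ℕ} {J : Ideal (MvPolynomial σ k)}
    (h : ∀ i, (X i : MvPolynomial σ k) ∈ J.radical) : Art w J := by
  choose N hN using h
  refine ⟨(∑ i, N i * w i) + 1, fun n hn f hf => ?_⟩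
  rw [f.as_sum]
  refine Ideal.sum_mem _ fun m hm => ?_
  have h1 : Finsupp.weight w m = n := hf (by simpa using hm)
  have : ∃ i, N i ≤ m i := by
    by_contra hc
    push Not at hc
    rw [Finsupp.weight_apply, Finsupp.sum_fintype _ _ (by simp)] at h1
    have : ∑ i, m i • w i ≤ ∑ i, N i * w i := Finset.sum_le_sum fun i _ => by
      rw [smul_eq_mul]; exact Nat.mul_le_mul_right _ (hc i).le
    omega
  obtain ⟨i, hi⟩ := this
  have : monomial m (coeff m f) = X i ^ N i * monomial (m - Finsupp.single i (N i)) (coeff m f) := by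
    rw [X_pow_eq_monomial, monomial_mul, one_mul, add_tsub_cancel_of_le]
    simpa using hi
  rw [this]
  exact Ideal.mul_mem_right _ _ (hN i)

lemma exists_soc_mul {w : σ → ℕ} {J : Ideal (MvPolynomial σ k)} (hw : ∀ i, 0 < w i) (hA : Art w J) {n : ℕ} {f : MvPolynomial σ k}
    (hf : IsWeightedHomogeneous w f n) (hfJ : f ∉ J) :
    ∃ m r, IsWeightedHomogeneous w r m ∧ r * f ∉ J ∧ Soc J (r * f) := by
  obtain ⟨D, hD⟩ := hA
  suffices H : ∀ t n f, D ≤ n + t → IsWeightedHomogeneous w f n → f ∉ J →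
    ∃ m r, IsWeightedHomogeneous w r m ∧ r * f ∉ J ∧ Soc J (r * f) from
      H D n f (by omega) hf hfJ
  intro t
  induction t with
  | zero => intro n f h1 h2 h3; exact absurd (hD n h1 f h2) h3
  | succ t ih =>
    intro n f h1 h2 h3
    by_cases hs : Soc J f
    · exact ⟨0, 1, isWeightedHomogeneous_one _ _, by simpa using h3, by simpa using hs⟩
    · unfold Soc at hs
      push Not at hs
      obtain ⟨i, hi⟩ := hs
      obtain ⟨m, r, a, b, c⟩ := ih (w i + n) (X i * f) (by have := hw i; omega) ((X_wh w i).mul h2) hi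
      exact ⟨_, r * X i, a.mul (X_wh w i), by rwa [mul_assoc], by rwa [mul_assoc]⟩
end Basics


section Frob
open MvPolynomial
variable {k σ : Type} [Field k]

lemma field_coords (p : ℕ) [Fact p.Prime] [CharP k p] (e : ℕ) :
    ∃ (ι : Type) (b : ι → k) (l : ι → k →+ k),
      (∀ α c d, l α (c ^ p ^ e * d) = c * l α d) ∧
      (∀ c, ∃ s : Finset ι, ∀ s', s ⊆ s' → c = ∑ α ∈ s', b α * (l α c) ^ p ^ e) := by
  classical
  let φ := iterateFrobenius k p e
  let B := Module.Basis.ofVectorSpace φ.fieldRange k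
  let E := φ.rangeRestrictFieldEquiv
  have hE : ∀ x : φ.fieldRange, (E.symm x) ^ p ^ e = (x : k) := fun x =>
    RingHom.rangeRestrictFieldEquiv_apply_symm_apply φ x
  refine ⟨_, B, fun α => E.symm.toAddEquiv.toAddMonoidHom.comp
    ((Finsupp.applyAddHom α).comp B.repr.toLinearMap.toAddMonoidHom), ?_, ?_⟩
  · intro α c d
    have h1 : c ^ p ^ e * d = (E c) • d := by
      rw [Subfield.smul_def]; rfl
    rw [h1]
    simp
  · intro c
    refine ⟨(B.repr c).support, fun s' hs' => ?_⟩
    conv_lhs => rw [← B.linearCombination_repr c, Finsupp.linearCombination_apply]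
    rw [Finsupp.sum_of_support_subset _ hs' _ (by simp)]
    refine Finset.sum_congr rfl fun α _ => ?_
    rw [Subfield.smul_def]
    have := hE (B.repr c α)
    rw [← this, smul_eq_mul, mul_comm]
    rfl

lemma smul_add_inj {q : ℕ} (hq : 0 < q) (β : σ →₀ ℕ) :
    Function.Injective (fun m : σ →₀ ℕ => q • m + β) := by
  intro m n h
  ext i
  have := DFunLike.congr_fun h i
  simp at this
  omega

open Classical in
/-- coordinate maps -/
noncomputable def tau (q : ℕ) (β : σ →₀ ℕ) (l : k →+ k) (f : MvPolynomial σ k) : MvPolynomial σ k :=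
  if hq : 0 < q then
  ∑ m ∈ f.support.preimage (fun m : σ →₀ ℕ => q • m + β) (smul_add_inj hq β).injOn,
    monomial m (l (coeff (q • m + β) f)) else 0

lemma coeff_tau {q : ℕ} (hq : 0 < q) (β : σ →₀ ℕ) (l : k →+ k) (f : MvPolynomial σ k) (m : σ →₀ ℕ) :
    coeff m (tau q β l f) = l (coeff (q • m + β) f) := by
  classical
  rw [tau, dif_pos hq, coeff_sum]
  simp only [coeff_monomial]
  rw [Finset.sum_ite_eq']
  split_ifs with h
  · rfl
  · simp at h
    rw [h, map_zero]

lemma tau_add {q : ℕ} (hq : 0 < q) (β : σ →₀ ℕ) (l : k →+ k) (f g : MvPolynomial σ k) :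
    tau q β l (f + g) = tau q β l f + tau q β l g := by
  ext m; simp [coeff_tau hq]

lemma tau_zero {q : ℕ} (hq : 0 < q) (β : σ →₀ ℕ) (l : k →+ k) :
    tau q β l (0 : MvPolynomial σ k) = 0 := by
  ext m; simp [coeff_tau hq]

lemma tau_sum {q : ℕ} (hq : 0 < q) (β : σ →₀ ℕ) (l : k →+ k) {ι : Type} (s : Finset ι) (f : ι → MvPolynomial σ k) :
    tau q β l (∑ i ∈ s, f i) = ∑ i ∈ s, tau q β l (f i) := by
  ext m; simp [coeff_tau hq, coeff_sum]

variable (p : ℕ) [Fact p.Prime] [CharP k p] (e : ℕ)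

lemma qpos : 0 < p ^ e := pow_pos (Fact.out : p.Prime).pos _

lemma tau_pow_mul {β : σ →₀ ℕ} (hβ : ∀ i, β i < p ^ e) {l : k →+ k}
    (hl : ∀ c d, l (c ^ p ^ e * d) = c * l d) (f g : MvPolynomial σ k) :
    tau (p ^ e) β l (f ^ p ^ e * g) = f * tau (p ^ e) β l g := by
  have hq := qpos p e
  induction f using MvPolynomial.induction_on'' with
  | C a =>
    ext m; rw [coeff_tau hq, ← map_pow, coeff_C_mul, coeff_C_mul, coeff_tau hq, hl]
  | monomial_add a b f ha hb ih1 ih2 =>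
    rw [add_pow_expChar_pow, add_mul, add_mul, tau_add hq, ih1, ih2]
  | mul_X f i ih =>
    rw [mul_pow, mul_right_comm, mul_right_comm f]
    rw [mul_comm, mul_comm _ (X i), ← ih]
    classical
    ext m
    rw [coeff_tau hq, X_pow_eq_monomial, coeff_monomial_mul', coeff_X_mul', coeff_tau hq]
    by_cases h : 1 ≤ m i
    · have h1 : Finsupp.single i (p ^ e) ≤ p ^ e • m + β := by
        rw [Finsupp.single_le_iff]
        simp
        nlinarith
      rw [if_pos h1, if_pos (by simp; omega)]
      congr 2
      rw [one_mul]
      congr 1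
      ext j
      by_cases hj : j = i
      · subst hj
        simp [Nat.mul_sub]
        have : p ^ e ≤ p ^ e * m j := by nlinarith
        omega
      · simp [Finsupp.single_apply, Ne.symm hj]
    · have h1 : ¬ Finsupp.single i (p ^ e) ≤ p ^ e • m + β := by
        rw [Finsupp.single_le_iff]
        have : m i = 0 := by omega
        simp [this, hβ i]
      rw [if_neg h1, if_neg (by simp; omega), map_zero]

lemma tau_mem {β : σ →₀ ℕ} (hβ : ∀ i, β i < p ^ e) {l : k →+ k}
    (hl : ∀ c d, l (c ^ p ^ e * d) = c * l d) {J : Ideal (MvPolynomial σ k)} {f : MvPolynomial σ k}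
    (hf : f ∈ frobPow J (p ^ e)) : tau (p ^ e) β l f ∈ J := by
  have hq := qpos p e
  refine Submodule.span_induction (p := fun f _ => ∀ g, tau (p ^ e) β l (g * f) ∈ J) ?_ ?_ ?_ ?_ hf 1 |>
    (by simpa using ·)
  · rintro _ ⟨x, hx, rfl⟩ g
    simp only
    rw [mul_comm, tau_pow_mul p e hβ hl]
    exact Ideal.mul_mem_right _ _ hx
  · intro g; simp [tau_zero hq]
  · intro x y _ _ h1 h2 g
    rw [mul_add, tau_add hq]; exact J.add_mem (h1 g) (h2 g)
  · intro a x _ h g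
    rw [smul_eq_mul, ← mul_assoc]; exact h _

lemma tau_X_mul {β : σ →₀ ℕ} {l : k →+ k} (i : σ) (f : MvPolynomial σ k) :
    tau (p ^ e) (β + Finsupp.single i 1) l (X i * f) = tau (p ^ e) β l f := by
  have hq := qpos p e
  ext m
  rw [coeff_tau hq, coeff_tau hq, ← add_assoc, add_comm _ (Finsupp.single i 1), coeff_X_mul]

lemma tau_X_mul' {β : σ →₀ ℕ} {l : k →+ k} (i : σ) (hi : β i = p ^ e - 1) (f : MvPolynomial σ k) :
    tau (p ^ e) (β - Finsupp.single i (p ^ e - 1)) l (X i * f) = X i * tau (p ^ e) β l f := by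
  have hq := qpos p e
  classical
  ext m
  rw [coeff_tau hq, coeff_X_mul', coeff_X_mul', coeff_tau hq]
  by_cases h : 1 ≤ m i
  · have h5 : p ^ e ≤ p ^ e * m i := by nlinarith
    rw [if_pos (by rw [Finsupp.mem_support_iff]; simp; have := (Fact.out : p.Prime).ne_zero; first | omega | tauto),
      if_pos (by rw [Finsupp.mem_support_iff]; omega)]
    congr 2
    ext j
    by_cases hj : j = i
    · subst hj
      simp [Nat.mul_sub, hi]
      have : p ^ e ≤ p ^ e * m j := by nlinarith
      omega
    · simp [Finsupp.single_apply, Ne.symm hj]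
  · have : m i = 0 := by omega
    rw [if_neg (by simp [this, hi]), if_neg (by simp; omega), map_zero]

variable [Fintype σ]

/-- exponents of the socle monomial -/
noncomputable def topExp (σ : Type) [Fintype σ] (q : ℕ) : σ →₀ ℕ := Finsupp.equivFunOnFinite.symm fun _ => q - 1

/-- `(x_1 ⋯ x_n)^(q-1)` -/
noncomputable def topMon (k σ : Type) [Field k] [Fintype σ] (q : ℕ) : MvPolynomial σ k := monomial (topExp σ q) 1

open Classical in
lemma reconstruct {ι : Type} {b : ι → k} {l : ι → k →+ k}
    (h2 : ∀ c, ∃ s : Finset ι, ∀ s', s ⊆ s' → c = ∑ α ∈ s', b α * (l α c) ^ p ^ e)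
    (f : MvPolynomial σ k) :
    f ∈ Ideal.span {g | ∃ α, ∃ β : σ →₀ ℕ, (∀ i, β i < p ^ e) ∧
      g = monomial β 1 * (tau (p ^ e) β (l α) f) ^ p ^ e} := by
  have hq := qpos p e
  choose S hS using h2
  let s' : Finset ι := f.support.biUnion fun m => S (coeff m f)
  let Box : Finset (σ →₀ ℕ) := (Fintype.piFinset fun _ : σ => Finset.range (p ^ e)).map
    Finsupp.equivFunOnFinite.symm.toEmbedding
  have hBox : ∀ β, β ∈ Box ↔ ∀ i, β i < p ^ e := by
    intro β
    simp [Box]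
  have key : f = ∑ β ∈ Box, ∑ α ∈ s', C (b α) * (monomial β 1 * (tau (p ^ e) β (l α) f) ^ p ^ e) := by
    have hmon : ∀ m ∈ f.support, monomial m (coeff m f) =
        ∑ β ∈ Box, ∑ α ∈ s', C (b α) * (monomial β 1 * (tau (p ^ e) β (l α) (monomial m (coeff m f))) ^ p ^ e) := by
      intro m hm
      set c := coeff m f with hc
      let β0 : σ →₀ ℕ := m.mapRange (· % p ^ e) (by simp)
      let m0 : σ →₀ ℕ := m.mapRange (· / p ^ e) (by simp)
      have hb0 : ∀ i, β0 i = m i % p ^ e := fun _ => rfl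
      have hn0 : ∀ i, m0 i = m i / p ^ e := fun _ => rfl
      have hm0 : m = p ^ e • m0 + β0 := by
        ext i; simp [hb0, hn0, Nat.div_add_mod]
      have hβ0 : ∀ i, β0 i < p ^ e := fun i => by rw [hb0]; exact Nat.mod_lt _ hq
      have ht1 : ∀ α, tau (p ^ e) β0 (l α) (monomial m c) = monomial m0 (l α c) := by
        intro α
        ext n
        rw [coeff_tau hq, coeff_monomial, coeff_monomial]
        by_cases h : m0 = n
        · subst h; rw [if_pos hm0, if_pos rfl]
        · rw [if_neg h, if_neg, map_zero]
          intro h'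
          rw [hm0] at h'
          exact h (smul_add_inj hq β0 h')
      have ht2 : ∀ β ∈ Box, β ≠ β0 → ∀ α, tau (p ^ e) β (l α) (monomial m c) = 0 := by
        intro β hβ hne α
        rw [hBox] at hβ
        ext n
        rw [coeff_tau hq, coeff_monomial, if_neg, map_zero, MvPolynomial.coeff_zero]
        intro h'
        apply hne
        ext i
        have := DFunLike.congr_fun h' i
        simp only [Finsupp.add_apply, Finsupp.smul_apply, smul_eq_mul] at this
        rw [hb0, this, Nat.mul_add_mod, Nat.mod_eq_of_lt (hβ i)]
      rw [Finset.sum_eq_single β0]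
      · simp_rw [ht1, monomial_pow, monomial_mul, C_mul_monomial, one_mul]
        rw [← map_sum, add_comm, ← hm0, ← hS c s' (Finset.subset_biUnion_of_mem (fun m => S (coeff m f)) hm)]
      · intro β hβ hne
        refine Finset.sum_eq_zero fun α _ => ?_
        rw [ht2 β hβ hne, zero_pow hq.ne']; simp
      · intro h; exact absurd ((hBox _).2 hβ0) h
    conv_lhs => rw [f.as_sum, Finset.sum_congr rfl hmon]
    rw [Finset.sum_comm]
    refine Finset.sum_congr rfl fun β _ => ?_
    rw [Finset.sum_comm]
    refine Finset.sum_congr rfl fun α _ => ?_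
    rw [← Finset.mul_sum, ← Finset.mul_sum, ← sum_pow_char_pow, ← tau_sum hq, ← f.as_sum]
  have hh : ∀ I : Ideal (MvPolynomial σ k), (∑ β ∈ Box, ∑ α ∈ s', C (b α) * (monomial β 1 * (tau (p ^ e) β (l α) f) ^ p ^ e)) ∈ I → f ∈ I := fun I h => by rw [key]; exact h
  refine hh _ ?_
  refine Ideal.sum_mem _ fun β hβ => Ideal.sum_mem _ fun α _ => Ideal.mul_mem_left _ _ (Ideal.subset_span ?_)
  exact ⟨α, β, (hBox β).1 hβ, rfl⟩

/-- (i') -/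
lemma soc_frob {J : Ideal (MvPolynomial σ k)} {f : MvPolynomial σ k}
    (hf : Soc (frobPow J (p ^ e)) f) :
    f ∈ frobPow J (p ^ e) ⊔ Ideal.span {g | ∃ h, Soc J h ∧ g = topMon k σ (p ^ e) * h ^ p ^ e} := by
  have hq := qpos p e
  obtain ⟨ι, b, l, h1, h2⟩ := field_coords (k := k) p e
  refine (Ideal.span_le.2 ?_ : Ideal.span _ ≤ _) (reconstruct p e h2 f)
  rintro _ ⟨α, β, hβ, rfl⟩
  by_cases hb : β = topExp σ (p ^ e)
  · refine Ideal.mem_sup_right (Ideal.subset_span ⟨_, fun i => ?_, by rw [hb]; rfl⟩)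
    have hbi : β i = p ^ e - 1 := by rw [hb]; rfl
    rw [← hb, ← tau_X_mul' p e i hbi]
    refine tau_mem p e (fun j => ?_) (h1 α) (hf i)
    exact lt_of_le_of_lt (by simp) (hβ j)
  · have : ∃ i, β i + 1 < p ^ e := by
      by_contra hc
      push Not at hc
      apply hb
      ext i
      have h3 := hβ i
      have h4 := hc i
      change _ = p ^ e - 1
      omega
    obtain ⟨i, hi⟩ := this
    refine Ideal.mem_sup_left (Ideal.mul_mem_left _ _ (Ideal.subset_span ⟨_, ?_, rfl⟩))
    rw [SetLike.mem_coe, ← tau_X_mul p e i]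
    refine tau_mem p e (fun j => ?_) (h1 α) (hf i)
    by_cases hj : j = i
    · subst hj; simpa using hi
    · simpa [Finsupp.single_apply, Ne.symm hj] using hβ j

/-- (ii') -/
lemma indep_frob {J : Ideal (MvPolynomial σ k)} {ι' : Type} (s : Finset ι') (f : ι' → MvPolynomial σ k)
    (hind : ∀ c : ι' → k, ∑ i ∈ s, C (c i) * f i ∈ J → ∀ i ∈ s, c i = 0)
    (c : ι' → k) (hc : ∑ i ∈ s, C (c i) * (topMon k σ (p ^ e) * f i ^ p ^ e) ∈ frobPow J (p ^ e)) :
    ∀ i ∈ s, c i = 0 := by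
  have hq := qpos p e
  obtain ⟨ι, b, l, h1, h2⟩ := field_coords (k := k) p e
  have hl0 : ∀ α, ∀ i ∈ s, l α (c i) = 0 := by
    intro α
    apply hind
    have := tau_mem p e (β := topExp σ (p ^ e)) (fun i => by change p ^ e - 1 < _; omega) (h1 α) hc
    rw [tau_sum hq] at this
    convert this using 2 with i
    rw [← mul_assoc, mul_comm _ (f i ^ p ^ e), tau_pow_mul p e (fun i => by change p ^ e - 1 < _; omega) (h1 α), mul_comm]
    congr 1
    ext m
    classical
    rw [coeff_tau hq, topMon, C_mul_monomial, coeff_monomial, coeff_C]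
    by_cases hm : 0 = m
    · subst hm; simp
    · rw [if_neg hm, if_neg, map_zero]
      intro h
      apply hm
      symm
      ext i
      have := DFunLike.congr_fun h i
      simp at this
      rcases this with h | h
      · have := (Fact.out : p.Prime).ne_zero; tauto
      · simpa using h
  intro i hi
  obtain ⟨t, ht⟩ := h2 (c i)
  rw [ht t subset_rfl]
  refine Finset.sum_eq_zero fun α _ => ?_
  rw [hl0 α i hi, zero_pow hq.ne', mul_zero]
end Frob


section RegS
open MvPolynomial
variable {k σ : Type} [Field k]

/-- y is a nonzerodivisor modulo J -/
def Reg (J : Ideal (MvPolynomial σ k)) (y : MvPolynomial σ k) : Prop := ∀ f, y * f ∈ J → f ∈ J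

/-- regular sequence modulo J -/
def RegSeq : Ideal (MvPolynomial σ k) → List (MvPolynomial σ k) → Prop
  | _, [] => True
  | J, y :: l => Reg J y ∧ RegSeq (J ⊔ Ideal.span {y}) l

lemma mem_sup_span {J : Ideal (MvPolynomial σ k)} {y f : MvPolynomial σ k} :
    f ∈ J ⊔ Ideal.span {y} ↔ ∃ g, f - y * g ∈ J := by
  rw [Submodule.mem_sup]
  constructor
  · rintro ⟨a, ha, b, hb, rfl⟩
    obtain ⟨g, rfl⟩ := Ideal.mem_span_singleton'.1 hb
    exact ⟨g, by rw [mul_comm]; simpa using ha⟩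
  · rintro ⟨g, hg⟩
    exact ⟨_, hg, y * g, Ideal.mul_mem_right _ _ (Ideal.mem_span_singleton_self y), by ring⟩

lemma swap2 {J : Ideal (MvPolynomial σ k)} {y z : MvPolynomial σ k} (h1 : Reg J y)
    (h2 : Reg (J ⊔ Ideal.span {y}) z) : Reg (J ⊔ Ideal.span {z}) y := by
  intro f hf
  obtain ⟨g, hg⟩ := mem_sup_span.1 hf
  have : z * g ∈ J ⊔ Ideal.span {y} := mem_sup_span.2 ⟨f, by
    rw [← J.neg_mem_iff]; convert hg using 1; ring⟩
  obtain ⟨g', hg'⟩ := mem_sup_span.1 (h2 _ this)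
  refine mem_sup_span.2 ⟨g', h1 _ ?_⟩
  have := J.add_mem hg (J.mul_mem_left z hg')
  convert this using 1; ring

lemma swap1 {w : σ → ℕ} {J : Ideal (MvPolynomial σ k)} (hJ : IsWHomogeneousIdeal w J) {y z : MvPolynomial σ k}
    {m n : ℕ} (hm : 0 < m) (hy : IsWeightedHomogeneous w y m) (hz : IsWeightedHomogeneous w z n)
    (h1 : Reg J y)
    (h2 : Reg (J ⊔ Ideal.span {y}) z) : Reg J z := by
  have key : ∀ d f, IsWeightedHomogeneous w f d → z * f ∈ J → f ∈ J := by
    intro d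
    induction d using Nat.strong_induction_on with
    | _ d ih =>
    intro f hf hzf
    obtain ⟨g, hg⟩ := mem_sup_span.1 (h2 f (Ideal.mem_sup_left hzf))
    have hg2 := hJ _ hg d
    rw [map_sub, hf.weightedHomogeneousComponent_same] at hg2
    by_cases hd : d < m
    · rwa [comp_mul_lt hy hd, sub_zero] at hg2
    · obtain ⟨d', rfl⟩ : ∃ d', d = m + d' := ⟨d - m, by omega⟩
      rw [comp_mul hy] at hg2
      have hc := weightedHomogeneousComponent_isWeightedHomogeneous (w := w) d' g
      set g' := weightedHomogeneousComponent w d' g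
      have : y * (z * g') ∈ J := by
        have := J.sub_mem hzf (J.mul_mem_left z hg2)
        convert this using 1; ring
      have := ih d' (by omega) g' hc (h1 _ this)
      have := J.add_mem hg2 (J.mul_mem_left y this)
      simpa using this
  intro f hf
  refine mem_of_comp w fun d => key d _ (weightedHomogeneousComponent_isWeightedHomogeneous d f) ?_
  rw [← comp_mul hz]
  exact hJ _ hf _

lemma wh_single {w : σ → ℕ} {y : MvPolynomial σ k} {m : ℕ} (hy : IsWeightedHomogeneous w y m) :
    IsWHomogeneousIdeal w (Ideal.span {y}) := wh_span (by simpa using ⟨m, hy⟩)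

lemma sup_ofList_cons (J : Ideal (MvPolynomial σ k)) (y : MvPolynomial σ k) (l : List (MvPolynomial σ k)) :
    J ⊔ Ideal.ofList (y :: l) = J ⊔ Ideal.span {y} ⊔ Ideal.ofList l := by
  rw [Ideal.ofList_cons, sup_assoc]

lemma regSeq_perm {w : σ → ℕ} (deg : MvPolynomial σ k → ℕ) (y : MvPolynomial σ k)
    (hy : 0 < deg y ∧ IsWeightedHomogeneous w y (deg y)) (l : List (MvPolynomial σ k))
    (hl : ∀ y ∈ l, 0 < deg y ∧ IsWeightedHomogeneous w y (deg y))  :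
    ∀ (J : Ideal (MvPolynomial σ k)), IsWHomogeneousIdeal w J → RegSeq J (y :: l) →
     Reg (J ⊔ Ideal.ofList l) y ∧ RegSeq J l := by
  induction l with
  | nil => intro J hJ h; simpa [RegSeq] using h
  | cons z l ih =>
    intro J hJ ⟨h1, h2, h3⟩
    obtain ⟨hz0, hz⟩ := hl z (by simp)
    have a1 := swap1 hJ hy.1 hy.2 hz h1 h2
    have a2 := swap2 h1 h2
    rw [sup_right_comm] at h3
    obtain ⟨b1, b2⟩ := ih (fun x hx => hl x (by simp [hx])) _ (wh_sup hJ (wh_single hz)) ⟨a2, h3⟩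
    exact ⟨by rwa [sup_ofList_cons], a1, b2⟩

lemma reg_pow {J : Ideal (MvPolynomial σ k)} {y z : MvPolynomial σ k} (h1 : Reg J y)
    (h2 : Reg (J ⊔ Ideal.span {y}) z) (N : ℕ) : Reg (J ⊔ Ideal.span {y ^ (N + 1)}) z := by
  induction N with
  | zero => simpa using h2
  | succ N ih =>
    intro f hf
    have hle : J ⊔ Ideal.span {y ^ (N + 1 + 1)} ≤ J ⊔ Ideal.span {y ^ (N + 1)} :=
      sup_le_sup_left (Ideal.span_singleton_le_span_singleton.2 (pow_dvd_pow _ (by omega))) _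
    obtain ⟨g, hg⟩ := mem_sup_span.1 (ih f (hle hf))
    obtain ⟨g2, hg2⟩ := mem_sup_span.1 hf
    have h3 : ∀ n g, y ^ n * g ∈ J → g ∈ J := by
      intro n; induction n with
      | zero => intro g; simp
      | succ n ih => intro g hg; rw [pow_succ', mul_assoc] at hg; exact ih _ (h1 _ hg)
    have h4 : z * g ∈ J ⊔ Ideal.span {y} := by
      refine mem_sup_span.2 ⟨g2, h3 (N + 1) _ ?_⟩
      have := J.sub_mem hg2 (J.mul_mem_left z hg)
      convert this using 1; ring
    obtain ⟨g3, hg3⟩ := mem_sup_span.1 (h2 _ h4)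
    refine mem_sup_span.2 ⟨g3, ?_⟩
    have := J.add_mem hg (J.mul_mem_left (y ^ (N + 1)) hg3)
    convert this using 1; ring

lemma regSeq_pow {y : MvPolynomial σ k} (N : ℕ) (l : List (MvPolynomial σ k)) :
    ∀ J, Reg J y → RegSeq (J ⊔ Ideal.span {y}) l → RegSeq (J ⊔ Ideal.span {y ^ (N + 1)}) l := by
  induction l with
  | nil => intro J h1 h2; trivial
  | cons z l ih =>
    intro J h1 ⟨h2, h3⟩
    refine ⟨reg_pow h1 h2 N, ?_⟩
    rw [sup_right_comm] at h3 ⊢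
    exact ih _ (swap2 h1 h2) h3

/-- P/J has one-dimensional socle spanned by z in degree t -/
structure Gor (w : σ → ℕ) (J : Ideal (MvPolynomial σ k)) (z : MvPolynomial σ k) (t : ℕ) : Prop where
  hz : IsWeightedHomogeneous w z t
  nz : z ∉ J
  soc : Soc J z
  uniq : ∀ f, Soc J f → ∃ c : k, f - C c * z ∈ J

lemma mem_aug_mul {J : Ideal (MvPolynomial σ k)} {f : MvPolynomial σ k} (h : Soc J f) {y : MvPolynomial σ k}
    (hy : y ∈ Ideal.span (Set.range (X : σ → MvPolynomial σ k))) : y * f ∈ J := by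
  refine Submodule.span_induction (p := fun y _ => y * f ∈ J) ?_ ?_ ?_ ?_ hy
  · rintro _ ⟨i, rfl⟩; exact h i
  · simp
  · intro a b _ _ h1 h2; rw [add_mul]; exact J.add_mem h1 h2
  · intro a b _ h1; rw [smul_eq_mul, mul_assoc]; exact J.mul_mem_left _ h1

lemma wh_pos_mem {w : σ → ℕ} (hw : ∀ i, 0 < w i) {y : MvPolynomial σ k} {d : ℕ} (hd : 0 < d)
    (hy : IsWeightedHomogeneous w y d) : y ∈ Ideal.span (Set.range (X : σ → MvPolynomial σ k)) := by
  rw [← irrel_eq hw]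
  exact Ideal.subset_span ⟨d, hd, hy⟩

lemma gor_pow {w : σ → ℕ} (hw : ∀ i, 0 < w i) {J : Ideal (MvPolynomial σ k)} {y z : MvPolynomial σ k} {t d : ℕ}
    (hd : 0 < d) (hy : IsWeightedHomogeneous w y d) (h1 : Reg J y) (h : Gor w (J ⊔ Ideal.span {y}) z t) (N : ℕ) :
    Gor w (J ⊔ Ideal.span {y ^ (N + 1)}) (y ^ N * z) (t + N * d) := by
  have h3 : ∀ n g, y ^ n * g ∈ J → g ∈ J := by
    intro n; induction n with
    | zero => intro g; simp
    | succ n ih => intro g hg; rw [pow_succ', mul_assoc] at hg; exact ih _ (h1 _ hg)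
  have h4 : ∀ f, y ^ N * f ∈ J ⊔ Ideal.span {y ^ (N + 1)} ↔ f ∈ J ⊔ Ideal.span {y} := by
    intro f
    rw [mem_sup_span, mem_sup_span]
    constructor
    · rintro ⟨g, hg⟩
      exact ⟨g, h3 N _ (by convert hg using 1; ring)⟩
    · rintro ⟨g, hg⟩
      exact ⟨g, by convert J.mul_mem_left (y ^ N) hg using 1; ring⟩
  refine ⟨?_, ?_, ?_, ?_⟩
  · have := (hy.pow N).mul h.hz
    rwa [add_comm, smul_eq_mul] at this
  · rw [h4]; exact h.nz
  · intro i
    rw [mul_left_comm, h4]; exact h.soc i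
  · intro f hf
    have hyf := mem_aug_mul hf (wh_pos_mem hw hd hy)
    obtain ⟨g, hg⟩ := mem_sup_span.1 hyf
    have h5 : f - y ^ N * g ∈ J := h1 _ (by convert hg using 1; ring)
    have h6 : Soc (J ⊔ Ideal.span {y}) g := by
      intro i
      rw [← h4]
      have a := hf i
      have b : X i * (f - y ^ N * g) ∈ J ⊔ Ideal.span {y ^ (N + 1)} := Ideal.mem_sup_left (J.mul_mem_left _ h5)
      have := Ideal.sub_mem _ a b
      convert this using 1; ring
    obtain ⟨c, hc⟩ := h.uniq g h6
    refine ⟨c, ?_⟩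
    have := Ideal.add_mem _ (Ideal.mem_sup_left h5 : _ ∈ J ⊔ Ideal.span {y ^ (N + 1)}) ((h4 _).2 hc)
    convert this using 1; ring

lemma gor_list {w : σ → ℕ} (hw : ∀ i, 0 < w i) (deg : MvPolynomial σ k → ℕ) (N : ℕ) (l : List (MvPolynomial σ k))
    (hl : ∀ y ∈ l, 0 < deg y ∧ IsWeightedHomogeneous w y (deg y)) :
    ∀ (J : Ideal (MvPolynomial σ k)) (z : MvPolynomial σ k) (t : ℕ), IsWHomogeneousIdeal w J → RegSeq J l →
      Gor w (J ⊔ Ideal.ofList l) z t →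
      ∃ z', Gor w (J ⊔ Ideal.ofList (l.map (· ^ (N + 1)))) z' (t + N * (l.map deg).sum) := by
  induction l with
  | nil => intro J z t _ _ h; exact ⟨z, by simpa using h⟩
  | cons y l ih =>
    intro J z t hJ h1 h2
    have hy := hl y (by simp)
    have hl' : ∀ y ∈ l, 0 < deg y ∧ IsWeightedHomogeneous w y (deg y) := fun x hx => hl x (by simp [hx])
    have a1 := (regSeq_perm deg y hy l hl' J hJ h1).1
    rw [sup_ofList_cons, sup_right_comm] at h2
    have a2 := gor_pow hw hy.1 hy.2 a1 h2 N
    rw [sup_right_comm] at a2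
    obtain ⟨z', hz'⟩ := ih hl' _ _ _ (wh_sup hJ (wh_single (hy.2.pow (N + 1)))) (regSeq_pow N l J h1.1 h1.2) a2
    refine ⟨z', ?_⟩
    rw [List.map_cons, sup_ofList_cons, List.map_cons, List.sum_cons, mul_add, ← add_assoc]
    exact hz'

lemma Gor.top {w : σ → ℕ} (hw : ∀ i, 0 < w i) {J : Ideal (MvPolynomial σ k)} {z : MvPolynomial σ k} {t : ℕ} (hJ : IsWHomogeneousIdeal w J)
    (hA : Art w J) (h : Gor w J z t)
    {n : ℕ} {f : MvPolynomial σ k} (hf : IsWeightedHomogeneous w f n) (hfJ : f ∉ J) :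
    ∃ m r, m + n = t ∧ IsWeightedHomogeneous w r m ∧ r * f ∉ J := by
  obtain ⟨m, r, hr, h1, h2⟩ := exists_soc_mul hw hA hf hfJ
  refine ⟨m, r, ?_, hr, h1⟩
  obtain ⟨c, hc⟩ := h.uniq _ h2
  by_contra hne
  apply h1
  have := hJ _ hc (m + n)
  rwa [map_sub, (hr.mul hf).weightedHomogeneousComponent_same,
    (h.hz.C_mul c).weightedHomogeneousComponent_ne _ hne, sub_zero] at this

lemma Gor.gt {w : σ → ℕ} (hw : ∀ i, 0 < w i) {J : Ideal (MvPolynomial σ k)} {z : MvPolynomial σ k} {t : ℕ} (hJ : IsWHomogeneousIdeal w J)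
    (hA : Art w J) (h : Gor w J z t)
    {n : ℕ} {f : MvPolynomial σ k} (hf : IsWeightedHomogeneous w f n) (hn : t < n) : f ∈ J := by
  by_contra hc
  obtain ⟨m, r, h1, _⟩ := h.top hw hJ hA hf hc
  omega

/-- top-degree functional -/
lemma Gor.functional {w : σ → ℕ} (hw : ∀ i, 0 < w i) {J : Ideal (MvPolynomial σ k)} {z : MvPolynomial σ k} {t : ℕ} (hJ : IsWHomogeneousIdeal w J)
    (hA : Art w J) (h : Gor w J z t) : ∃ φ : MvPolynomial σ k →ₗ[k] k,
      ∀ f, IsWeightedHomogeneous w f t → (φ f = 0 ↔ f ∈ J) := by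
  obtain ⟨φ, h1, h2⟩ := Submodule.exists_le_ker_of_notMem (p := J.restrictScalars k) (v := z) h.nz
  refine ⟨φ, fun f hf => ⟨fun h0 => ?_, fun h0 => h2 h0⟩⟩
  have hs : Soc J f := fun i => h.gt hw hJ hA ((X_wh w i).mul hf) (by have := hw i; omega)
  obtain ⟨c, hc⟩ := h.uniq f hs
  have h3 : φ (f - C c * z) = 0 := h2 hc
  rw [map_sub, h0, C_mul', map_smul, zero_sub, neg_eq_zero, smul_eq_mul] at h3
  have : c = 0 := (mul_eq_zero.1 h3).resolve_right h1
  subst this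
  simpa using hc
end RegS


section Hilb
open MvPolynomial
variable {k σ : Type} [Field k] [Fintype σ] {w : σ → ℕ}

lemma fin_piece (hw : ∀ i, 0 < w i) (n : ℕ) : Module.Finite k (weightedHomogeneousSubmodule k w n) :=
  Module.Finite.iff_fg.2 (weightedHomogeneousSubmodule_fg _ w (fun i => (hw i).ne') n)

lemma fin_inf (hw : ∀ i, 0 < w i) (n : ℕ) (V : Submodule k (MvPolynomial σ k)) :
    Module.Finite k (V ⊓ weightedHomogeneousSubmodule k w n : Submodule k (MvPolynomial σ k)) := by
  have := fin_piece (k := k) hw n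
  exact Submodule.finiteDimensional_of_le inf_le_right

lemma finrank_map_inj {V V' : Type} [AddCommGroup V] [Module k V] [AddCommGroup V'] [Module k V'] {f : V →ₗ[k] V'}
    (hf : Function.Injective f) (p : Submodule k V) : Module.finrank k (p.map f) = Module.finrank k p :=
  (Submodule.equivMapOfInjective f hf p).symm.finrank_eq

lemma hilb_step_s18 (hw : ∀ i, 0 < w i) {J : Ideal (MvPolynomial σ k)} (hJ : IsWHomogeneousIdeal w J)
    {y : MvPolynomial σ k} {d : ℕ} (hy : IsWeightedHomogeneous w y d) (hy0 : y ≠ 0)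
    (hr : Reg J y) :
    hilbQ (weightedHomogeneousSubmodule k w) (J ⊔ Ideal.span {y}) =
      (1 - PowerSeries.X ^ d) * hilbQ (weightedHomogeneousSubmodule k w) J := by
  have hinj : Function.Injective (LinearMap.mulLeft k y) := fun a b h => mul_left_cancel₀ hy0 h
  ext n
  rw [sub_mul, one_mul, map_sub, PowerSeries.coeff_X_pow_mul']
  simp only [hilbQ, PowerSeries.coeff_mk]
  split_ifs with hn
  · obtain ⟨m, rfl⟩ : ∃ m, n = d + m := ⟨n - d, by omega⟩
    rw [Nat.add_sub_cancel_left]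
    have e1 : (Submodule.restrictScalars k (J ⊔ Ideal.span {y}) ⊓ weightedHomogeneousSubmodule k w (d + m)) =
      (Submodule.restrictScalars k J ⊓ weightedHomogeneousSubmodule k w (d + m)) ⊔
        (weightedHomogeneousSubmodule k w m).map (LinearMap.mulLeft k y) := by
      apply le_antisymm
      · rintro f ⟨h1, h2⟩
        obtain ⟨g, hg⟩ := mem_sup_span.1 h1
        have h3 := hJ _ hg (d + m)
        rw [map_sub, IsWeightedHomogeneous.weightedHomogeneousComponent_same h2, comp_mul hy] at h3
        refine Submodule.mem_sup.2 ⟨_, ⟨h3, ?_⟩, _, ⟨weightedHomogeneousComponent w m g, ?_, rfl⟩, ?_⟩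
        · exact Submodule.sub_mem _ h2 (hy.mul (weightedHomogeneousComponent_isWeightedHomogeneous m g))
        · exact weightedHomogeneousComponent_isWeightedHomogeneous m g
        · simp
      · refine sup_le (inf_le_inf_right _ ?_) ?_
        · intro f hf; exact Ideal.mem_sup_left hf
        · rintro _ ⟨g, hg, rfl⟩
          exact ⟨mem_sup_span.2 ⟨g, by simp⟩, hy.mul hg⟩
    have e2 : (Submodule.restrictScalars k J ⊓ weightedHomogeneousSubmodule k w (d + m)) ⊓
        (weightedHomogeneousSubmodule k w m).map (LinearMap.mulLeft k y) =
        (Submodule.restrictScalars k J ⊓ weightedHomogeneousSubmodule k w m).map (LinearMap.mulLeft k y) := by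
      apply le_antisymm
      · rintro _ ⟨⟨h1, h2⟩, g, hg, rfl⟩
        exact ⟨g, ⟨hr _ h1, hg⟩, rfl⟩
      · rintro _ ⟨g, ⟨hg1, hg2⟩, rfl⟩
        exact ⟨⟨J.mul_mem_left y hg1, hy.mul hg2⟩, g, hg2, rfl⟩
    have := fin_piece (k := k) hw m
    have := fin_inf (k := k) hw (d + m) (Submodule.restrictScalars k J)
    have h := Submodule.finrank_sup_add_finrank_inf_eq
      (Submodule.restrictScalars k J ⊓ weightedHomogeneousSubmodule k w (d + m))
      ((weightedHomogeneousSubmodule k w m).map (LinearMap.mulLeft k y))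
    rw [← e1, e2, finrank_map_inj hinj, finrank_map_inj hinj] at h
    omega
  · have e1 : (Submodule.restrictScalars k (J ⊔ Ideal.span {y}) ⊓ weightedHomogeneousSubmodule k w n) =
      (Submodule.restrictScalars k J ⊓ weightedHomogeneousSubmodule k w n) := by
      apply le_antisymm
      · rintro f ⟨h1, h2⟩
        obtain ⟨g, hg⟩ := mem_sup_span.1 h1
        have h3 := hJ _ hg n
        rw [map_sub, IsWeightedHomogeneous.weightedHomogeneousComponent_same h2, comp_mul_lt hy (by omega), sub_zero] at h3
        exact ⟨h3, h2⟩
      · refine (inf_le_inf_right _ ?_)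
        intro f hf; exact Ideal.mem_sup_left hf
    rw [e1, sub_zero]

lemma hilb_list_s18 (hw : ∀ i, 0 < w i) (deg : MvPolynomial σ k → ℕ) (l : List (MvPolynomial σ k))
    (hl : ∀ y ∈ l, 0 < deg y ∧ IsWeightedHomogeneous w y (deg y)) :
    ∀ (J : Ideal (MvPolynomial σ k)), IsWHomogeneousIdeal w J → RegSeq J l → J ⊔ Ideal.ofList l ≠ ⊤ →
    hilbQ (weightedHomogeneousSubmodule k w) (J ⊔ Ideal.ofList l) =
      (l.map fun y => (1 - PowerSeries.X ^ deg y)).prod * hilbQ (weightedHomogeneousSubmodule k w) J := by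
  induction l with
  | nil => intro J _ _ _; simp
  | cons y l ih =>
    intro J hJ h1 hne
    have hy := hl y (by simp)
    rw [sup_ofList_cons] at hne ⊢
    rw [ih (fun x hx => hl x (by simp [hx])) _ (wh_sup hJ (wh_single hy.2)) h1.2 hne, hilb_step_s18 hw hJ hy.2 _ h1.1]
    · simp [mul_comm, mul_assoc, mul_left_comm]
    · rintro rfl
      apply hne
      rw [Ideal.eq_top_iff_one]
      exact Ideal.mem_sup_left (Ideal.mem_sup_left (h1.1 1 (by simp)))

lemma a_eq (hw : ∀ i, 0 < w i) (deg : MvPolynomial σ k → ℕ) (l : List (MvPolynomial σ k))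
    (hl : ∀ y ∈ l, 0 < deg y ∧ IsWeightedHomogeneous w y (deg y))
    {J : Ideal (MvPolynomial σ k)} (hJ : IsWHomogeneousIdeal w J) (hr : RegSeq J l)
    (hJl : IsWHomogeneousIdeal w (J ⊔ Ideal.ofList l))
    (hA : Art w (J ⊔ Ideal.ofList l)) {z : MvPolynomial σ k} {t : ℕ} (hG : Gor w (J ⊔ Ideal.ofList l) z t)
    {a : ℤ} (ha : IsAInv (weightedHomogeneousSubmodule k w) J a) :
    a = t - (l.map deg).sum := by
  obtain ⟨num, den, hden, h1, rfl⟩ := ha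
  have hne : J ⊔ Ideal.ofList l ≠ ⊤ := fun h => hG.nz (by rw [h]; trivial)
  have h2 := hilb_list_s18 hw deg l hl J hJ hr hne
  set H := hilbQ (weightedHomogeneousSubmodule k w) (J ⊔ Ideal.ofList l) with hH
  have hgt : ∀ n, t < n → PowerSeries.coeff n H = 0 := by
    intro n hn
    rw [hH, hilbQ, PowerSeries.coeff_mk]
    have : (Submodule.restrictScalars k (J ⊔ Ideal.ofList l) ⊓ weightedHomogeneousSubmodule k w n) =
      weightedHomogeneousSubmodule k w n := inf_eq_right.2 fun f hf => hG.gt hw hJl hA hf hn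
    rw [this, sub_self]
  have ht : PowerSeries.coeff t H ≠ 0 := by
    rw [hH, hilbQ, PowerSeries.coeff_mk]
    have hlt : (Submodule.restrictScalars k (J ⊔ Ideal.ofList l) ⊓ weightedHomogeneousSubmodule k w t) <
      weightedHomogeneousSubmodule k w t := by
      refine lt_of_le_of_ne inf_le_right fun h => ?_
      rw [inf_eq_right] at h
      exact hG.nz (h hG.hz)
    have hf := fin_piece (k := k) hw t
    have := Submodule.finrank_lt_finrank_of_lt hlt
    omega
  let Q : Polynomial ℤ := H.trunc (t + 1)
  have hQ : (Q : PowerSeries ℤ) = H := by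
    ext n
    rw [Polynomial.coeff_coe, PowerSeries.coeff_trunc]
    split_ifs with h
    · rfl
    · rw [hgt n (by omega)]
  have hQd : Q.natDegree = t := by
    apply Polynomial.natDegree_eq_of_le_of_coeff_ne_zero
    · rw [Polynomial.natDegree_le_iff_coeff_eq_zero]
      intro n hn
      rw [← Polynomial.coeff_coe, hQ, hgt n hn]
    · rw [← Polynomial.coeff_coe, hQ]; exact ht
  have hQ0 : Q ≠ 0 := by
    intro h; apply ht; rw [← hQ, h]; simp
  let RR : Polynomial ℤ := (l.map fun y => (1 - Polynomial.X ^ deg y : Polynomial ℤ)).prod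
  have hRR : (RR : PowerSeries ℤ) = (l.map fun y => (1 - PowerSeries.X ^ deg y : PowerSeries ℤ)).prod := by
    change Polynomial.coeToPowerSeries.ringHom RR = _
    rw [map_list_prod, List.map_map]
    congr 2
    ext1 y
    simp
  have hfac : ∀ d, 0 < d → (1 - Polynomial.X ^ d : Polynomial ℤ).natDegree = d ∧ (1 - Polynomial.X ^ d : Polynomial ℤ) ≠ 0 := by
    intro d hd
    have h1 : (1 - Polynomial.X ^ d : Polynomial ℤ) = - (Polynomial.X ^ d - Polynomial.C 1) := by simp
    rw [h1, Polynomial.natDegree_neg, Polynomial.natDegree_X_pow_sub_C]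
    exact ⟨rfl, neg_ne_zero.2 (Polynomial.X_pow_sub_C_ne_zero hd _)⟩
  have hRd : RR.natDegree = (l.map deg).sum ∧ RR ≠ 0 := by
    have : ∀ l' : List (MvPolynomial σ k), (∀ y ∈ l', 0 < deg y) →
      (l'.map fun y => (1 - Polynomial.X ^ deg y : Polynomial ℤ)).prod.natDegree = (l'.map deg).sum ∧ (l'.map fun y => (1 - Polynomial.X ^ deg y : Polynomial ℤ)).prod ≠ 0 := by
      intro l'
      induction l' with
      | nil => simp
      | cons y l' ih =>
        intro h
        obtain ⟨i1, i2⟩ := ih fun x hx => h x (by simp [hx])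
        obtain ⟨f1, f2⟩ := hfac (deg y) (h y (by simp))
        simp only [List.map_cons, List.prod_cons, List.sum_cons]
        exact ⟨by rw [Polynomial.natDegree_mul f2 i2, f1, i1], mul_ne_zero f2 i2⟩
    exact this l fun y hy => (hl y hy).1
  have heq : den * Q = RR * num := by
    apply Polynomial.coe_injective ℤ
    rw [Polynomial.coe_mul, Polynomial.coe_mul, hQ, hRR, h2, ← h1]
    ring
  have hnum : num ≠ 0 := by
    rintro rfl
    rw [mul_zero] at heq
    exact mul_ne_zero hden hQ0 heq
  have := congrArg Polynomial.natDegree heq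
  rw [Polynomial.natDegree_mul hden hQ0, Polynomial.natDegree_mul hRd.2 hnum, hRd.1, hQd] at this
  omega
end Hilb


section Unpack
open MvPolynomial
variable {k σ : Type} [Field k] [Fintype σ] {w : σ → ℕ}

lemma regSeq_of_index (l : List (MvPolynomial σ k)) : ∀ (J : Ideal (MvPolynomial σ k)),
    (∀ i (h : i < l.length), Reg (J ⊔ Ideal.ofList (l.take i)) l[i]) → RegSeq J l := by
  induction l with
  | nil => intro J _; trivial
  | cons y l ih =>
    intro J h
    have h0 := h 0 (by simp)
    rw [List.take_zero, Ideal.ofList_nil, sup_bot_eq] at h0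
    refine ⟨h0, ih _ fun i hi => ?_⟩
    have := h (i + 1) (by simpa using hi)
    rw [List.take_succ_cons, sup_ofList_cons] at this
    simpa using this

lemma irrel_quot (C : Ideal (MvPolynomial σ k)) : irrel (fun n =>
      Submodule.map (Ideal.Quotient.mkₐ k C).toLinearMap
        (MvPolynomial.weightedHomogeneousSubmodule k w n)) =
      (irrel (weightedHomogeneousSubmodule k w)).map (Ideal.Quotient.mk C) := by
  rw [irrel, irrel, Ideal.map_span]
  congr 1
  ext x
  constructor
  · rintro ⟨i, hi, f, hf, rfl⟩; exact ⟨f, ⟨i, hi, hf⟩, rfl⟩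
  · rintro ⟨f, ⟨i, hi, hf⟩, rfl⟩; exact ⟨i, hi, f, hf, rfl⟩

/-- dimension bookkeeping -/
lemma dim_zero {V : Type} [AddCommGroup V] [Module k V] {X0 X : Submodule k V} [Module.Finite k X] (h : X0 ≤ X)
    (h0 : Module.finrank k X - Module.finrank k X0 = 0) : X0 = X :=
  Submodule.eq_of_le_of_finrank_le h (by omega)

lemma dim_one {V : Type} [AddCommGroup V] [Module k V] {X0 X : Submodule k V} [Module.Finite k X] (h : X0 ≤ X)
    (h1 : Module.finrank k X - Module.finrank k X0 = 1) : ∃ z ∈ X, z ∉ X0 ∧ ∀ f ∈ X, ∃ c : k, f - c • z ∈ X0 := by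
  have hne : X0 < X := lt_of_le_of_ne h (by rintro rfl; omega)
  obtain ⟨z, hz, hz0⟩ := SetLike.exists_of_lt hne
  refine ⟨z, hz, hz0, ?_⟩
  have hX0 : Module.Finite k X0 := Submodule.finiteDimensional_of_le h
  have hlt : X0 < X0 ⊔ k ∙ z := lt_of_le_of_ne le_sup_left (fun h => hz0 (by
    rw [h]; exact Submodule.mem_sup_right (Submodule.mem_span_singleton_self z)))
  have hle : X0 ⊔ k ∙ z ≤ X := sup_le h (by simpa using hz)
  have := Submodule.finrank_lt_finrank_of_lt hlt
  have e : X0 ⊔ k ∙ z = X := Submodule.eq_of_le_of_finrank_le hle (by omega)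
  intro f hf
  rw [← e, Submodule.mem_sup] at hf
  obtain ⟨a, ha, b, hb, rfl⟩ := hf
  obtain ⟨c, rfl⟩ := Submodule.mem_span_singleton.1 hb
  exact ⟨c, by simpa using ha⟩

lemma gor_unpack (hw : ∀ i, 0 < w i) {C : Ideal (MvPolynomial σ k)} (hChom : IsWHomogeneousIdeal w C)
    (hGor : IsGorensteinGraded (fun n =>
      Submodule.map (Ideal.Quotient.mkₐ k C).toLinearMap
        (MvPolynomial.weightedHomogeneousSubmodule k w n))) :
    ∃ (l : List (MvPolynomial σ k)) (deg : MvPolynomial σ k → ℕ) (z : MvPolynomial σ k) (t : ℕ),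
      (∀ y ∈ l, 0 < deg y ∧ IsWeightedHomogeneous w y (deg y)) ∧ RegSeq C l ∧
      Gor w (C ⊔ Ideal.ofList l) z t ∧ ∀ i, (X i : MvPolynomial σ k) ∈ (C ⊔ Ideal.ofList l).radical := by
  classical
  obtain ⟨xs, hreg, hhom, hrad, t, ht1, ht0⟩ := hGor
  have hlift : ∀ x : MvPolynomial σ k ⧸ C, ∃ y : MvPolynomial σ k, Ideal.Quotient.mk C y = x ∧
      (x ∈ xs → ∃ i, 0 < i ∧ IsWeightedHomogeneous w y i) := by
    intro x
    by_cases hx : x ∈ xs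
    · obtain ⟨i, hi, y, hy, rfl⟩ := hhom x hx
      exact ⟨y, rfl, fun _ => ⟨i, hi, hy⟩⟩
    · obtain ⟨y, hy⟩ := Ideal.Quotient.mk_surjective x
      exact ⟨y, hy, fun h => absurd h hx⟩
  choose lift hl1 hl2 using hlift
  let l := xs.map lift
  have hlxs : l.map (Ideal.Quotient.mk C) = xs := by
    simp only [l, List.map_map]
    conv_rhs => rw [← List.map_id xs]
    exact List.map_congr_left fun x _ => hl1 x
  have hl : ∀ y ∈ l, ∃ i, 0 < i ∧ IsWeightedHomogeneous w y i := by
    intro y hy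
    obtain ⟨x, hx, rfl⟩ := List.mem_map.1 hy
    exact hl2 x hx
  have hdeg : ∀ y, ∃ i, y ∈ l → 0 < i ∧ IsWeightedHomogeneous w y i := by
    intro y
    by_cases hy : y ∈ l
    · obtain ⟨i, hi⟩ := hl y hy; exact ⟨i, fun _ => hi⟩
    · exact ⟨0, fun h => absurd h hy⟩
  choose deg hdeg using hdeg
  have hspan : Ideal.span {x | x ∈ xs} = (Ideal.ofList l).map (Ideal.Quotient.mk C) := by
    rw [Ideal.map_ofList, hlxs]
  have hmem : ∀ f, Ideal.Quotient.mk C f ∈ Ideal.span {x | x ∈ xs} ↔ f ∈ C ⊔ Ideal.ofList l := by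
    intro f
    rw [hspan, Ideal.mem_quotient_iff_mem_sup, sup_comm]
  have hJhom : IsWHomogeneousIdeal w (C ⊔ Ideal.ofList l) :=
    wh_sup hChom (wh_span fun x hx => ⟨deg x, (hdeg x hx).2⟩)
  have hsoc : ∀ f, Ideal.Quotient.mk C f ∈ (Ideal.span {x | x ∈ xs}).colon (irrel (fun n =>
      Submodule.map (Ideal.Quotient.mkₐ k C).toLinearMap
        (MvPolynomial.weightedHomogeneousSubmodule k w n))) ↔ Soc (C ⊔ Ideal.ofList l) f := by
    intro f
    rw [irrel_quot, irrel_eq hw, Ideal.map_span]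
    have := Submodule.colon_span (N := Ideal.span {x | x ∈ xs}) (S := (Ideal.Quotient.mk C) '' Set.range (X : σ → MvPolynomial σ k))
    refine (iff_of_eq (congrArg (fun I => Ideal.Quotient.mk C f ∈ I) this)).trans ?_
    rw [Submodule.mem_colon]
    simp only [Set.mem_image, Set.mem_range, exists_exists_eq_and, forall_exists_index, forall_apply_eq_imp_iff, Soc,
      smul_eq_mul, ← map_mul, hmem]
    simp only [mul_comm]
  refine ⟨l, deg, ?_⟩
  set 𝒜 : ℕ → Submodule k (MvPolynomial σ k ⧸ C) := (fun n =>
      Submodule.map (Ideal.Quotient.mkₐ k C).toLinearMap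
        (MvPolynomial.weightedHomogeneousSubmodule k w n)) with h𝒜
  set J' : Ideal (MvPolynomial σ k ⧸ C) := Ideal.span {x | x ∈ xs} with hJ'
  have hfin : ∀ n, ∀ V : Submodule k (MvPolynomial σ k ⧸ C), Module.Finite k (V ⊓ 𝒜 n : Submodule k (MvPolynomial σ k ⧸ C)) := by
    intro n V
    have := fin_piece (k := k) hw n
    have h2 : Module.Finite k (𝒜 n) := by rw [h𝒜]; infer_instance
    exact Submodule.finiteDimensional_of_le (inf_le_right : V ⊓ 𝒜 n ≤ 𝒜 n)
  have hle : ∀ n, (Submodule.restrictScalars k J' ⊓ 𝒜 n) ≤ (Submodule.restrictScalars k (J'.colon (irrel 𝒜)) ⊓ 𝒜 n) := by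
    intro n
    refine inf_le_inf_right _ fun f hf => ?_
    exact Submodule.mem_colon.2 fun s _ => J'.mul_mem_right _ hf
  obtain ⟨z', ⟨hz1, z, hz, rfl⟩, hz2, hz3⟩ := @dim_one _ _ _ _ _ _ _ (hfin t _) (hle t) ht1
  change IsWeightedHomogeneous w z t at hz
  have hzz : z ∉ C ⊔ Ideal.ofList l := by
    intro h
    exact hz2 ⟨(hmem z).2 h, z, hz, rfl⟩
  have hhomsoc : ∀ n f, IsWeightedHomogeneous w f n → Soc (C ⊔ Ideal.ofList l) f →
      ∃ c : k, f - MvPolynomial.C c * weightedHomogeneousComponent w n z ∈ C ⊔ Ideal.ofList l := by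
    intro n f hf hs
    by_cases hn : n = t
    · subst hn
      obtain ⟨c, hc⟩ := hz3 (Ideal.Quotient.mk C f) ⟨(hsoc f).2 hs, f, hf, rfl⟩
      refine ⟨c, (hmem _).1 ?_⟩
      rw [hz.weightedHomogeneousComponent_same]
      have := hc.1
      rw [C_mul']
      exact this
    · refine ⟨0, ?_⟩
      have h := @dim_zero _ _ _ _ _ _ _ (hfin n _) (hle n) (ht0 n hn)
      have h2 : Ideal.Quotient.mk C f ∈ (Submodule.restrictScalars k J' ⊓ 𝒜 n) := by
        rw [h]; exact ⟨(hsoc f).2 hs, f, hf, rfl⟩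
      simpa using (hmem f).1 h2.1
  refine ⟨z, t, fun y hy => hdeg y hy, ?_, ⟨hz, hzz, (hsoc z).1 hz1, ?_⟩, ?_⟩
  · apply regSeq_of_index
    intro i hi f hf
    have hi' : i < xs.length := by simpa [l] using hi
    have h := hreg.regular_mod_prev i hi'
    rw [isSMulRegular_quotient_iff_mem_of_smul_mem] at h
    have hm : ∀ g, Ideal.Quotient.mk C g ∈ (Ideal.ofList (xs.take i) • ⊤ : Submodule (MvPolynomial σ k ⧸ C) (MvPolynomial σ k ⧸ C)) ↔ g ∈ C ⊔ Ideal.ofList (l.take i) := by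
      intro g
      have : Ideal.ofList (xs.take i) = (Ideal.ofList (l.take i)).map (Ideal.Quotient.mk C) := by
        rw [Ideal.map_ofList, List.map_take, hlxs]
      rw [smul_eq_mul, Ideal.mul_top, this, Ideal.mem_quotient_iff_mem_sup, sup_comm]
    rw [← hm]
    apply h
    have h3 : xs[i] = Ideal.Quotient.mk C l[i] := by simp [l, hl1]
    rw [h3]
    have h4 := (hm (l[i] * f)).2 hf
    rw [map_mul] at h4
    exact h4
  · intro f hs
    choose! c hc using hhomsoc
    refine ⟨c t (weightedHomogeneousComponent w t f), mem_of_comp w fun n => ?_⟩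
    have h1 := hc n _ (weightedHomogeneousComponent_isWeightedHomogeneous n f) (hs.comp hJhom n)
    rw [map_sub, weightedHomogeneousComponent_C_mul]
    by_cases hn : n = t
    · subst hn; exact h1
    · rw [hz.weightedHomogeneousComponent_ne _ (by first | exact hn | exact Ne.symm hn), mul_zero] at h1 ⊢
      exact h1
  · intro i
    have : Ideal.Quotient.mk C (X i) ∈ J'.radical := by
      rw [hrad, irrel_quot, irrel_eq hw]
      exact Ideal.mem_map_of_mem _ (Ideal.subset_span ⟨i, rfl⟩)
    obtain ⟨n, hn⟩ := this
    rw [← map_pow] at hn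
    exact ⟨n, (hmem _).1 hn⟩
end Unpack


section FrobGor
open MvPolynomial
variable {k σ : Type} [Field k] [Fintype σ] {w : σ → ℕ}
variable (p : ℕ) [Fact p.Prime] [CharP k p] (e : ℕ)

lemma pow_mem_frob {J : Ideal (MvPolynomial σ k)} {f : MvPolynomial σ k} {q : ℕ} (hf : f ∈ J) : f ^ q ∈ frobPow J q :=
  Ideal.subset_span ⟨f, hf, rfl⟩

lemma topMon_wh (q : ℕ) : IsWeightedHomogeneous w (topMon k σ q) ((q - 1) * ∑ i, w i) := by
  apply isWeightedHomogeneous_monomial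
  rw [Finsupp.weight_apply, Finsupp.sum_fintype _ _ (by simp)]
  simp [topExp, Finset.mul_sum]

lemma X_topMon (i : σ) : ∃ g, X i * topMon k σ (p ^ e) = X i ^ p ^ e * g := by
  classical
  refine ⟨monomial (topExp σ (p ^ e) - Finsupp.single i (p ^ e - 1)) 1, ?_⟩
  have := qpos p e
  rw [topMon, X_pow_eq_monomial, X, monomial_mul, monomial_mul, one_mul]
  refine congrArg (fun m => monomial m _) ?_
  ext j
  by_cases h : j = i
  · subst h; simp [topExp]; omega
  · simp [topExp, Finsupp.single_apply, Ne.symm h]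

lemma soc_top {J : Ideal (MvPolynomial σ k)} {f : MvPolynomial σ k} (h : Soc J f) :
    Soc (frobPow J (p ^ e)) (topMon k σ (p ^ e) * f ^ p ^ e) := by
  intro i
  obtain ⟨g, hg⟩ := X_topMon (k := k) p e i
  rw [← mul_assoc, hg, mul_right_comm, ← mul_pow]
  exact Ideal.mul_mem_right _ _ (pow_mem_frob (h i))

lemma sub_C_mem_aug (g : MvPolynomial σ k) : ∃ c : k, g - C c ∈ Ideal.span (Set.range (X : σ → MvPolynomial σ k)) := by
  induction g using MvPolynomial.induction_on with
  | C a => exact ⟨a, by simp⟩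
  | add f g hf hg =>
    obtain ⟨a, ha⟩ := hf
    obtain ⟨b, hb⟩ := hg
    exact ⟨a + b, by convert Ideal.add_mem _ ha hb using 1; rw [C_add]; ring⟩
  | mul_X f i _ => exact ⟨0, by rw [C_0, sub_zero]; exact Ideal.mul_mem_left _ _ (Ideal.subset_span ⟨i, rfl⟩)⟩

lemma gor_frob {J : Ideal (MvPolynomial σ k)} {z : MvPolynomial σ k} {t : ℕ} (h : Gor w J z t) :
    Gor w (frobPow J (p ^ e)) (topMon k σ (p ^ e) * z ^ p ^ e) (p ^ e * t + (p ^ e - 1) * ∑ i, w i) := by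
  have hs := soc_top p e h.soc
  refine ⟨?_, ?_, hs, ?_⟩
  · rw [add_comm]
    simpa using (topMon_wh (k := k) (w := w) (p ^ e)).mul (h.hz.pow (p ^ e))
  · intro hc
    have := indep_frob (J := J) p e {()} (fun _ => z) (fun c hc i _ => by
      by_contra h0
      apply h.nz
      simp only [Finset.sum_singleton] at hc
      have h2 := J.mul_mem_left (C (c i)⁻¹) hc
      rw [← mul_assoc, ← C_mul] at h2
      change C ((c i)⁻¹ * c i) * z ∈ J at h2
      rwa [inv_mul_cancel₀ h0, C_1, one_mul] at h2) (fun _ => 1) (by simpa using hc) () (by simp)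
    exact one_ne_zero this
  · intro f hf
    have h1 := soc_frob p e hf
    have h2 : f ∈ frobPow J (p ^ e) ⊔ Ideal.span {topMon k σ (p ^ e) * z ^ p ^ e} := by
      refine (sup_le (le_sup_left) ?_ : _ ≤ frobPow J (p ^ e) ⊔ Ideal.span {topMon k σ (p ^ e) * z ^ p ^ e}) h1
      refine Ideal.span_le.2 ?_
      rintro _ ⟨g, hg, rfl⟩
      obtain ⟨c, hc⟩ := h.uniq g hg
      refine mem_sup_span.2 ⟨(C c) ^ p ^ e, ?_⟩
      have := pow_mem_frob (q := p ^ e) hc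
      rw [sub_pow_char_pow, mul_pow] at this
      convert Ideal.mul_mem_left _ (topMon k σ (p ^ e)) this using 1
      ring
    obtain ⟨g, hg⟩ := mem_sup_span.1 h2
    obtain ⟨c, hc⟩ := sub_C_mem_aug g
    refine ⟨c, ?_⟩
    have h3 := mem_aug_mul hs hc
    convert Ideal.add_mem _ hg h3 using 1
    ring

lemma X_pow_mem (i : σ) : (X i : MvPolynomial σ k) ^ p ^ e ∈ frobPow (Ideal.span (Set.range (X : σ → MvPolynomial σ k))) (p ^ e) :=
  pow_mem_frob (Ideal.subset_span ⟨i, rfl⟩)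

lemma monomial_mem_frob {m : σ →₀ ℕ} {i : σ} (h : p ^ e ≤ m i) (c : k) :
    monomial m c ∈ frobPow (Ideal.span (Set.range (X : σ → MvPolynomial σ k))) (p ^ e) := by
  classical
  have : monomial m c = monomial (m - Finsupp.single i (p ^ e)) c * (X i : MvPolynomial σ k) ^ p ^ e := by
    rw [X_pow_eq_monomial, monomial_mul, mul_one]
    refine congrArg (fun m => monomial m _) ?_
    ext j
    by_cases hj : j = i
    · subst hj; simp; omega
    · simp [Finsupp.single_apply, Ne.symm hj]
  rw [this]
  exact Ideal.mul_mem_left _ _ (X_pow_mem p e i)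

lemma exists_v (hw : ∀ i, 0 < w i) {u : MvPolynomial σ k} {n : ℕ} (hu : IsWeightedHomogeneous w u n)
    (hum : u ∉ frobPow (Ideal.span (Set.range (X : σ → MvPolynomial σ k))) (p ^ e)) :
    ∃ v, topMon k σ (p ^ e) - u * v ∈ frobPow (Ideal.span (Set.range (X : σ → MvPolynomial σ k))) (p ^ e) := by
  classical
  set M := frobPow (Ideal.span (Set.range (X : σ → MvPolynomial σ k))) (p ^ e)
  have hq := qpos p e
  have : ∃ β ∈ u.support, ∀ i, β i < p ^ e := by
    by_contra! hc
    apply hum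
    rw [u.as_sum]
    refine Ideal.sum_mem _ fun β hβ => ?_
    obtain ⟨i, hi⟩ := hc β hβ
    exact monomial_mem_frob p e hi _
  obtain ⟨β, hβ, hlt⟩ := this
  have hb := mem_support_iff.1 hβ
  have hT : ∀ i, topExp σ (p ^ e) i = p ^ e - 1 := fun i => rfl
  refine ⟨monomial (topExp σ (p ^ e) - β) (coeff β u)⁻¹, ?_⟩
  conv => enter [2, 2, 1]; rw [u.as_sum]
  rw [Finset.sum_mul, ← Finset.add_sum_erase _ _ hβ, ← sub_sub]
  have h1 : topMon k σ (p ^ e) - monomial β (coeff β u) * monomial (topExp σ (p ^ e) - β) (coeff β u)⁻¹ = 0 := by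
    rw [monomial_mul, mul_inv_cancel₀ hb, topMon, sub_eq_zero]
    refine congrArg (fun m => monomial m _) ?_
    ext i
    have := hlt i
    simp [hT]; omega
  rw [h1, zero_sub, M.neg_mem_iff]
  refine Ideal.sum_mem _ fun γ hγ => ?_
  rw [Finset.mem_erase] at hγ
  have hex : ∃ i, β i < γ i := by
    by_contra! hc
    apply hγ.1
    have h2 := hu (mem_support_iff.1 hγ.2)
    have h3 := hu hb
    rw [Finsupp.weight_apply, Finsupp.sum_fintype _ _ (by simp)] at h2 h3
    simp only [smul_eq_mul] at h2 h3
    have h4 := (Finset.sum_eq_sum_iff_of_le (s := univ) (f := fun i => γ i * w i) (g := fun i => β i * w i)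
      (fun i _ => Nat.mul_le_mul_right _ (hc i))).1 (h2.trans h3.symm)
    ext i
    exact Nat.eq_of_mul_eq_mul_right (hw i) (h4 i (mem_univ i))
  obtain ⟨i, hi⟩ := hex
  rw [monomial_mul]
  refine monomial_mem_frob p e (i := i) ?_ _
  have := hlt i
  simp [hT]; omega

end FrobGor


section ExistsU
open MvPolynomial
variable {k σ : Type} [Field k] [Fintype σ] {w : σ → ℕ}

lemma dual_link (hw : ∀ i, 0 < w i) {A B : Ideal (MvPolynomial σ k)} {zA zB : MvPolynomial σ k} {tA tB : ℕ}
    (hA : IsWHomogeneousIdeal w A) (hB : IsWHomogeneousIdeal w B) (aA : Art w A) (aB : Art w B)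
    (gA : Gor w A zA tA) (gB : Gor w B zB tB) (hBA : B ≤ A) :
    ∃ δ u, tA + δ = tB ∧ IsWeightedHomogeneous w u δ ∧
      ∀ n f, IsWeightedHomogeneous w f n → (u * f ∈ B ↔ f ∈ A) := by
  obtain ⟨δ, r0, hδ, -, -⟩ := gB.top hw hB aB gA.hz (fun h => gA.nz (hBA h))
  obtain ⟨φ, hφ⟩ := gB.functional hw hB aB
  obtain ⟨ψ, hψ⟩ := gA.functional hw hA aA
  have hfin := fin_piece (k := k) hw tA
  let V := weightedHomogeneousSubmodule k w tA
  let L : MvPolynomial σ k →ₗ[k] Module.Dual k V :=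
    (LinearMap.lcomp k k V.subtype) ∘ₗ (LinearMap.compRight k φ) ∘ₗ (LinearMap.mul k (MvPolynomial σ k))
  have hL : ∀ u v, L u v = φ (u * (v : MvPolynomial σ k)) := fun u v => rfl
  let W : Submodule k (Module.Dual k V) := (weightedHomogeneousSubmodule k w δ).map L
  have hψW : ψ ∘ₗ V.subtype ∈ W := by
    rw [← Subspace.dualCoannihilator_dualAnnihilator_eq (W := W), Submodule.mem_dualAnnihilator]
    intro v hv
    rw [Submodule.mem_dualCoannihilator] at hv
    have hvB : (v : MvPolynomial σ k) ∈ B := by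
      by_contra hc
      obtain ⟨m, r, hm, hr, hrv⟩ := gB.top hw hB aB v.2 hc
      have : m = δ := by omega
      subst this
      have h1 := hv (L r) ⟨r, hr, rfl⟩
      rw [hL] at h1
      refine hrv ((hφ _ ?_).1 h1)
      rw [← hm]; exact hr.mul v.2
    exact (hψ _ v.2).2 (hBA hvB)
  obtain ⟨u, hu, huL⟩ := hψW
  have huφ : ∀ v, IsWeightedHomogeneous w v tA → φ (u * v) = ψ v := by
    intro v hv
    have := LinearMap.congr_fun huL ⟨v, hv⟩
    rw [hL] at this
    exact this
  have hu' : IsWeightedHomogeneous w u δ := hu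
  refine ⟨δ, u, by omega, hu', fun n f hf => ⟨fun h => ?_, fun h => ?_⟩⟩
  · by_contra hc
    obtain ⟨m, r, hm, hr, hrf⟩ := gA.top hw hA aA hf hc
    have h1 : IsWeightedHomogeneous w (r * f) tA := by rw [← hm]; exact hr.mul hf
    refine hrf ((hψ _ h1).1 ?_)
    rw [← huφ _ h1, hφ]
    · rw [mul_left_comm]; exact B.mul_mem_left _ h
    · rw [← hδ]; exact hu'.mul h1
  · by_contra hc
    obtain ⟨m, r, hm, hr, hrf⟩ := gB.top hw hB aB (hu'.mul hf) hc
    have h1 : IsWeightedHomogeneous w (r * f) tA := by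
      have : tA = m + n := by omega
      rw [this]; exact hr.mul hf
    apply hrf
    rw [mul_left_comm, ← hφ, huφ _ h1, hψ _ h1]
    · exact A.mul_mem_left _ h
    · rw [← hδ]; exact hu'.mul h1

lemma comp_ofList_lt {D : ℕ} {L : List (MvPolynomial σ k)} (hL : ∀ y ∈ L, ∃ d, D ≤ d ∧ IsWeightedHomogeneous w y d)
    {b : MvPolynomial σ k} (hb : b ∈ Ideal.ofList L) {n : ℕ} (hn : n < D) : weightedHomogeneousComponent w n b = 0 := by
  have : ∀ g, weightedHomogeneousComponent w n (g * b) = 0 := by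
    refine Submodule.span_induction (p := fun b _ => ∀ g, weightedHomogeneousComponent w n (g * b) = 0) ?_ ?_ ?_ ?_ hb
    · intro y hy g
      obtain ⟨d, hd, hy⟩ := hL y hy
      rw [mul_comm]
      exact comp_mul_lt hy (by omega)
    · simp
    · intro x y _ _ h1 h2 g
      rw [mul_add, map_add, h1, h2, add_zero]
    · intro a x _ h1 g
      rw [smul_eq_mul, ← mul_assoc]; exact h1 _
  simpa using this 1

variable (p : ℕ) [Fact p.Prime] [CharP k p] (e : ℕ)

lemma frob_le (J : Ideal (MvPolynomial σ k)) : frobPow J (p ^ e) ≤ J :=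
  Ideal.span_le.2 (by rintro _ ⟨x, hx, rfl⟩; exact J.pow_mem_of_mem hx _ (qpos p e))

lemma frob_mono {I J : Ideal (MvPolynomial σ k)} (h : I ≤ J) (q : ℕ) : frobPow I q ≤ frobPow J q :=
  Ideal.span_mono (Set.image_mono h)

lemma frob_sup_list (J : Ideal (MvPolynomial σ k)) (l : List (MvPolynomial σ k)) (N : ℕ) :
    frobPow (J ⊔ Ideal.ofList (l.map (· ^ N))) (p ^ e) = frobPow J (p ^ e) ⊔ Ideal.ofList (l.map (· ^ (N * p ^ e))) := by
  rw [frobPow_eq, frobPow_eq, Ideal.map_sup, Ideal.map_ofList, List.map_map]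
  congr 3
  ext x : 1
  simp [iterateFrobenius_def, pow_mul]

lemma rad_pow {C : Ideal (MvPolynomial σ k)} {l : List (MvPolynomial σ k)} (N : ℕ)
    (h : ∀ i, (X i : MvPolynomial σ k) ∈ (C ⊔ Ideal.ofList l).radical) (i : σ) :
    (X i : MvPolynomial σ k) ∈ (C ⊔ Ideal.ofList (l.map (· ^ N))).radical := by
  have hle : C ⊔ Ideal.ofList l ≤ (C ⊔ Ideal.ofList (l.map (· ^ N))).radical := by
    refine sup_le (le_sup_left.trans Ideal.le_radical) (Ideal.span_le.2 fun y hy => ?_)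
    refine ⟨N, Ideal.mem_sup_right (Ideal.subset_span ?_)⟩
    exact List.mem_map.2 ⟨y, hy, rfl⟩
  exact Ideal.radical_le_radical_iff.2 hle (h i)

lemma rad_frob {J : Ideal (MvPolynomial σ k)}
    (h : ∀ i, (X i : MvPolynomial σ k) ∈ J.radical) (i : σ) :
    (X i : MvPolynomial σ k) ∈ (frobPow J (p ^ e)).radical := by
  have hle : J ≤ (frobPow J (p ^ e)).radical := fun y hy => ⟨p ^ e, pow_mem_frob hy⟩
  exact Ideal.radical_le_radical_iff.2 hle (h i)

lemma frob_mul_pow {M J : Ideal (MvPolynomial σ k)} {z u : MvPolynomial σ k} {q : ℕ} (h : ∀ y ∈ M, y * z ∈ J)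
    (hu : u ∈ frobPow M q) : u * z ^ q ∈ frobPow J q := by
  refine Submodule.span_induction (p := fun u _ => u * z ^ q ∈ frobPow J q) ?_ ?_ ?_ ?_ hu
  · rintro _ ⟨y, hy, rfl⟩
    change y ^ q * z ^ q ∈ _
    rw [← mul_pow]; exact pow_mem_frob (h y hy)
  · simp
  · intro x y _ _ h1 h2; rw [add_mul]; exact Ideal.add_mem _ h1 h2
  · intro a x _ h1; rw [smul_eq_mul, mul_assoc]; exact Ideal.mul_mem_left _ _ h1

lemma fpure_use {C J : Ideal (MvPolynomial σ k)} (hCJ : C ≤ J) (hFp : IsFPureRing (MvPolynomial σ k ⧸ C) p)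
    {z : MvPolynomial σ k} (hz : z ∉ J) : z ^ p ^ e ∉ frobPow J (p ^ e) ⊔ C := by
  intro hc
  refine hFp (J.map (Ideal.Quotient.mk C)) (Ideal.Quotient.mk C z) ?_ e ?_
  · rw [Ideal.mem_quotient_iff_mem_sup, sup_eq_left.2 hCJ]; exact hz
  · rw [← Ideal.mem_quotient_iff_mem_sup, map_pow] at hc
    refine (?_ : (frobPow J (p ^ e)).map (Ideal.Quotient.mk C) ≤ _) hc
    rw [frobPow, Ideal.map_span]
    refine Ideal.span_le.2 ?_
    rintro _ ⟨_, ⟨x, hx, rfl⟩, rfl⟩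
    refine Ideal.subset_span ⟨Ideal.Quotient.mk C x, Ideal.mem_map_of_mem _ hx, ?_⟩
    simp

lemma exists_u (hw : ∀ i, 0 < w i) {C : Ideal (MvPolynomial σ k)} (hC : IsWHomogeneousIdeal w C)
    (hFp : IsFPureRing (MvPolynomial σ k ⧸ C) p)
    {l : List (MvPolynomial σ k)} {deg : MvPolynomial σ k → ℕ} {z : MvPolynomial σ k} {t : ℕ}
    (hl : ∀ y ∈ l, 0 < deg y ∧ IsWeightedHomogeneous w y (deg y)) (hreg : RegSeq C l)
    (hG : Gor w (C ⊔ Ideal.ofList l) z t) (hrad : ∀ i, (X i : MvPolynomial σ k) ∈ (C ⊔ Ideal.ofList l).radical) :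
    ∃ δ u, (p ^ e - 1) * (l.map deg).sum + δ = (p ^ e - 1) * t + (p ^ e - 1) * ∑ i, w i ∧
      IsWeightedHomogeneous w u δ ∧ (∀ c ∈ C, u * c ∈ frobPow C (p ^ e)) ∧
      u ∉ frobPow (Ideal.span (Set.range (X : σ → MvPolynomial σ k))) (p ^ e) := by
  classical
  obtain ⟨G, hGC⟩ : C.FG := IsNoetherian.noetherian C
  have hE : ∃ E, ∀ g ∈ G, weightedTotalDegree w g ≤ E :=
    ⟨G.sup (weightedTotalDegree w), fun g hg => Finset.le_sup hg⟩
  obtain ⟨E, hE⟩ := hE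
  obtain ⟨r, hr⟩ : ∃ r, p ^ e = r + 1 := ⟨p ^ e - 1, by have := qpos p e; omega⟩
  set s := ∑ i, w i with hs
  set Y := (l.map deg).sum with hY
  let N := r * t + r * s + E
  let N' := N * r + N + r
  have hN' : (N + 1) * p ^ e = N' + 1 := by rw [hr]; simp only [N']; ring
  obtain ⟨zJ, gJ⟩ := gor_list hw deg N l hl C z t hC hreg hG
  obtain ⟨zA, gA⟩ := gor_list hw deg N' l hl C z t hC hreg hG
  have hlist : ∀ K, IsWHomogeneousIdeal w (Ideal.ofList (l.map (· ^ K))) := fun K => wh_span (by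
    intro x hx
    obtain ⟨y, hy, rfl⟩ := List.mem_map.1 hx
    exact ⟨_, (hl y hy).2.pow K⟩)
  set J := C ⊔ Ideal.ofList (l.map (· ^ (N + 1))) with hJ
  have hJh : IsWHomogeneousIdeal w J := wh_sup hC (hlist _)
  have hBeq := frob_sup_list p e C l (N + 1)
  rw [hN'] at hBeq
  obtain ⟨δ, u, h1, hu, h2⟩ := dual_link hw (wh_sup hC (hlist (N' + 1))) (wh_frob p e hJh)
    (art_of_radical (rad_pow (N' + 1) hrad)) (art_of_radical (rad_frob p e (rad_pow (N + 1) hrad))) gA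
    (gor_frob p e gJ) (by rw [hBeq]; exact sup_le_sup_right (frob_le p e C) _)
  have h3 : r * Y + δ = r * t + r * s := by
    rw [hr, Nat.add_sub_cancel, ← hs, ← hY] at h1
    simp only [N'] at h1
    nlinarith
  refine ⟨δ, u, by rw [hr, Nat.add_sub_cancel]; exact h3, hu, ?_, ?_⟩
  · have key : ∀ g ∈ G, u * g ∈ frobPow C (p ^ e) := by
      intro g hg
      have hgC : g ∈ C := by rw [← hGC]; exact Ideal.subset_span hg
      obtain ⟨S, hS⟩ := sum_comp w g
      rw [hS, Finset.mul_sum]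
      refine Ideal.sum_mem _ fun m _ => ?_
      by_cases hm : weightedTotalDegree w g < m
      · rw [weightedHomogeneousComponent_eq_zero _ _ hm, mul_zero]; exact Ideal.zero_mem _
      · have hmh : IsWeightedHomogeneous w (weightedHomogeneousComponent w m g) m :=
          weightedHomogeneousComponent_isWeightedHomogeneous m g
        have h4 := (h2 m _ hmh).2 (Ideal.mem_sup_left (hC g hgC m))
        rw [hBeq] at h4
        obtain ⟨b1, hb1, b2, hb2, hb⟩ := Submodule.mem_sup.1 h4
        have h5 : weightedHomogeneousComponent w (δ + m) b2 = 0 := by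
          refine comp_ofList_lt (D := N' + 1) ?_ hb2 ?_
          · intro x hx
            obtain ⟨y, hy, rfl⟩ := List.mem_map.1 hx
            refine ⟨_, ?_, (hl y hy).2.pow _⟩
            have := (hl y hy).1
            rw [smul_eq_mul]
            exact Nat.le_mul_of_pos_right _ this
          · have := hE g hg
            have h6 : N ≤ N' := by simp only [N']; nlinarith
            simp only [N] at h6
            omega
        have h6 := congrArg (weightedHomogeneousComponent w (δ + m)) hb
        rw [map_add, h5, add_zero, (hu.mul hmh).weightedHomogeneousComponent_same] at h6
        rw [← h6]
        exact wh_frob p e hC _ hb1 _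
    intro c hc
    have : C ≤ Submodule.comap (LinearMap.mulLeft (MvPolynomial σ k) u) (frobPow C (p ^ e)) := by
      conv_lhs => rw [← hGC]
      exact Submodule.span_le.2 key
    exact this hc
  · intro hum
    have h4 : u * zJ ^ p ^ e ∈ frobPow J (p ^ e) := frob_mul_pow (fun y hy => mem_aug_mul gJ.soc hy) hum
    have h5 := (h2 _ _ (gJ.hz.pow _)).1 h4
    refine fpure_use p e (le_sup_left : C ≤ J) hFp gJ.nz ?_
    rw [hBeq]
    exact (sup_le le_sup_right (le_sup_right.trans le_sup_left) : C ⊔ _ ≤ _) h5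
end ExistsU


section MainStep
open MvPolynomial
variable {k σ : Type} [Field k] [Fintype σ] {w : σ → ℕ}

lemma dim_indep {V : Type} [AddCommGroup V] [Module k V] {X0 X : Submodule k V} [Module.Finite k X] (h : X0 ≤ X) {r : ℕ}
    (hr : Module.finrank k X - Module.finrank k X0 = r) :
    ∃ f : Fin r → V, (∀ i, f i ∈ X) ∧ ∀ (s : Finset (Fin r)) (c : Fin r → k), ∑ i ∈ s, c i • f i ∈ X0 → ∀ i ∈ s, c i = 0 := by
  let Z := X0.comap X.subtype
  have h1 : Module.finrank k (X ⧸ Z) = r := by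
    have h2 := Submodule.finrank_quotient_add_finrank Z
    have h3 := (Submodule.comapSubtypeEquivOfLe h).finrank_eq
    change Module.finrank k Z = _ at h3
    omega
  let b := Module.finBasisOfFinrankEq k (X ⧸ Z) h1
  choose f hf using fun i => Submodule.mkQ_surjective Z (b i)
  refine ⟨fun i => f i, fun i => (f i).2, fun s c hc => ?_⟩
  refine linearIndependent_iff'.1 b.linearIndependent s c ?_
  have : ∑ i ∈ s, c i • b i = Z.mkQ (∑ i ∈ s, c i • f i) := by simp [hf, map_sum]
  rw [this, Submodule.mkQ_apply, Submodule.Quotient.mk_eq_zero]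
  change X.subtype _ ∈ X0
  simpa using hc

lemma dim_ker {V W : Type} [AddCommGroup V] [Module k V] [AddCommGroup W] [Module k W] {X0 X : Submodule k V} [Module.Finite k X] (h : X0 ≤ X) {r : ℕ}
    (hr : Module.finrank k X - Module.finrank k X0 = r) (F : V →ₗ[k] W) (hF : ∀ x ∈ X0, F x = 0)
    (g : Fin r → V) (hg : ∀ i, g i ∈ X) (hind : LinearIndependent k fun i => F (g i)) :
    ∀ f ∈ X, F f = 0 → f ∈ X0 := by
  have h1 := LinearMap.finrank_range_add_finrank_ker (F.domRestrict X)
  have h2 : r ≤ Module.finrank k (LinearMap.range (F.domRestrict X)) := by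
    have := finrank_span_eq_card hind
    rw [Fintype.card_fin] at this
    rw [← this]
    refine Submodule.finrank_mono (Submodule.span_le.2 ?_)
    rintro _ ⟨i, rfl⟩
    exact ⟨⟨g i, hg i⟩, rfl⟩
  let Z := X0.comap X.subtype
  have h3 := (Submodule.comapSubtypeEquivOfLe h).finrank_eq
  have hle : Z ≤ LinearMap.ker (F.domRestrict X) := fun x hx => hF _ hx
  have h4 : Z = LinearMap.ker (F.domRestrict X) := Submodule.eq_of_le_of_finrank_le hle (by
    change Module.finrank k Z = _ at h3
    have := Submodule.finrank_mono (R := k) h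
    omega)
  intro f hf hf0
  have : (⟨f, hf⟩ : X) ∈ Z := by rw [h4]; exact hf0
  exact this

variable (p : ℕ) [Fact p.Prime] [CharP k p] (e : ℕ)

lemma main_ind (hw : ∀ i, 0 < w i) {C I : Ideal (MvPolynomial σ k)} (hC : IsWHomogeneousIdeal w C)
    (hI : IsWHomogeneousIdeal w I) (hCI : C ≤ I) (hArt : Art w (frobPow I (p ^ e)))
    {δ : ℕ} {u v : MvPolynomial σ k} (hu : IsWeightedHomogeneous w u δ)
    (huC : ∀ c ∈ C, u * c ∈ frobPow C (p ^ e))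
    (huv : topMon k σ (p ^ e) - u * v ∈ frobPow (Ideal.span (Set.range (X : σ → MvPolynomial σ k))) (p ^ e))
    (hcount : ∀ n, socCount (weightedHomogeneousSubmodule k w) (frobPow I (p ^ e) ⊔ C) n = 0 ∨
      ∃ j, (p ^ e - 1) * ∑ i, w i + p ^ e * j = δ + n ∧
        socCount (weightedHomogeneousSubmodule k w) (frobPow I (p ^ e) ⊔ C) n =
        socCount (weightedHomogeneousSubmodule k w) I j) :
    ∀ n f, IsWeightedHomogeneous w f n → u * f ∈ frobPow I (p ^ e) → f ∈ frobPow I (p ^ e) ⊔ C := by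
  set B := frobPow I (p ^ e) with hB
  have hBh : IsWHomogeneousIdeal w B := wh_frob p e hI
  obtain ⟨D, hD⟩ := hArt
  suffices H : ∀ t n f, D ≤ n + t → IsWeightedHomogeneous w f n → u * f ∈ B → f ∈ B ⊔ C from
    fun n f => H D n f (by omega)
  intro t
  induction t with
  | zero => intro n f hn hf _; exact Ideal.mem_sup_left (hD n hn f hf)
  | succ t ih =>
    intro n f hn hf huf
    have hsoc : ∀ h, IsWeightedHomogeneous w h n → Soc B (u * h) → Soc (B ⊔ C) h := by
      intro h hh hs i
      refine ih (w i + n) _ (by have := hw i; omega) ((X_wh w i).mul hh) ?_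
      rw [mul_left_comm]; exact hs i
    have hfin := fin_inf (k := k) hw n (Submodule.restrictScalars k ((B ⊔ C).colon (irrel (weightedHomogeneousSubmodule k w))))
    have hle : ∀ (J : Ideal (MvPolynomial σ k)) n, Submodule.restrictScalars k J ⊓ weightedHomogeneousSubmodule k w n ≤
        Submodule.restrictScalars k (J.colon (irrel (weightedHomogeneousSubmodule k w))) ⊓ weightedHomogeneousSubmodule k w n := by
      intro J n
      refine inf_le_inf_right _ fun f hf => ?_
      exact Submodule.mem_colon.2 fun s _ => J.mul_mem_right _ hf
    have hmem : ∀ h, IsWeightedHomogeneous w h n → Soc B (u * h) → h ∈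
        Submodule.restrictScalars k ((B ⊔ C).colon (irrel (weightedHomogeneousSubmodule k w))) ⊓ weightedHomogeneousSubmodule k w n :=
      fun h hh hs => ⟨(mem_colon_irrel hw).2 (hsoc h hh hs), hh⟩
    have hfX := hmem f hf (fun i => B.mul_mem_left _ huf)
    rcases hcount n with h0 | ⟨j, hj, hcnt⟩
    · rw [← dim_zero (hle (B ⊔ C) n) h0] at hfX
      exact hfX.1
    · have hfin2 := fin_inf (k := k) hw j (Submodule.restrictScalars k (I.colon (irrel (weightedHomogeneousSubmodule k w))))
      obtain ⟨g, hg, hgi⟩ := dim_indep (hle I j) hcnt.symm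
      have hgh : ∀ i, IsWeightedHomogeneous w (g i) j := fun i => (hg i).2
      have hgs : ∀ i, Soc I (g i) := fun i => (mem_colon_irrel hw).1 (hg i).1
      have hcong : ∀ i, u * weightedHomogeneousComponent w n (v * g i ^ p ^ e) - topMon k σ (p ^ e) * g i ^ p ^ e ∈ B := by
        intro i
        have h1 : (topMon k σ (p ^ e) - u * v) * g i ^ p ^ e ∈ B :=
          frob_mul_pow (fun y hy => mem_aug_mul (hgs i) hy) huv
        have h2 : IsWeightedHomogeneous w (topMon k σ (p ^ e) * g i ^ p ^ e) (δ + n) := by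
          rw [← hj]; simpa using (topMon_wh (k := k) (w := w) (p ^ e)).mul ((hgh i).pow (p ^ e))
        have h3 := hBh _ h1 (δ + n)
        rw [sub_mul, map_sub, h2.weightedHomogeneousComponent_same, mul_assoc, comp_mul hu] at h3
        rw [← B.neg_mem_iff, neg_sub]
        exact h3
      let F : MvPolynomial σ k →ₗ[k] (MvPolynomial σ k ⧸ (B.restrictScalars k)) :=
        (B.restrictScalars k).mkQ ∘ₗ LinearMap.mulLeft k u
      have hF : ∀ x, F x = 0 ↔ u * x ∈ B := fun x => Submodule.Quotient.mk_eq_zero (B.restrictScalars k)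
      have := dim_ker (hle (B ⊔ C) n) rfl F ?_ (fun i => weightedHomogeneousComponent w n (v * g i ^ p ^ e)) ?_ ?_ f hfX ((hF f).2 huf)
      · exact this.1
      · rintro x ⟨hx, -⟩
        rw [hF]
        obtain ⟨b, hb, c, hc, rfl⟩ := Submodule.mem_sup.1 hx
        rw [mul_add]
        exact B.add_mem (B.mul_mem_left _ hb) (frob_mono hCI _ (huC c hc))
      · intro i
        refine hmem _ (weightedHomogeneousComponent_isWeightedHomogeneous n _) fun x => ?_
        have := B.add_mem (B.mul_mem_left (X x) (hcong i)) (soc_top p e (hgs i) x)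
        rw [← mul_add, sub_add_cancel] at this
        exact this
      · rw [linearIndependent_iff']
        intro s c hc
        refine indep_frob (J := I) p e s g ?_ c ?_
        · intro c hc
          refine hgi s c ⟨?_, ?_⟩
          · simp only [C_mul'] at hc
            exact hc
          · exact Submodule.sum_mem _ fun i _ => Submodule.smul_mem _ _ (hgh i)
        · have h1 : F (∑ i ∈ s, c i • weightedHomogeneousComponent w n (v * g i ^ p ^ e)) = 0 := by
            simpa only [map_sum, map_smul] using hc
          rw [hF, Finset.mul_sum] at h1
          have h2 : ∑ i ∈ s, MvPolynomial.C (c i) * (u * weightedHomogeneousComponent w n (v * g i ^ p ^ e) - topMon k σ (p ^ e) * g i ^ p ^ e) ∈ B :=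
            B.sum_mem fun i _ => B.mul_mem_left _ (hcong i)
          convert B.sub_mem h1 h2 using 1
          rw [← Finset.sum_sub_distrib]
          refine Finset.sum_congr rfl fun i _ => ?_
          rw [← C_mul']
          ring
end MainStep


/-- **Proposition 6.2.** Let `R = P/C` be Gorenstein and F-pure, `S = R/IR` artinian with
socle degrees `d 0 ≤ … ≤ d (ℓ-1)`, and suppose the socle of `F_R^e(S)` has the same
dimension `ℓ` with socle degrees `D i = q·d i - (q-1)·a(R)`.  Then
`(C^{[q]} + I^{[q]}) : (C^{[q]} : C) = C + I^{[q]}`. -/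
theorem socle_degrees_stmt18
    {k : Type} [Field k] (p : ℕ) [Fact p.Prime] [CharP k p]
    {σ : Type} [Fintype σ] (w : σ → ℕ) (hw : ∀ i, 0 < w i)
    (e : ℕ) (he : 0 < e) (q : ℕ) (hq : q = p ^ e)
    (C : Ideal (MvPolynomial σ k)) (hChom : IsWHomogeneousIdeal w C)
    (hGor : IsGorensteinGraded (fun n =>
      Submodule.map (Ideal.Quotient.mkₐ k C).toLinearMap
        (MvPolynomial.weightedHomogeneousSubmodule k w n)))
    (hFp : IsFPureRing (MvPolynomial σ k ⧸ C) p)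
    (I : Ideal (MvPolynomial σ k)) (hI : IsWHomogeneousIdeal w I) (hCI : C ≤ I)
    (hIprim : I.radical = irrel (MvPolynomial.weightedHomogeneousSubmodule k w))
    (a : ℤ) (ha : IsAInv (MvPolynomial.weightedHomogeneousSubmodule k w) C a)
    {ℓ : ℕ} (d : Fin ℓ → ℕ)
    (hd : HasSocleDegrees (MvPolynomial.weightedHomogeneousSubmodule k w) I d)
    (hDpos : ∀ i, (0 : ℤ) ≤ (q : ℤ) * d i - ((q : ℤ) - 1) * a)
    (hD : ∀ n : ℕ,
      socCount (MvPolynomial.weightedHomogeneousSubmodule k w) (frobPow I q + C) n =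
        (univ.filter fun i => (q : ℤ) * d i - ((q : ℤ) - 1) * a = (n : ℤ)).card) :
    (frobPow C q + frobPow I q).colon ((frobPow C q).colon C) = C + frobPow I q := by
  subst hq
  obtain ⟨l, deg, z, t, hl, hreg, hG, hrad⟩ := gor_unpack hw hChom hGor
  have hJl : IsWHomogeneousIdeal w (C ⊔ Ideal.ofList l) :=
    wh_sup hChom (wh_span fun y hy => ⟨_, (hl y hy).2⟩)
  have haeq := a_eq hw deg l hl hChom hreg hJl (art_of_radical hrad) hG ha
  obtain ⟨δ, u, hδ, hu, huC, hum⟩ := exists_u p e hw hChom hFp hl hreg hG hrad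
  obtain ⟨v, huv⟩ := exists_v p e hw hu hum
  have hIrad : ∀ i, (MvPolynomial.X i : MvPolynomial σ k) ∈ I.radical := by
    intro i
    rw [hIprim, irrel_eq hw]
    exact Ideal.subset_span ⟨i, rfl⟩
  have hqp := qpos p e
  obtain ⟨r, hr⟩ : ∃ r, p ^ e = r + 1 := ⟨p ^ e - 1, by omega⟩
  have hcount : ∀ n, socCount (MvPolynomial.weightedHomogeneousSubmodule k w) (frobPow I (p ^ e) ⊔ C) n = 0 ∨
      ∃ j, (p ^ e - 1) * ∑ i, w i + p ^ e * j = δ + n ∧ 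
        socCount (MvPolynomial.weightedHomogeneousSubmodule k w) (frobPow I (p ^ e) ⊔ C) n = 
        socCount (MvPolynomial.weightedHomogeneousSubmodule k w) I j := by
    intro n
    have hDn := hD n
    rw [Submodule.add_eq_sup] at hDn
    rw [hDn]
    rcases Finset.eq_empty_or_nonempty (univ.filter fun i => ((p ^ e : ℕ) : ℤ) * d i - (((p ^ e : ℕ) : ℤ) - 1) * a = (n : ℤ)) with h | ⟨i0, hi0⟩
    · left; rw [h, Finset.card_empty]
    · right
      have hi0' := (Finset.mem_filter.1 hi0).2
      refine ⟨d i0, ?_, ?_⟩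
      · rw [hr] at hi0' hδ ⊢
        rw [haeq] at hi0'
        rw [Nat.add_sub_cancel] at hδ ⊢
        zify at hδ ⊢
        push_cast at hi0'
        linarith
      · rw [hd.2]
        congr 1
        ext i
        simp only [Finset.mem_filter, Finset.mem_univ, true_and]
        rw [← hi0', sub_left_inj]
        have : ((p ^ e : ℕ) : ℤ) ≠ 0 := by exact_mod_cast hqp.ne'
        rw [mul_right_inj' this]
        exact Nat.cast_inj
  have key := main_ind p e hw hChom hI hCI (art_of_radical (rad_frob p e hIrad)) hu huC huv hcount
  have hCle : frobPow C (p ^ e) ≤ frobPow I (p ^ e) := frob_mono hCI _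
  rw [Submodule.add_eq_sup, Submodule.add_eq_sup, sup_eq_right.2 hCle, sup_comm]
  apply le_antisymm
  · intro f hf
    rw [Submodule.mem_colon] at hf
    have h1 : f * u ∈ frobPow I (p ^ e) := hf u (Submodule.mem_colon.2 fun c hc => huC c hc)
    refine mem_of_comp w fun n => key n _ (MvPolynomial.weightedHomogeneousComponent_isWeightedHomogeneous n f) ?_
    rw [← comp_mul hu]
    rw [mul_comm] at h1
    exact wh_frob p e hI _ h1 _
  · refine sup_le (fun f hf => Submodule.mem_colon.2 fun s _ => Ideal.mul_mem_right _ _ hf) fun f hf => ?_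
    refine Submodule.mem_colon.2 fun s hs => hCle ?_
    have := Submodule.mem_colon.1 hs f hf
    rw [smul_eq_mul, mul_comm]
    exact this
end
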